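/- Let X₁,…,Xₙ be i.i.d. from a non-degenerate probability measure μ on ℝ with E[e^{λ|X₁|^p}]<∞ for some p ≥ v and all λ>0, and let {Qₙ} be symmetric matrices with zero diagonal such that δ_□(W_{Qₙ},W)→0 for some W∈𝒲 and limsup_{n→∞}‖W_{Qₙ}‖_{qΔ}<∞ for some q>1 with 1/p+1/q≤1. Then Z_n^{(1)}(θ) := (1/n) log E_{μ^{⊗n}}[e^{nθ·N₁(H,Qₙ,X)}] is finite for all large n and converges, as n→∞, to sup{ θ·G_{1,W}(f) − ∫₀¹ γ(β(f(x)))dx : f∈ℒ, ∫₀¹ γ(β(f(x)))dx < ∞ }. -/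

import Mathlib

open MeasureTheory Filter Set
open scoped ENNReal NNReal

noncomputable section

/-- The uniform probability measure on `[0,1]`. -/
def unif01 : Measure ℝ := volume.restrict (Set.Icc 0 1)

instance : IsProbabilityMeasure unif01 :=
  ⟨by rw [unif01, Measure.restrict_apply_univ, Real.volume_Icc]; norm_num⟩

/-- The `L^r` norm (`r : ℝ≥0∞`) of a kernel, viewed as a function on `[0,1]²`. -/
def kerNorm (W : ℝ → ℝ → ℝ) (r : ℝ≥0∞) : ℝ≥0∞ :=
  eLpNorm (fun z : ℝ × ℝ => W z.1 z.2) r (unif01.prod unif01)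

/-- The (strong) cut distance `d_□` between two kernels on `[0,1]²`. -/
def cutDist (W₁ W₂ : ℝ → ℝ → ℝ) : ℝ :=
  ⨆ S : {S : Set ℝ // MeasurableSet S}, ⨆ T : {T : Set ℝ // MeasurableSet T},
    |∫ x in Set.Icc (0:ℝ) 1 ∩ S.1, ∫ y in Set.Icc (0:ℝ) 1 ∩ T.1, (W₁ x y - W₂ x y)|

/-- A Lebesgue-measure-preserving bijection of `[0,1]`. -/
def MPB (σ : ℝ → ℝ) : Prop :=
  Set.BijOn σ (Set.Icc 0 1) (Set.Icc 0 1) ∧ MeasurePreserving σ unif01 unif01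

/-- The weak cut distance `δ_□`. -/
def weakCutDist (W₁ W₂ : ℝ → ℝ → ℝ) : ℝ :=
  ⨅ σ : {σ : ℝ → ℝ // MPB σ}, cutDist (fun x y => W₁ (σ.1 x) (σ.1 y)) W₂

/-- The step kernel `W_{Q_n}` associated to an `n × n` matrix `Q`:
it equals `Q i j` when `⌈n x⌉ = i, ⌈n y⌉ = j`. -/
def stepKernel (n : ℕ) (Q : Fin n → Fin n → ℝ) : ℝ → ℝ → ℝ := fun x y =>
  ∑ i : Fin n, ∑ j : Fin n,
    if x ∈ Set.Ioc (((i : ℕ) : ℝ)/n) ((((i : ℕ) : ℝ)+1)/n) ∧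
       y ∈ Set.Ioc (((j : ℕ) : ℝ)/n) ((((j : ℕ) : ℝ)+1)/n)
    then Q i j else 0

/-- Product over the edges of `H` (each edge counted once) of `f a b`. -/
def edgeProd {v : ℕ} (G : SimpleGraph (Fin v)) [DecidableRel G.Adj]
    (f : Fin v → Fin v → ℝ) : ℝ :=
  ∏ p ∈ Finset.univ.filter (fun p : Fin v × Fin v => G.Adj p.1 p.2 ∧ p.1 < p.2), f p.1 p.2

/-- The number of edges `|E(H)|`. -/
def edgeCard {v : ℕ} (G : SimpleGraph (Fin v)) [DecidableRel G.Adj] : ℕ :=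
  (Finset.univ.filter (fun p : Fin v × Fin v => G.Adj p.1 p.2 ∧ p.1 < p.2)).card

/-- The inhomogeneous U-statistic `U_n(X)` (sum over distinct indices). -/
def Ustat {X : Type*} {v : ℕ} (G : SimpleGraph (Fin v)) [DecidableRel G.Adj]
    (φ : (Fin v → X) → ℝ) (n : ℕ) (Q : Fin n → Fin n → ℝ) (x : Fin n → X) : ℝ :=
  (∑ i ∈ Finset.univ.filter (fun i : Fin v → Fin n => Function.Injective i),
      φ (x ∘ i) * edgeProd G (fun a b => Q (i a) (i b))) / (n : ℝ) ^ v

/-- The inhomogeneous V-statistic `V_n(X)` (sum over all indices). -/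
def Vstat {X : Type*} {v : ℕ} (G : SimpleGraph (Fin v)) [DecidableRel G.Adj]
    (φ : (Fin v → X) → ℝ) (n : ℕ) (Q : Fin n → Fin n → ℝ) (x : Fin n → X) : ℝ :=
  (∑ i : Fin v → Fin n, φ (x ∘ i) * edgeProd G (fun a b => Q (i a) (i b))) / (n : ℝ) ^ v

open Classical in
/-- Kullback-Leibler divergence `D(ν | ρ) ∈ [0,∞]`. -/
def KLdiv {α : Type*} [MeasurableSpace α] (ν ρ : Measure α) : ℝ≥0∞ :=
  if ν ≪ ρ ∧ Integrable (llr ν ρ) ν then ENNReal.ofReal (∫ a, llr ν ρ a ∂ν) else ⊤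

open Classical in
/-- `ν` itself if it is a probability measure, junk value `0` otherwise. -/
def probOr {α : Type*} [MeasurableSpace α] (ν : Measure α) : Measure α :=
  if IsProbabilityMeasure ν then ν else 0

instance {α : Type*} [MeasurableSpace α] (ν : Measure α) : SigmaFinite (probOr ν) := by
  unfold probOr
  split_ifs with h
  · haveI := h; infer_instance
  · infer_instance

/-- `v`-fold product of a (probability) measure. -/
def piProb {α : Type*} [MeasurableSpace α] (v : ℕ) (ν : Measure α) : Measure (Fin v → α) :=
  Measure.pi fun _ => probOr ν

/-- The functional `T_{W,φ}(ν) = E[φ(B₁,…,B_v) ∏_{(a,b) ∈ E(H)} W(A_a,A_b)]`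
for `(A_a,B_a)` i.i.d. with law `ν`. -/
def TWphi {X : Type*} [MeasurableSpace X] {v : ℕ} (G : SimpleGraph (Fin v))
    [DecidableRel G.Adj] (W : ℝ → ℝ → ℝ) (φ : (Fin v → X) → ℝ)
    (ν : Measure (ℝ × X)) : ℝ :=
  ∫ z : Fin v → ℝ × X,
    φ (fun a => (z a).2) * edgeProd G (fun a b => W (z a).1 (z b).1) ∂(piProb v ν)

/-- Membership in `𝒯ℳ`: probability measures on `[0,1] × 𝒳` whose first marginal
is uniform on `[0,1]`. -/
def inTM {X : Type*} [MeasurableSpace X] (ν : Measure (ℝ × X)) : Prop :=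
  IsProbabilityMeasure ν ∧ ν.map Prod.fst = unif01

/-- The rate function `I₀(t) = inf { D(ν|ρ) : ν ∈ 𝒯ℳ, D(ν|ρ) < ∞, T_{W,φ}(ν) = t }`. -/
def rate0 {X : Type*} [MeasurableSpace X] {v : ℕ} (G : SimpleGraph (Fin v))
    [DecidableRel G.Adj] (W : ℝ → ℝ → ℝ) (φ : (Fin v → X) → ℝ) (μ : Measure X)
    (t : ℝ) : ℝ≥0∞ :=
  ⨅ ν : {ν : Measure (ℝ × X) //
      inTM ν ∧ KLdiv ν (unif01.prod μ) ≠ ⊤ ∧ TWphi G W φ ν = t},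
    KLdiv ν.1 (unif01.prod μ)

/-- Tail assumption (T): `E_μ[e^{λ ψ(X)^p}] < ∞` for all `λ > 0`; for `p = ∞`
it means `ψ` is bounded. -/
def TailCond {X : Type*} [MeasurableSpace X] (μ : Measure X) (ψ : X → ℝ)
    (p : ℝ≥0∞) : Prop :=
  if p = ⊤ then ∃ C : ℝ, ∀ x, ψ x ≤ C
  else ∀ lam : ℝ, 0 < lam →
    ∫⁻ x, ENNReal.ofReal (Real.exp (lam * ψ x ^ p.toReal)) ∂μ < ⊤

/-- A sequence of random elements `T n` defined on probability spaces `(Ω n, P n)`,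
taking values in a topological space `E`, satisfies a large deviation principle at
speed `n` with good rate function `I`. -/
def SatisfiesLDP {E : Type*} [TopologicalSpace E] {Ω : ℕ → Type*}
    [∀ n, MeasurableSpace (Ω n)] (P : ∀ n, Measure (Ω n)) (T : ∀ n, Ω n → E)
    (I : E → ℝ≥0∞) : Prop :=
  (∀ c : ℝ≥0∞, c ≠ ⊤ → IsCompact {x | I x ≤ c}) ∧
  ∀ F : Set E, MeasurableSet[borel E] F →
    (-(⨅ x ∈ interior F, (I x : EReal)) ≤
      Filter.atTop.liminf fun n : ℕ =>
        (((n : ℝ)⁻¹ : ℝ) : EReal) * ENNReal.log (P n {ω | T n ω ∈ F})) ∧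
    (Filter.atTop.limsup (fun n : ℕ =>
        (((n : ℝ)⁻¹ : ℝ) : EReal) * ENNReal.log (P n {ω | T n ω ∈ F})) ≤
      -(⨅ x ∈ closure F, (I x : EReal)))

end
/-- The log-normalizing constant `Z_n(θ) = (1/n) log E_{μ^{⊗n}}[e^{nθ f_n(X)}]`. -/
noncomputable def ZnGen {X : Type*} [MeasurableSpace X] (μ : Measure X)
    [IsProbabilityMeasure μ] (f : ∀ n : ℕ, (Fin n → X) → ℝ) (n : ℕ) (θ : ℝ) : ℝ :=
  (n : ℝ)⁻¹ *
    Real.log (∫ x, Real.exp (n * θ * f n x) ∂(Measure.pi fun _ : Fin n => μ))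

/-- The Gibbs measure `R_{n,θ}` with Hamiltonian `f n`, having density
`exp(nθ f_n(x) − n Z_n(θ))` with respect to `μ^{⊗n}`. -/
noncomputable def GibbsMeasure {X : Type*} [MeasurableSpace X] (μ : Measure X)
    [IsProbabilityMeasure μ] (f : ∀ n : ℕ, (Fin n → X) → ℝ) (n : ℕ) (θ : ℝ) :
    Measure (Fin n → X) :=
  (Measure.pi fun _ : Fin n => μ).withDensity fun x =>
    ENNReal.ofReal (Real.exp (n * θ * f n x - n * ZnGen μ f n θ))

/-- The set `{θ T_{W,φ}(ν) − D(ν|ρ) : ν ∈ 𝒯ℳ, D(ν|ρ) < ∞}` whose supremum is `Z(θ)`. -/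
def Zset {X : Type*} [MeasurableSpace X] {v : ℕ} (G : SimpleGraph (Fin v))
    [DecidableRel G.Adj] (W : ℝ → ℝ → ℝ) (φ : (Fin v → X) → ℝ) (μ : Measure X)
    (θ : ℝ) : Set ℝ :=
  {z : ℝ | ∃ ν : Measure (ℝ × X), inTM ν ∧ KLdiv ν (unif01.prod μ) ≠ ⊤ ∧
    z = θ * TWphi G W φ ν - (KLdiv ν (unif01.prod μ)).toReal}
/-- The cumulant generating function `α(θ) = log ∫ e^{θx} dμ(x)`. -/
noncomputable def cgf' (μ : Measure ℝ) (θ : ℝ) : ℝ := Real.log (∫ x, Real.exp (θ * x) ∂μ)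

/-- `𝒩 = α'(ℝ)`, the range of the derivative of the cgf. -/
def Ncal (μ : Measure ℝ) : Set ℝ := Set.range (deriv (cgf' μ))

/-- The function `u ↦ γ(β(u))` appearing in the multilinear rate function. On `cl(𝒩)`
it coincides (by convex duality) with the Legendre transform `sup_θ {θu − α(θ)}`,
which is the formula used here; its values lie in `[0,∞]`. -/
noncomputable def gammaBeta (μ : Measure ℝ) (u : ℝ) : ℝ≥0∞ :=
  ⨆ θ : ℝ, ENNReal.ofReal (θ * u - cgf' μ θ)

/-- The class `ℒ` of measurable `f : [0,1] → cl(𝒩)` with `∫₀¹ |f|^p < ∞`. -/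
def Lcal (μ : Measure ℝ) (p : ℝ≥0∞) : Set (ℝ → ℝ) :=
  {f | Measurable f ∧ (∀ u ∈ Set.Icc (0 : ℝ) 1, f u ∈ closure (Ncal μ)) ∧
    eLpNorm f p unif01 < ⊤}

/-- The functional `G_{1,W}(f) = ∫_{[0,1]^v} ∏_{(a,b) ∈ E(H)} W(x_a,x_b) ∏_a f(x_a) dx`. -/
noncomputable def G1 {v : ℕ} (G : SimpleGraph (Fin v)) [DecidableRel G.Adj]
    (W : ℝ → ℝ → ℝ) (f : ℝ → ℝ) : ℝ :=
  ∫ x : Fin v → ℝ, edgeProd G (fun a b => W (x a) (x b)) * ∏ a, f (x a)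
    ∂(Measure.pi fun _ : Fin v => unif01)

/-- The rate function `I₁` for multilinear forms. -/
noncomputable def rate1 {v : ℕ} (G : SimpleGraph (Fin v)) [DecidableRel G.Adj]
    (W : ℝ → ℝ → ℝ) (μ : Measure ℝ) (p : ℝ≥0∞) (t : ℝ) : ℝ≥0∞ :=
  ⨅ f : {f : ℝ → ℝ // f ∈ Lcal μ p ∧ (∫⁻ u, gammaBeta μ (f u) ∂unif01) ≠ ⊤ ∧
      G1 G W f = t},
    ∫⁻ u, gammaBeta μ (f.1 u) ∂unif01
/-- The set whose supremum gives the limit of `Z_n^{(1)}(θ)`. -/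
def Zset1 {v : ℕ} (G : SimpleGraph (Fin v)) [DecidableRel G.Adj] (W : ℝ → ℝ → ℝ)
    (μ : Measure ℝ) (p : ℝ≥0∞) (θ : ℝ) : Set ℝ :=
  {z : ℝ | ∃ f ∈ Lcal μ p, (∫⁻ u, gammaBeta μ (f u) ∂unif01) ≠ ⊤ ∧
    z = θ * G1 G W f - (∫⁻ u, gammaBeta μ (f u) ∂unif01).toReal}

namespace MGL

theorem lintegral_pi_prod {ι : Type*} [Fintype ι] {α : Type*} [MeasurableSpace α]
    (μ : ι → Measure α) [∀ i, IsProbabilityMeasure (μ i)] (f : ι → α → ℝ≥0∞)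
    (hf : ∀ i, Measurable (f i)) :
    ∫⁻ x, ∏ i, f i (x i) ∂(Measure.pi μ) = ∏ i, ∫⁻ y, f i y ∂(μ i) := by
  have h := ProbabilityTheory.iIndepFun_pi (μ := μ) (X := f) (fun i => (hf i).aemeasurable)
  rw [ProbabilityTheory.lintegral_prod_eq_prod_lintegral_of_indepFun Finset.univ _ h]
  · refine Finset.prod_congr rfl fun i _ => ?_
    exact (measurePreserving_eval μ i).lintegral_comp (hf i)
  · intro i
    exact (hf i).comp (measurable_pi_apply i)

theorem mp_pair {ι : Type*} [Fintype ι] {α : Type*} [MeasurableSpace α]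
    (μ : ι → Measure α) [∀ i, IsProbabilityMeasure (μ i)] {a b : ι} (hab : a ≠ b) :
    MeasurePreserving (fun x : ι → α => (x a, x b)) (Measure.pi μ) ((μ a).prod (μ b)) := by
  have h := ProbabilityTheory.iIndepFun_pi (μ := μ) (X := fun _ x => x)
    (fun i => aemeasurable_id)
  have h2 := h.indepFun hab
  refine ⟨(measurable_pi_apply a).prodMk (measurable_pi_apply b), ?_⟩
  rw [(ProbabilityTheory.indepFun_iff_map_prod_eq_prod_map_map
    (measurable_pi_apply a).aemeasurable (measurable_pi_apply b).aemeasurable).1 h2]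
  congr 1
  · exact (measurePreserving_eval μ a).map_eq
  · exact (measurePreserving_eval μ b).map_eq

theorem mp_update {ι : Type*} [Fintype ι] [DecidableEq ι] {α : Type*} [MeasurableSpace α]
    (μ : ι → Measure α) [∀ i, IsProbabilityMeasure (μ i)] (a : ι) :
    MeasurePreserving (fun z : (ι → α) × α => Function.update z.1 a z.2)
      ((Measure.pi μ).prod (μ a)) (Measure.pi μ) := by
  have hm : Measurable (fun z : (ι → α) × α => Function.update z.1 a z.2) := by
    rw [measurable_pi_iff]
    intro i
    by_cases h : i = a
    · subst h; simpa using measurable_snd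
    · simp only [Function.update_of_ne h]
      exact (measurable_pi_apply i).comp measurable_fst
  refine ⟨hm, ?_⟩
  symm
  apply Measure.pi_eq
  intro s hs
  rw [Measure.map_apply hm (MeasurableSet.univ_pi hs)]
  have : (fun z : (ι → α) × α => Function.update z.1 a z.2) ⁻¹' (Set.univ.pi s)
      = (Set.univ.pi (Function.update s a Set.univ)) ×ˢ (s a) := by
    ext z
    simp only [Set.mem_preimage, Set.mem_univ_pi, Set.mem_prod]
    constructor
    · intro h
      refine ⟨fun i => ?_, by simpa using h a⟩
      by_cases hi : i = a
      · subst hi; simp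
      · simpa [Function.update_of_ne hi] using h i
    · rintro ⟨h1, h2⟩ i
      by_cases hi : i = a
      · subst hi; simpa using h2
      · simpa [Function.update_of_ne hi] using h1 i
  rw [this, Measure.prod_prod, Measure.pi_pi]
  rw [← Finset.mul_prod_erase _ _ (Finset.mem_univ a),
    ← Finset.mul_prod_erase Finset.univ (fun i => μ i (s i)) (Finset.mem_univ a)]
  simp only [Function.update_self, measure_univ, one_mul]
  rw [mul_comm]
  congr 1
  refine Finset.prod_congr rfl fun i hi => ?_
  rw [Function.update_of_ne (Finset.ne_of_mem_erase hi)]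

theorem finner_aux {ι κ : Type*} [Fintype ι] [DecidableEq ι] {α : Type*} [MeasurableSpace α]
    (ρ : Measure α) [IsProbabilityMeasure ρ] (E : Finset κ) (D : ℕ) (hD : D ≠ 0)
    (U : κ → (ι → α) → ℝ≥0∞) (hU : ∀ e, Measurable (U e))
    (dep : κ → ι → Prop) [∀ e i, Decidable (dep e i)]
    (hdep : ∀ e i, ¬ dep e i → ∀ x y, U e (Function.update x i y) = U e x)
    (hcount : ∀ i, (E.filter (fun e => dep e i)).card ≤ D) (s : Finset ι) (x : ι → α) :
    lmarginal (fun _ => ρ) s (fun x => ∏ e ∈ E, U e x) x ≤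
      ∏ e ∈ E, (lmarginal (fun _ => ρ) s (fun x => U e x ^ (D : ℝ)) x) ^ (1 / (D : ℝ)) := by
  have hD' : (D : ℝ) ≠ 0 := by exact_mod_cast hD
  induction s using Finset.induction generalizing x with
  | empty =>
    simp only [lmarginal_empty]
    apply le_of_eq
    refine Finset.prod_congr rfl fun e _ => ?_
    rw [← ENNReal.rpow_mul, mul_one_div_cancel hD', ENNReal.rpow_one]
  | insert i s hi ih =>
    have hmU : ∀ e, Measurable (fun x => U e x ^ (D : ℝ)) := fun e => (hU e).pow_const _
    rw [lmarginal_insert _ (Finset.measurable_fun_prod _ fun e _ => hU e) hi]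
    set V : κ → (ι → α) → ℝ≥0∞ := fun e => lmarginal (fun _ => ρ) s (fun x => U e x ^ (D : ℝ))
      with hV
    have hVm : ∀ e, Measurable (V e) := fun e => (hmU e).lmarginal _
    have hVdep : ∀ e, ¬ dep e i → ∀ y, V e (Function.update x i y) = V e x := by
      intro e he y
      rw [hV]
      simp only
      rw [lmarginal_update_of_notMem (hmU e) hi]
      congr 1
      funext z
      simp [hdep e i he]
    have hVm' : ∀ e, Measurable (fun y => V e (Function.update x i y)) := fun e =>
      (hVm e).comp (measurable_update x)
    calc ∫⁻ y, lmarginal (fun _ => ρ) s (fun x => ∏ e ∈ E, U e x) (Function.update x i y) ∂ρ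
        ≤ ∫⁻ y, ∏ e ∈ E, (V e (Function.update x i y)) ^ (1 / (D : ℝ)) ∂ρ :=
          lintegral_mono fun y => ih _
      _ = ∫⁻ y, (∏ e ∈ E.filter (fun e => ¬ dep e i), (V e x) ^ (1 / (D : ℝ))) *
            ∏ e ∈ E.filter (fun e => dep e i),
              (V e (Function.update x i y)) ^ (1 / (D : ℝ)) ∂ρ := by
          refine lintegral_congr fun y => ?_
          rw [← Finset.prod_filter_mul_prod_filter_not E (fun e => dep e i), mul_comm]
          congr 1
          refine Finset.prod_congr rfl fun e he => ?_
          rw [hVdep e (Finset.mem_filter.1 he).2]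
      _ = (∏ e ∈ E.filter (fun e => ¬ dep e i), (V e x) ^ (1 / (D : ℝ))) *
            ∫⁻ y, ∏ e ∈ E.filter (fun e => dep e i),
              (V e (Function.update x i y)) ^ (1 / (D : ℝ)) ∂ρ := by
          rw [lintegral_const_mul]
          exact Finset.measurable_fun_prod _ fun e _ => (hVm' e).pow_const _
      _ ≤ (∏ e ∈ E.filter (fun e => ¬ dep e i), (V e x) ^ (1 / (D : ℝ))) *
            ∏ e ∈ E.filter (fun e => dep e i),
              (∫⁻ y, V e (Function.update x i y) ∂ρ) ^ (1 / (D : ℝ)) := by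
          gcongr
          have := ENNReal.lintegral_mul_prod_norm_pow_le (μ := ρ)
            (E.filter (fun e => dep e i)) (g := fun _ => 1)
            (f := fun e y => V e (Function.update x i y)) aemeasurable_const
            (fun e _ => (hVm' e).aemeasurable)
            (1 - (E.filter (fun e => dep e i)).card * (1 / (D : ℝ)))
            (p := fun _ => 1 / (D : ℝ)) (by simp) (by
              have h1 : ((E.filter (fun e => dep e i)).card : ℝ) ≤ D := by
                exact_mod_cast hcount i
              have h2 : (0 : ℝ) < D := by positivity
              rw [mul_one_div, sub_nonneg, div_le_one h2]
              exact h1) (fun _ _ => by positivity)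
          simpa using this
      _ = ∏ e ∈ E, (lmarginal (fun _ => ρ) (insert i s)
            (fun x => U e x ^ (D : ℝ)) x) ^ (1 / (D : ℝ)) := by
          rw [← Finset.prod_filter_mul_prod_filter_not E (fun e => dep e i), mul_comm]
          congr 1
          · refine Finset.prod_congr rfl fun e he => ?_
            rw [lmarginal_insert _ (hmU e) hi]
          · refine Finset.prod_congr rfl fun e he => ?_
            rw [lmarginal_insert _ (hmU e) hi]
            have : ∀ y, lmarginal (fun _ => ρ) s (fun x => U e x ^ (D : ℝ))
              (Function.update x i y) = V e x := fun y => hVdep e (Finset.mem_filter.1 he).2 y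
            simp only [this, lintegral_const, measure_univ, mul_one, V]

end MGL

namespace MGL

theorem abs_int_le_two {α : Type*} [MeasurableSpace α] (ρ : Measure α) (h : α → ℝ)
    (hm : Measurable h) (hi : Integrable h ρ) (c : ℝ)
    (hc : ∀ S, MeasurableSet S → |∫ x in S, h x ∂ρ| ≤ c) : ∫ x, |h x| ∂ρ ≤ 2 * c := by
  have hS : MeasurableSet {x | 0 ≤ h x} := measurableSet_le measurable_const hm
  have h1 := integral_add_compl hS hi.abs
  have h2 : ∫ x in {x | 0 ≤ h x}, |h x| ∂ρ = ∫ x in {x | 0 ≤ h x}, h x ∂ρ :=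
    setIntegral_congr_fun hS fun x hx => abs_of_nonneg hx
  have h3 : ∫ x in {x | 0 ≤ h x}ᶜ, |h x| ∂ρ = ∫ x in {x | 0 ≤ h x}ᶜ, - h x ∂ρ :=
    setIntegral_congr_fun hS.compl fun x hx => abs_of_nonpos (le_of_lt (by simpa using hx))
  rw [integral_neg] at h3
  have h4 := (abs_le.1 (hc _ hS)).2
  have h5 := (abs_le.1 (hc _ hS.compl)).1
  linarith

theorem abs_int_mul_le {α : Type*} [MeasurableSpace α] (ρ : Measure α) (h u : α → ℝ)
    (hi : Integrable h ρ) (R : ℝ) (hR : ∀ x, |u x| ≤ R) :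
    |∫ x, h x * u x ∂ρ| ≤ R * ∫ x, |h x| ∂ρ := by
  calc |∫ x, h x * u x ∂ρ| ≤ ∫ x, |h x * u x| ∂ρ := abs_integral_le_integral_abs
    _ ≤ ∫ x, R * |h x| ∂ρ := by
        refine integral_mono_of_nonneg (ae_of_all _ fun x => abs_nonneg _)
          (hi.abs.const_mul R) (ae_of_all _ fun x => ?_)
        simp only [abs_mul]
        rw [mul_comm]
        exact mul_le_mul_of_nonneg_right (hR x) (abs_nonneg _)
    _ = R * ∫ x, |h x| ∂ρ := integral_const_mul _ _

theorem cut_fun {α : Type*} [MeasurableSpace α] (ρ : Measure α) [IsProbabilityMeasure ρ]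
    (D : α → α → ℝ) (hDm : Measurable (Function.uncurry D))
    (hDi : Integrable (Function.uncurry D) (ρ.prod ρ)) (η R : ℝ) (hR0 : 0 ≤ R)
    (hcut : ∀ S T, MeasurableSet S → MeasurableSet T →
      |∫ s in S, ∫ t in T, D s t ∂ρ ∂ρ| ≤ η)
    (u w : α → ℝ) (hw : Measurable w) (huR : ∀ s, |u s| ≤ R)
    (hwR : ∀ s, |w s| ≤ R) :
    |∫ s, ∫ t, D s t * (u s * w t) ∂ρ ∂ρ| ≤ 4 * R ^ 2 * η := by
  have hDw : Integrable (Function.uncurry fun s t => D s t * w t) (ρ.prod ρ) := by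
    have := hDi.mul_bdd (c := R) (g := fun z : α × α => w z.2)
      (hw.comp measurable_snd).aestronglyMeasurable (ae_of_all _ fun z => hwR z.2)
    exact this
  have hDwm : Measurable (Function.uncurry fun s t => D s t * w t) :=
    hDm.mul (hw.comp measurable_snd)
  set h : α → ℝ := fun s => ∫ t, D s t * w t ∂ρ with hh
  have hhm : Measurable h := by
    have := (hDwm.stronglyMeasurable.integral_prod_right (ν := ρ))
    exact this.measurable
  have hhi : Integrable h ρ := hDw.integral_prod_left
  have e1 : ∫ s, ∫ t, D s t * (u s * w t) ∂ρ ∂ρ = ∫ s, h s * u s ∂ρ := by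
    refine integral_congr_ae (ae_of_all _ fun s => ?_)
    simp only [hh]
    rw [← integral_mul_const]
    congr 1; funext t; ring
  rw [e1]
  have key : ∀ S, MeasurableSet S → |∫ s in S, h s ∂ρ| ≤ 2 * R * η := by
    intro S hS
    have hDS : Integrable (Function.uncurry D) ((ρ.restrict S).prod ρ) := by
      have : (ρ.restrict S).prod ρ = (ρ.prod ρ).restrict (S ×ˢ Set.univ) := by
        rw [← Measure.prod_restrict, Measure.restrict_univ]
      rw [this]; exact hDi.restrict
    have hDSw : Integrable (Function.uncurry fun s t => D s t * w t) ((ρ.restrict S).prod ρ) := by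
      have := hDS.mul_bdd (c := R) (g := fun z : α × α => w z.2)
        (hw.comp measurable_snd).aestronglyMeasurable (ae_of_all _ fun z => hwR z.2)
      exact this
    set k : α → ℝ := fun t => ∫ s in S, D s t ∂ρ with hk
    have hkm : Measurable k := by
      have : StronglyMeasurable fun t => ∫ s, D s t ∂(ρ.restrict S) :=
        hDm.stronglyMeasurable.integral_prod_left' (μ := ρ.restrict S) (f := Function.uncurry D)
      exact this.measurable
    have hki : Integrable k ρ := hDS.integral_prod_right
    have e2 : ∫ s in S, h s ∂ρ = ∫ t, k t * w t ∂ρ := by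
      simp only [hh]
      rw [integral_integral_swap hDSw]
      refine integral_congr_ae (ae_of_all _ fun t => ?_)
      simp only [hk]
      rw [← integral_mul_const]
    rw [e2]
    refine (abs_int_mul_le ρ k w hki R hwR).trans ?_
    have : ∫ t, |k t| ∂ρ ≤ 2 * η := by
      refine abs_int_le_two ρ k hkm hki η fun T hT => ?_
      have hDT : Integrable (Function.uncurry D) ((ρ.restrict S).prod (ρ.restrict T)) := by
        rw [Measure.prod_restrict]; exact hDi.restrict
      have e3 : ∫ t in T, k t ∂ρ = ∫ s in S, ∫ t in T, D s t ∂ρ ∂ρ := by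
        simp only [hk]
        rw [integral_integral_swap hDT]
      rw [e3]; exact hcut S T hS hT
    nlinarith
  refine (abs_int_mul_le ρ h u hhi R huR).trans ?_
  have := abs_int_le_two ρ h hhm hhi _ key
  nlinarith

theorem cut_edge {ι : Type*} [Fintype ι] [DecidableEq ι] {α : Type*} [MeasurableSpace α]
    (ρ : Measure α) [IsProbabilityMeasure ρ]
    (D : α → α → ℝ) (hDm : Measurable (Function.uncurry D))
    (hDi : Integrable (Function.uncurry D) (ρ.prod ρ)) (η R : ℝ) (hR0 : 0 ≤ R)
    (hcut : ∀ S T, MeasurableSet S → MeasurableSet T →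
      |∫ s in S, ∫ t in T, D s t ∂ρ ∂ρ| ≤ η)
    {a b : ι} (hab : a ≠ b) (Φ Ψ : (ι → α) → ℝ) (hΦ : Measurable Φ) (hΨ : Measurable Ψ)
    (hΦR : ∀ x, |Φ x| ≤ R) (hΨR : ∀ x, |Ψ x| ≤ R)
    (hΦb : ∀ x t, Φ (Function.update x b t) = Φ x)
    (hΨa : ∀ x t, Ψ (Function.update x a t) = Ψ x) :
    |∫ x, D (x a) (x b) * (Φ x * Ψ x) ∂(Measure.pi fun _ : ι => ρ)| ≤ 4 * R ^ 2 * η := by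
  set P := Measure.pi fun _ : ι => ρ with hP
  have hDx : Integrable (fun x : ι → α => D (x a) (x b)) P :=
    (mp_pair (fun _ : ι => ρ) hab).integrable_comp_of_integrable hDi
  have hF : Integrable (fun x : ι → α => D (x a) (x b) * (Φ x * Ψ x)) P := by
    refine hDx.mul_bdd (c := R * R) (hΦ.mul hΨ).aestronglyMeasurable (ae_of_all _ fun x => ?_)
    rw [Real.norm_eq_abs, abs_mul]
    exact mul_le_mul (hΦR x) (hΨR x) (abs_nonneg _) hR0
  have mpa := mp_update (fun _ : ι => ρ) a
  have mpb := mp_update (fun _ : ι => ρ) b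
  rw [← hP] at mpa mpb
  have mp : MeasurePreserving (fun z : ((ι → α) × α) × α =>
      Function.update (Function.update z.1.1 a z.1.2) b z.2) ((P.prod ρ).prod ρ) P :=
    mpb.comp (mpa.prod (MeasurePreserving.id ρ))
  have hFc := mp.integrable_comp_of_integrable hF
  have hFc' : Integrable (fun z : ((ι → α) × α) × α => D z.1.2 z.2 *
      (Φ (Function.update z.1.1 a z.1.2) * Ψ (Function.update z.1.1 b z.2)))
      ((P.prod ρ).prod ρ) := by
    refine hFc.congr (ae_of_all _ fun z => ?_)
    simp only [Function.comp_apply, Function.update_self, hΦb, Function.update_of_ne hab]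
    rw [Function.update_comm hab, hΨa]
  have e1 : ∫ x, D (x a) (x b) * (Φ x * Ψ x) ∂P =
      ∫ z : ((ι → α) × α) × α, D z.1.2 z.2 *
      (Φ (Function.update z.1.1 a z.1.2) * Ψ (Function.update z.1.1 b z.2))
      ∂((P.prod ρ).prod ρ) := by
    have h0 := integral_map (f := fun x : ι → α => D (x a) (x b) * (Φ x * Ψ x))
      mp.measurable.aemeasurable (by rw [mp.map_eq]; exact hF.aestronglyMeasurable)
    rw [mp.map_eq] at h0
    rw [h0]
    refine integral_congr_ae (ae_of_all _ fun z => ?_)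
    simp only [Function.update_self, hΦb, Function.update_of_ne hab]
    rw [Function.update_comm hab, hΨa]
  rw [e1, integral_prod _ hFc', integral_prod _ hFc'.integral_prod_left]
  rw [← Real.norm_eq_abs]
  have : ∀ x : ι → α, ‖∫ s, ∫ t, D s t * (Φ (Function.update x a s) *
      Ψ (Function.update x b t)) ∂ρ ∂ρ‖ ≤ 4 * R ^ 2 * η := fun x => by
    rw [Real.norm_eq_abs]
    exact cut_fun ρ D hDm hDi η R hR0 hcut _ _
      (hΨ.comp (measurable_update x)) (fun _ => hΦR _) (fun _ => hΨR _)
  refine (norm_integral_le_of_norm_le_const (ae_of_all _ this)).trans ?_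
  simp

end MGL

namespace MGL

/-- Edge set as a finset of ordered pairs. -/
def edgeF {v : ℕ} (G : SimpleGraph (Fin v)) [DecidableRel G.Adj] : Finset (Fin v × Fin v) :=
  Finset.univ.filter (fun p : Fin v × Fin v => G.Adj p.1 p.2 ∧ p.1 < p.2)

/-- Product over edges of a family of kernels. -/
def KV {v : ℕ} (G : SimpleGraph (Fin v)) [DecidableRel G.Adj]
    (V : Fin v × Fin v → ℝ → ℝ → ℝ) (x : Fin v → ℝ) : ℝ :=
  ∏ e ∈ edgeF G, V e (x e.1) (x e.2)

/-- The product measure on the cube. -/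
noncomputable def piU (v : ℕ) : Measure (Fin v → ℝ) := Measure.pi fun _ : Fin v => unif01

instance (v : ℕ) : IsProbabilityMeasure (piU v) := by unfold piU; infer_instance

/-- Bounded `L^r` moment. -/
def LrB (r : ℝ) (C : ℝ≥0∞) (U : ℝ → ℝ → ℝ) : Prop :=
  Measurable (Function.uncurry U) ∧
    ∫⁻ z : ℝ × ℝ, ‖U z.1 z.2‖ₑ ^ r ∂(unif01.prod unif01) ≤ C

theorem edgeF_mem {v : ℕ} {G : SimpleGraph (Fin v)} [DecidableRel G.Adj] {e : Fin v × Fin v} :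
    e ∈ edgeF G ↔ G.Adj e.1 e.2 ∧ e.1 < e.2 := by simp [edgeF]

theorem edgeF_count {v : ℕ} (G : SimpleGraph (Fin v)) [DecidableRel G.Adj] (i : Fin v) :
    ((edgeF G).filter (fun e => e.1 = i ∨ e.2 = i)).card ≤ G.maxDegree := by
  refine le_trans ?_ (G.degree_le_maxDegree i)
  rw [← G.card_neighborFinset_eq_degree]
  refine Finset.card_le_card_of_injOn (fun e => if e.1 = i then e.2 else e.1) ?_ ?_
  · intro e he
    simp only [Finset.coe_filter, Set.mem_ofPred_eq, edgeF_mem] at he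
    simp only [Finset.mem_coe, SimpleGraph.mem_neighborFinset]
    split_ifs with h
    · rw [← h]; exact he.1.1
    · have h2 := he.2.resolve_left h
      rw [← h2]; exact he.1.1.symm
  · intro e he f hf hef
    simp only [Finset.coe_filter, Set.mem_ofPred_eq, edgeF_mem] at he hf
    obtain ⟨e1, e2⟩ := e
    obtain ⟨f1, f2⟩ := f
    simp only at he hf hef ⊢
    ext <;> grind

theorem enorm_prodR {ι : Type*} (s : Finset ι) (f : ι → ℝ) :
    ‖∏ i ∈ s, f i‖ₑ = ∏ i ∈ s, ‖f i‖ₑ := by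
  classical
  induction s using Finset.induction with
  | empty => simp
  | insert i s hi ih => rw [Finset.prod_insert hi, Finset.prod_insert hi, enorm_mul, ih]

theorem meas_pair {v : ℕ} (U : ℝ → ℝ → ℝ) (hU : Measurable (Function.uncurry U)) (a b : Fin v) :
    Measurable (fun x : Fin v → ℝ => U (x a) (x b)) := by
  have h : Measurable (fun x : Fin v → ℝ => (x a, x b)) :=
    (measurable_pi_apply a).prodMk (measurable_pi_apply b)
  exact hU.comp h

theorem KV_measurable {v : ℕ} (G : SimpleGraph (Fin v)) [DecidableRel G.Adj]
    (V : Fin v × Fin v → ℝ → ℝ → ℝ) (hV : ∀ e, Measurable (Function.uncurry (V e))) :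
    Measurable (KV G V) := by
  unfold KV
  refine Finset.measurable_fun_prod _ fun e _ => ?_
  exact meas_pair _ (hV e) _ _

theorem maxDegree_pos {v : ℕ} (G : SimpleGraph (Fin v)) [DecidableRel G.Adj]
    {e : Fin v × Fin v} (he : e ∈ edgeF G) : 1 ≤ G.maxDegree := by
  refine le_trans ?_ (edgeF_count G e.1)
  rw [Nat.one_le_iff_ne_zero]
  exact Finset.card_ne_zero_of_mem (Finset.mem_filter.2 ⟨he, Or.inl rfl⟩)

theorem finnerG {v : ℕ} (G : SimpleGraph (Fin v)) [DecidableRel G.Adj] (q : ℝ) (hq : 0 ≤ q)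
    (C : ℝ≥0∞) (hC : 1 ≤ C) (V : Fin v × Fin v → ℝ → ℝ → ℝ)
    (hV : ∀ e, LrB (q * G.maxDegree) C (V e)) :
    ∫⁻ x, ‖KV G V x‖ₑ ^ q ∂(piU v) ≤ C ^ (edgeF G).card := by
  by_cases hD : G.maxDegree = 0
  · have : edgeF G = ∅ := by
      rw [Finset.eq_empty_iff_forall_notMem]
      intro e he
      have := maxDegree_pos G he
      omega
    simp [KV, this]
  · have hmU : ∀ e, Measurable (fun x : Fin v → ℝ => ‖V e (x e.1) (x e.2)‖ₑ ^ q) := fun e =>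
      (meas_pair _ (hV e).1 _ _).enorm.pow_const _
    have hmW : ∀ e, Measurable (fun z : ℝ × ℝ => ‖V e z.1 z.2‖ₑ ^ (q * G.maxDegree)) := fun e =>
      (hV e).1.enorm.pow_const _
    have h := finner_aux unif01 (edgeF G) G.maxDegree hD
      (fun e x => ‖V e (x e.1) (x e.2)‖ₑ ^ q) hmU (fun e i => e.1 = i ∨ e.2 = i)
      (fun e i hi x y => by
        push Not at hi
        simp only [Function.update_of_ne hi.1, Function.update_of_ne hi.2])
      (edgeF_count G) Finset.univ (fun _ => 0)
    rw [← lintegral_eq_lmarginal_univ] at h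
    have e1 : ∫⁻ x, ‖KV G V x‖ₑ ^ q ∂(piU v) =
        ∫⁻ x, ∏ e ∈ edgeF G, ‖V e (x e.1) (x e.2)‖ₑ ^ q ∂(piU v) := by
      refine lintegral_congr fun x => ?_
      rw [ENNReal.prod_rpow_of_nonneg hq]
      congr 1
      unfold KV
      exact enorm_prodR _ _
    rw [e1]
    refine h.trans ?_
    rw [← Finset.prod_const]
    refine Finset.prod_le_prod' fun e he => ?_
    rw [← lintegral_eq_lmarginal_univ]
    have hne : e.1 ≠ e.2 := (edgeF_mem.1 he).2.ne
    have e2 := (mp_pair (fun _ : Fin v => unif01) hne).lintegral_comp (hmW e)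
    simp only [← ENNReal.rpow_mul]
    rw [e2]
    have hD1 : (1 : ℝ) ≤ G.maxDegree := by
      exact_mod_cast Nat.one_le_iff_ne_zero.2 hD
    calc _ ≤ C ^ (1 / (G.maxDegree : ℝ)) := by
          apply ENNReal.rpow_le_rpow (hV e).2 (by positivity)
      _ ≤ C ^ (1 : ℝ) := by
          apply ENNReal.rpow_le_rpow_of_exponent_le hC
          rw [div_le_one (by linarith)]; exact hD1
      _ = C := ENNReal.rpow_one C

theorem holderE {α : Type*} [MeasurableSpace α] (P : Measure α) {p q : ℝ}
    (hpq : p.HolderConjugate q) (K Ψ : α → ℝ) (hK : Measurable K) (hΨ : Measurable Ψ)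
    (A B : ℝ≥0∞) (hA : ∫⁻ x, ‖K x‖ₑ ^ q ∂P ≤ A) (hB : ∫⁻ x, ‖Ψ x‖ₑ ^ p ∂P ≤ B) :
    ∫⁻ x, ‖K x * Ψ x‖ₑ ∂P ≤ A ^ (1 / q) * B ^ (1 / p) := by
  have h := ENNReal.lintegral_mul_le_Lp_mul_Lq P hpq.symm
    (f := fun x => ‖K x‖ₑ) (g := fun x => ‖Ψ x‖ₑ) hK.enorm.aemeasurable hΨ.enorm.aemeasurable
  have hp := hpq.pos
  have hq := hpq.symm.pos
  calc ∫⁻ x, ‖K x * Ψ x‖ₑ ∂P = ∫⁻ x, ((fun x => ‖K x‖ₑ) * (fun x => ‖Ψ x‖ₑ)) x ∂P := by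
        refine lintegral_congr fun x => ?_
        simp [enorm_mul]
    _ ≤ _ := h
    _ ≤ A ^ (1 / q) * B ^ (1 / p) := by gcongr

theorem holder_int {α : Type*} [MeasurableSpace α] (P : Measure α) {p q : ℝ}
    (hpq : p.HolderConjugate q) (K Ψ : α → ℝ) (hK : Measurable K) (hΨ : Measurable Ψ)
    (A B : ℝ≥0∞) (hA : ∫⁻ x, ‖K x‖ₑ ^ q ∂P ≤ A) (hB : ∫⁻ x, ‖Ψ x‖ₑ ^ p ∂P ≤ B)
    (hA' : A ≠ ⊤) (hB' : B ≠ ⊤) :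
    Integrable (fun x => K x * Ψ x) P ∧
      |∫ x, K x * Ψ x ∂P| ≤ (A ^ (1 / q) * B ^ (1 / p)).toReal := by
  have h := holderE P hpq K Ψ hK hΨ A B hA hB
  have hp := hpq.pos
  have hq := hpq.symm.pos
  have hfin : A ^ (1 / q) * B ^ (1 / p) ≠ ⊤ :=
    ENNReal.mul_ne_top (ENNReal.rpow_ne_top_of_nonneg (by positivity) hA')
      (ENNReal.rpow_ne_top_of_nonneg (by positivity) hB')
  have hi : Integrable (fun x => K x * Ψ x) P :=
    ⟨(hK.mul hΨ).aestronglyMeasurable, lt_of_le_of_lt h hfin.lt_top⟩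
  refine ⟨hi, ?_⟩
  have h1 : ‖∫ x, K x * Ψ x ∂P‖ₑ ≤ A ^ (1 / q) * B ^ (1 / p) :=
    (enorm_integral_le_lintegral_enorm _).trans h
  rw [← Real.norm_eq_abs, ← toReal_enorm]
  exact ENNReal.toReal_mono hfin h1

end MGL

namespace MGL

/-- Hard truncation. -/
noncomputable def trunc (T y : ℝ) : ℝ := if |y| ≤ T then y else 0

theorem trunc_meas (T : ℝ) : Measurable (trunc T) :=
  Measurable.ite (measurableSet_le measurable_id.abs measurable_const) measurable_id
    measurable_const

theorem trunc_abs_le {T : ℝ} (hT : 0 ≤ T) (y : ℝ) : |trunc T y| ≤ T := by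
  unfold trunc; split_ifs with h
  · exact h
  · simpa using hT

theorem trunc_eq {T y : ℝ} (h : |y| ≤ T) : trunc T y = y := by simp [trunc, h]

theorem prod_abs_le {ι : Type*} (s : Finset ι) (f : ι → ℝ) (T : ℝ) (hT : 1 ≤ T) (N : ℕ)
    (hN : s.card ≤ N) (h : ∀ i ∈ s, |f i| ≤ T) : |∏ i ∈ s, f i| ≤ T ^ N := by
  rw [Finset.abs_prod]
  calc ∏ i ∈ s, |f i| ≤ ∏ _i ∈ s, T := Finset.prod_le_prod (fun _ _ => abs_nonneg _) h
    _ = T ^ s.card := by simp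
    _ ≤ T ^ N := pow_le_pow_right₀ hT hN

theorem LrB_integrable {r : ℝ} (hr : 1 ≤ r) {C : ℝ≥0∞} (hC : C ≠ ⊤) {U : ℝ → ℝ → ℝ}
    (hU : LrB r C U) : Integrable (Function.uncurry U) (unif01.prod unif01) := by
  refine ⟨hU.1.aestronglyMeasurable, ?_⟩
  calc ∫⁻ z, ‖Function.uncurry U z‖ₑ ∂(unif01.prod unif01)
      ≤ ∫⁻ z : ℝ × ℝ, (1 + ‖U z.1 z.2‖ₑ ^ r) ∂(unif01.prod unif01) := by
        refine lintegral_mono fun z => ?_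
        show ‖U z.1 z.2‖ₑ ≤ _
        by_cases h : ‖U z.1 z.2‖ₑ ≤ 1
        · exact h.trans le_self_add
        · refine le_trans ?_ le_add_self
          calc ‖U z.1 z.2‖ₑ = ‖U z.1 z.2‖ₑ ^ (1 : ℝ) := (ENNReal.rpow_one _).symm
            _ ≤ _ := ENNReal.rpow_le_rpow_of_exponent_le (not_le.1 h).le hr
    _ = 1 + ∫⁻ z : ℝ × ℝ, ‖U z.1 z.2‖ₑ ^ r ∂(unif01.prod unif01) := by
        rw [lintegral_add_left measurable_const]; simp
    _ ≤ 1 + C := by gcongr; exact hU.2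
    _ < ⊤ := by simp [hC.lt_top]

theorem bad_bound {v : ℕ} (G : SimpleGraph (Fin v)) [DecidableRel G.Adj] {r : ℝ} (hr : 0 < r)
    (C : ℝ≥0∞) (V : Fin v × Fin v → ℝ → ℝ → ℝ) (hV : ∀ e, LrB r C (V e)) (T : ℝ) (hT : 0 < T) :
    piU v {x | ∃ e ∈ edgeF G, T < |V e (x e.1) (x e.2)|} ≤
      (edgeF G).card * C / ENNReal.ofReal (T ^ r) := by
  have hTr : 0 < T ^ r := by positivity
  have hsub : {x : Fin v → ℝ | ∃ e ∈ edgeF G, T < |V e (x e.1) (x e.2)|} ⊆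
      ⋃ e ∈ edgeF G, {x | ENNReal.ofReal (T ^ r) ≤ ‖V e (x e.1) (x e.2)‖ₑ ^ r} := by
    rintro x ⟨e, he, hx⟩
    simp only [Set.mem_iUnion]
    refine ⟨e, he, ?_⟩
    show ENNReal.ofReal (T ^ r) ≤ ‖V e (x e.1) (x e.2)‖ₑ ^ r
    rw [← ENNReal.ofReal_rpow_of_pos hT, Real.enorm_eq_ofReal_abs]
    gcongr
  refine (measure_mono hsub).trans ((measure_biUnion_finset_le _ _).trans ?_)
  calc _ ≤ ∑ _e ∈ edgeF G, C / ENNReal.ofReal (T ^ r) := by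
        refine Finset.sum_le_sum fun e he => ?_
        have hne : e.1 ≠ e.2 := (edgeF_mem.1 he).2.ne
        have h1 := meas_ge_le_lintegral_div (μ := piU v)
          (f := fun x => ‖V e (x e.1) (x e.2)‖ₑ ^ r)
          ((meas_pair _ (hV e).1 _ _).enorm.pow_const _).aemeasurable
          (ε := ENNReal.ofReal (T ^ r)) (by simpa using hTr) ENNReal.ofReal_ne_top
        refine h1.trans ?_
        gcongr
        have e2 := (mp_pair (fun _ : Fin v => unif01) hne).lintegral_comp
          (f := fun z : ℝ × ℝ => ‖V e z.1 z.2‖ₑ ^ r) ((hV e).1.enorm.pow_const _)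
        unfold piU
        rw [e2]
        exact (hV e).2
    _ = _ := by simp [mul_div_assoc]

theorem single_edge {v : ℕ} (G : SimpleGraph (Fin v)) [DecidableRel G.Adj] {p q : ℝ}
    (hpq : p.HolderConjugate q) (C : ℝ≥0∞) (hC : 1 ≤ C) (hC' : C ≠ ⊤)
    (V : Fin v × Fin v → ℝ → ℝ → ℝ) (hV : ∀ e, LrB (q * G.maxDegree) C (V e))
    (e0 : Fin v × Fin v) (he0 : e0 ∈ edgeF G) (η : ℝ)
    (hcut : ∀ S T, MeasurableSet S → MeasurableSet T →
      |∫ s in S, ∫ t in T, V e0 s t ∂unif01 ∂unif01| ≤ η)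
    (M T : ℝ) (hM : 1 ≤ M) (hT : 1 ≤ T) (g : ℝ → ℝ) (hg : Measurable g)
    (hgM : ∀ x, |g x| ≤ M) :
    |∫ x, KV G V x * ∏ a, g (x a) ∂(piU v)| ≤
      4 * (T ^ (edgeF G).card * M ^ v) ^ 2 * η +
      ((C ^ (edgeF G).card) ^ (1 / q) * (ENNReal.ofReal (M ^ v) ^ p *
        ((edgeF G).card * C / ENNReal.ofReal (T ^ (q * G.maxDegree)))) ^ (1 / p)).toReal := by
  classical
  set r := q * (G.maxDegree : ℝ) with hr
  set m := (edgeF G).card with hm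
  have hp := hpq.pos
  have hq := hpq.symm.pos
  have hD1 : (1 : ℝ) ≤ G.maxDegree := by exact_mod_cast maxDegree_pos G he0
  have hr1 : 1 ≤ r := by
    have := hpq.symm.lt
    nlinarith
  have hT0 : 0 < T := by linarith
  set V' : Fin v × Fin v → ℝ → ℝ → ℝ := fun e => if e = e0 then V e0 else
    fun s t => trunc T (V e s t) with hV'
  have hV'm : ∀ e, Measurable (Function.uncurry (V' e)) := by
    intro e
    simp only [hV']
    split_ifs with h
    · exact (hV e0).1
    · exact (trunc_meas T).comp (hV e).1
  have hP : Measurable (fun x : Fin v → ℝ => ∏ a, g (x a)) :=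
    Finset.measurable_fun_prod _ fun a _ => hg.comp (measurable_pi_apply a)
  have hPM : ∀ x : Fin v → ℝ, |∏ a, g (x a)| ≤ M ^ v := fun x =>
    prod_abs_le _ _ M hM v (by simp) fun a _ => hgM _
  set Bad : Set (Fin v → ℝ) := {x | ∃ e ∈ edgeF G, T < |V e (x e.1) (x e.2)|} with hBad
  have hBm : MeasurableSet Bad := by
    have : Bad = ⋃ e ∈ edgeF G, {x | T < |V e (x e.1) (x e.2)|} := by
      ext x; simp [hBad]
    rw [this]
    refine Finset.measurableSet_biUnion _ fun e _ => ?_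
    exact measurableSet_lt measurable_const (meas_pair _ (hV e).1 _ _).abs
  have hKm : Measurable (KV G V) := KV_measurable G V fun e => (hV e).1
  have hKbound := finnerG G q hq.le C hC V hV
  -- splitting
  have hA : C ^ m ≠ ⊤ := ENNReal.pow_ne_top hC'
  have hgood : ∀ x, x ∉ Bad → KV G V x = KV G V' x := by
    intro x hx
    unfold KV
    refine Finset.prod_congr rfl fun e he => ?_
    simp only [hV']
    split_ifs with h
    · rw [h]
    · show V e (x e.1) (x e.2) = trunc T (V e (x e.1) (x e.2))
      rw [trunc_eq]
      by_contra hcon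
      exact hx ⟨e, he, not_le.1 hcon⟩
  -- the product with the truncated kernel
  obtain ⟨a, b⟩ := e0
  have hlt : a < b := (edgeF_mem.1 he0).2
  have hab : a ≠ b := hlt.ne
  set Φ : (Fin v → ℝ) → ℝ := fun x =>
    (∏ e ∈ ((edgeF G).erase (a, b)).filter (fun e => ¬ (e.1 = b ∨ e.2 = b)),
      V' e (x e.1) (x e.2)) * ∏ c ∈ Finset.univ.erase b, g (x c) with hΦ
  set Ψ : (Fin v → ℝ) → ℝ := fun x =>
    (∏ e ∈ ((edgeF G).erase (a, b)).filter (fun e => (e.1 = b ∨ e.2 = b)),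
      V' e (x e.1) (x e.2)) * g (x b) with hΨ
  have hfac : ∀ x, KV G V' x * ∏ c, g (x c) = V (a, b) (x a) (x b) * (Φ x * Ψ x) := by
    intro x
    unfold KV
    rw [← Finset.mul_prod_erase _ _ he0, ← Finset.mul_prod_erase Finset.univ _ (Finset.mem_univ b),
      ← Finset.prod_filter_mul_prod_filter_not ((edgeF G).erase (a, b))
        (fun e => (e.1 = b ∨ e.2 = b))]
    have : V' (a, b) = V (a, b) := by simp [hV']
    rw [this]
    simp only [hΦ, hΨ]
    ring
  have hV'T : ∀ e, e ≠ (a, b) → ∀ s t, |V' e s t| ≤ T := by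
    intro e he s t
    simp only [hV', if_neg he]
    exact trunc_abs_le hT0.le _
  have hcardle : ∀ (P : Fin v × Fin v → Prop) [DecidablePred P],
      (((edgeF G).erase (a, b)).filter P).card ≤ m := fun P _ =>
    Finset.card_le_card ((Finset.filter_subset _ _).trans (Finset.erase_subset _ _))
  have hΦR : ∀ x, |Φ x| ≤ T ^ m * M ^ v := by
    intro x
    simp only [hΦ, abs_mul]
    refine mul_le_mul ?_ ?_ (abs_nonneg _) (by positivity)
    · refine prod_abs_le _ _ T hT m (hcardle _) fun e he => hV'T e ?_ _ _
      exact Finset.ne_of_mem_erase (Finset.mem_filter.1 he).1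
    · refine prod_abs_le _ _ M hM v ?_ fun c _ => hgM _
      exact (Finset.card_le_univ _).trans (by simp)
  have hv1 : 1 ≤ v := by have := b.2; omega
  have hΨR : ∀ x, |Ψ x| ≤ T ^ m * M ^ v := by
    intro x
    simp only [hΨ, abs_mul]
    refine mul_le_mul ?_ ?_ (abs_nonneg _) (by positivity)
    · refine prod_abs_le _ _ T hT m (hcardle _) fun e he => hV'T e ?_ _ _
      exact Finset.ne_of_mem_erase (Finset.mem_filter.1 he).1
    · exact (hgM _).trans (le_self_pow₀ hM (by omega))
  have hΦm : Measurable Φ := by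
    refine Measurable.mul ?_ ?_
    · exact Finset.measurable_fun_prod _ fun e _ => meas_pair _ (hV'm e) _ _
    · exact Finset.measurable_fun_prod _ fun c _ => hg.comp (measurable_pi_apply c)
  have hΨm : Measurable Ψ := by
    refine Measurable.mul ?_ ?_
    · exact Finset.measurable_fun_prod _ fun e _ => meas_pair _ (hV'm e) _ _
    · exact hg.comp (measurable_pi_apply b)
  have hΦb : ∀ x t, Φ (Function.update x b t) = Φ x := by
    intro x t
    simp only [hΦ]
    congr 1
    · refine Finset.prod_congr rfl fun e he => ?_
      have h := (Finset.mem_filter.1 he).2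
      push Not at h
      rw [Function.update_of_ne h.1, Function.update_of_ne h.2]
    · refine Finset.prod_congr rfl fun c hc => ?_
      rw [Function.update_of_ne (Finset.ne_of_mem_erase hc)]
  have hΨa : ∀ x t, Ψ (Function.update x a t) = Ψ x := by
    intro x t
    simp only [hΨ]
    congr 1
    · refine Finset.prod_congr rfl fun e he => ?_
      have h := Finset.mem_filter.1 he
      have h1 := Finset.mem_erase.1 h.1
      have h2 := (edgeF_mem.1 h1.2).2
      have h3 : e.1 ≠ a ∧ e.2 ≠ a := by
        obtain ⟨e1, e2⟩ := e
        simp only at h h2 ⊢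
        rcases h.2 with h4 | h4
        · subst h4
          exact ⟨hab.symm, (hlt.trans h2).ne'⟩
        · subst h4
          refine ⟨fun h5 => h1.1 (by rw [h5]), hab.symm⟩
      rw [Function.update_of_ne h3.1, Function.update_of_ne h3.2]
    · rw [Function.update_of_ne hab.symm]
  have hDi := LrB_integrable hr1 hC' (hV (a, b))
  have hI1 := cut_edge unif01 (V (a, b)) (hV (a, b)).1 hDi η (T ^ m * M ^ v) (by positivity)
    hcut hab Φ Ψ hΦm hΨm hΦR hΨR hΦb hΨa
  have hI1' : Integrable (fun x => V (a, b) (x a) (x b) * (Φ x * Ψ x)) (piU v) := by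
    have hDx : Integrable (fun x : Fin v → ℝ => V (a, b) (x a) (x b)) (piU v) :=
      (mp_pair (fun _ : Fin v => unif01) hab).integrable_comp_of_integrable hDi
    refine hDx.mul_bdd (c := (T ^ m * M ^ v) * (T ^ m * M ^ v))
      (hΦm.mul hΨm).aestronglyMeasurable (ae_of_all _ fun x => ?_)
    rw [Real.norm_eq_abs, abs_mul]
    exact mul_le_mul (hΦR x) (hΨR x) (abs_nonneg _) (by positivity)
  -- full integrability
  have hbd : ∀ (x : Fin v → ℝ), ‖∏ c, g (x c)‖ₑ ≤ ENNReal.ofReal (M ^ v) := fun x => by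
    rw [Real.enorm_eq_ofReal_abs]
    exact ENNReal.ofReal_le_ofReal (hPM x)
  have hKI : Integrable (fun x => KV G V x * ∏ c, g (x c)) (piU v) := by
    refine (holder_int (piU v) hpq (KV G V) _ hKm hP (C ^ m) (ENNReal.ofReal (M ^ v) ^ p)
      hKbound ?_ hA ?_).1
    · calc _ ≤ ∫⁻ x, ENNReal.ofReal (M ^ v) ^ p ∂(piU v) := by
            refine lintegral_mono fun x => ?_
            exact ENNReal.rpow_le_rpow (hbd x) hp.le
        _ = _ := by simp
    · exact ENNReal.rpow_ne_top_of_nonneg hp.le ENNReal.ofReal_ne_top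
  -- difference
  set R : (Fin v → ℝ) → ℝ := fun x => KV G V x * ∏ c, g (x c) -
    V (a, b) (x a) (x b) * (Φ x * Ψ x) with hR
  have hRi : Integrable R (piU v) := hKI.sub hI1'
  have hRb : ∀ x, |R x| ≤ |KV G V x * Bad.indicator (fun x => M ^ v) x| := by
    intro x
    by_cases hx : x ∈ Bad
    · simp only [hR, Set.indicator_of_mem hx, ← hfac]
      rw [← sub_mul, abs_mul, abs_mul, abs_of_nonneg (by positivity : 0 ≤ M ^ v)]
      refine mul_le_mul ?_ (hPM x) (abs_nonneg _) (abs_nonneg _)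
      by_cases hall : ∀ e ∈ edgeF G, e ≠ (a, b) → |V e (x e.1) (x e.2)| ≤ T
      · have : KV G V x = KV G V' x := by
          unfold KV
          refine Finset.prod_congr rfl fun e he => ?_
          simp only [hV']
          split_ifs with h
          · rw [h]
          · show V e (x e.1) (x e.2) = trunc T (V e (x e.1) (x e.2))
            rw [trunc_eq (hall e he h)]
        rw [← this]; simp
      · push Not at hall
        obtain ⟨e, he, hne, hlt⟩ := hall
        have : KV G V' x = 0 := by
          unfold KV
          refine Finset.prod_eq_zero he ?_
          simp [hV', if_neg hne, trunc, not_le.2 hlt]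
        rw [this]; simp
    · simp only [hR, ← hfac, ← hgood x hx]
      rw [sub_self, abs_zero]
      exact abs_nonneg _
  have hI2 : |∫ x, R x ∂(piU v)| ≤ ((C ^ m) ^ (1 / q) * (ENNReal.ofReal (M ^ v) ^ p *
        (m * C / ENNReal.ofReal (T ^ r))) ^ (1 / p)).toReal := by
    have hBfin : (m : ℝ≥0∞) * C / ENNReal.ofReal (T ^ r) ≠ ⊤ := by
      refine (ENNReal.div_lt_top (ENNReal.mul_ne_top (by simp) hC') ?_).ne
      have : 0 < T ^ r := by positivity
      simpa using this
    have hE : ∫⁻ x, ‖KV G V x * Bad.indicator (fun x => M ^ v) x‖ₑ ∂(piU v) ≤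
        (C ^ m) ^ (1 / q) * (ENNReal.ofReal (M ^ v) ^ p *
        (m * C / ENNReal.ofReal (T ^ r))) ^ (1 / p) := by
      refine holderE (piU v) hpq (KV G V) _ hKm (measurable_const.indicator hBm) _ _ hKbound ?_
      calc _ = ∫⁻ x, Bad.indicator (fun _ => ENNReal.ofReal (M ^ v) ^ p) x ∂(piU v) := by
            refine lintegral_congr fun x => ?_
            by_cases hx : x ∈ Bad
            · simp only [Set.indicator_of_mem hx]
              rw [Real.enorm_eq_ofReal (by positivity)]
            · simp [Set.indicator_of_notMem hx, hp]
        _ = ENNReal.ofReal (M ^ v) ^ p * piU v Bad := lintegral_indicator_const hBm _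
        _ ≤ _ := by
            gcongr
            exact bad_bound G (by linarith) C V hV T hT0
    rw [← Real.norm_eq_abs, ← toReal_enorm]
    refine ENNReal.toReal_mono ?_ ?_
    · refine ENNReal.mul_ne_top (ENNReal.rpow_ne_top_of_nonneg (by positivity) hA)
        (ENNReal.rpow_ne_top_of_nonneg (by positivity) (ENNReal.mul_ne_top
          (ENNReal.rpow_ne_top_of_nonneg hp.le ENNReal.ofReal_ne_top) hBfin))
    · refine (enorm_integral_le_lintegral_enorm _).trans (le_trans ?_ hE)
      refine lintegral_mono fun x => ?_
      rw [Real.enorm_eq_ofReal_abs, Real.enorm_eq_ofReal_abs]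
      exact ENNReal.ofReal_le_ofReal (hRb x)
  have hsum : ∫ x, KV G V x * ∏ c, g (x c) ∂(piU v) =
      ∫ x, V (a, b) (x a) (x b) * (Φ x * Ψ x) ∂(piU v) + ∫ x, R x ∂(piU v) := by
    rw [← integral_add hI1' hRi]
    congr 1; funext x; simp [hR]
  rw [hsum]
  exact (abs_add_le _ _).trans (add_le_add hI1 hI2)

end MGL

namespace MGL

/-- Cut norm bound. -/
def cutB (η : ℝ) (U : ℝ → ℝ → ℝ) : Prop :=
  ∀ S T, MeasurableSet S → MeasurableSet T → |∫ s in S, ∫ t in T, U s t ∂unif01 ∂unif01| ≤ η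

theorem LrB_mono {r : ℝ} {C D : ℝ≥0∞} (h : C ≤ D) {U : ℝ → ℝ → ℝ} (hU : LrB r C U) :
    LrB r D U := ⟨hU.1, hU.2.trans h⟩

theorem LrB_sub {r : ℝ} (hr : 1 ≤ r) {C : ℝ≥0∞} {U V : ℝ → ℝ → ℝ} (hU : LrB r C U)
    (hV : LrB r C V) : LrB r (2 ^ (r - 1) * (C + C)) (fun s t => U s t - V s t) := by
  refine ⟨hU.1.sub hV.1, ?_⟩
  calc ∫⁻ z : ℝ × ℝ, ‖U z.1 z.2 - V z.1 z.2‖ₑ ^ r ∂(unif01.prod unif01)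
      ≤ ∫⁻ z : ℝ × ℝ, 2 ^ (r - 1) * (‖U z.1 z.2‖ₑ ^ r + ‖V z.1 z.2‖ₑ ^ r)
          ∂(unif01.prod unif01) := by
        refine lintegral_mono fun z => ?_
        refine le_trans ?_ (ENNReal.rpow_add_le_mul_rpow_add_rpow _ _ hr)
        exact ENNReal.rpow_le_rpow enorm_sub_le (by linarith)
    _ = 2 ^ (r - 1) * (∫⁻ z : ℝ × ℝ, ‖U z.1 z.2‖ₑ ^ r ∂(unif01.prod unif01) +
          ∫⁻ z : ℝ × ℝ, ‖V z.1 z.2‖ₑ ^ r ∂(unif01.prod unif01)) := by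
        have h1 : Measurable fun z : ℝ × ℝ => ‖U z.1 z.2‖ₑ ^ r := hU.1.enorm.pow_const _
        have h2 : Measurable fun z : ℝ × ℝ => ‖V z.1 z.2‖ₑ ^ r := hV.1.enorm.pow_const _
        have h3 := lintegral_const_mul (μ := unif01.prod unif01) ((2 : ℝ≥0∞) ^ (r - 1)) (h1.add h2)
        rw [← lintegral_add_left h1]
        exact h3
    _ ≤ _ := by gcongr; exacts [hU.2, hV.2]

theorem T_choice {r p q M : ℝ} (hr : 0 < r) (hp : 0 < p) (hq : 0 < q) (C D : ℝ≥0∞)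
    (hC : C ≠ ⊤) (hD : D ≠ ⊤)
    (ε : ℝ) (hε : 0 < ε) : ∃ T : ℝ, 1 ≤ T ∧
      (C ^ (1 / q) * (ENNReal.ofReal M ^ p * (D / ENNReal.ofReal (T ^ r))) ^ (1 / p)).toReal
        ≤ ε := by
  have h1 : Tendsto (fun T : ℝ => ENNReal.ofReal (T ^ r)) atTop (nhds ⊤) :=
    ENNReal.tendsto_ofReal_atTop.comp (tendsto_rpow_atTop hr)
  have h2 : Tendsto (fun T : ℝ => D / ENNReal.ofReal (T ^ r)) atTop (nhds 0) := by
    have := ENNReal.Tendsto.const_div (a := D) h1 (Or.inr hD)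
    simpa using this
  have h3 : Tendsto (fun T : ℝ => ENNReal.ofReal M ^ p * (D / ENNReal.ofReal (T ^ r))) atTop
      (nhds 0) := by
    have := ENNReal.Tendsto.const_mul h2
      (Or.inr (ENNReal.rpow_ne_top_of_nonneg hp.le (ENNReal.ofReal_ne_top (r := M))))
    simpa using this
  have h4 : Tendsto (fun T : ℝ => (ENNReal.ofReal M ^ p * (D / ENNReal.ofReal (T ^ r)))
      ^ (1 / p)) atTop (nhds 0) := by
    have := h3.ennrpow_const (1 / p)
    rwa [ENNReal.zero_rpow_of_pos (by positivity)] at this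
  have h5 : Tendsto (fun T : ℝ => C ^ (1 / q) * (ENNReal.ofReal M ^ p *
      (D / ENNReal.ofReal (T ^ r))) ^ (1 / p)) atTop (nhds 0) := by
    have := ENNReal.Tendsto.const_mul h4
      (Or.inr (ENNReal.rpow_ne_top_of_nonneg (by positivity : 0 ≤ 1 / q) hC))
    simpa using this
  have h6 := (ENNReal.tendsto_toReal ENNReal.zero_ne_top).comp h5
  have h7 := (h6.eventually_le_const (u := ε) (by simpa using hε)).and (eventually_ge_atTop 1)
  obtain ⟨T, hT⟩ := h7.exists
  exact ⟨T, hT.2, hT.1⟩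

theorem KV_int {v : ℕ} (G : SimpleGraph (Fin v)) [DecidableRel G.Adj] {p q : ℝ}
    (hpq : p.HolderConjugate q) (C : ℝ≥0∞) (hC : 1 ≤ C) (hC' : C ≠ ⊤)
    (V : Fin v × Fin v → ℝ → ℝ → ℝ) (hV : ∀ e, LrB (q * G.maxDegree) C (V e))
    (Ψ : (Fin v → ℝ) → ℝ) (hΨ : Measurable Ψ) (B : ℝ≥0∞) (hB' : B ≠ ⊤)
    (hB : ∫⁻ x, ‖Ψ x‖ₑ ^ p ∂(piU v) ≤ B) :
    Integrable (fun x => KV G V x * Ψ x) (piU v) ∧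
     |∫ x, KV G V x * Ψ x ∂(piU v)| ≤ ((C ^ (edgeF G).card) ^ (1 / q) * B ^ (1 / p)).toReal :=
  holder_int (piU v) hpq (KV G V) Ψ (KV_measurable G V fun e => (hV e).1) hΨ _ _
    (finnerG G q hpq.symm.pos.le C hC V hV) hB (ENNReal.pow_ne_top hC') hB'

theorem prodP_bound {v : ℕ} {p M : ℝ} (hp : 0 < p) (hM : 1 ≤ M) (g : ℝ → ℝ)
    (hgM : ∀ x, |g x| ≤ M) :
    ∫⁻ x : Fin v → ℝ, ‖∏ a, g (x a)‖ₑ ^ p ∂(piU v) ≤ ENNReal.ofReal (M ^ v) ^ p := by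
  calc _ ≤ ∫⁻ x, ENNReal.ofReal (M ^ v) ^ p ∂(piU v) := by
        refine lintegral_mono fun x => ?_
        refine ENNReal.rpow_le_rpow ?_ hp.le
        rw [Real.enorm_eq_ofReal_abs]
        exact ENNReal.ofReal_le_ofReal (prod_abs_le _ _ M hM v (by simp) fun a _ => hgM _)
    _ = _ := by simp

theorem meas_prodg {v : ℕ} {g : ℝ → ℝ} (hg : Measurable g) :
    Measurable (fun x : Fin v → ℝ => ∏ a, g (x a)) :=
  Finset.measurable_fun_prod _ fun a _ => hg.comp (measurable_pi_apply a)

theorem counting_bounded {v : ℕ} (G : SimpleGraph (Fin v)) [DecidableRel G.Adj] {p q : ℝ}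
    (hpq : p.HolderConjugate q) (C : ℝ≥0∞) (hC : 1 ≤ C) (hC' : C ≠ ⊤)
    (M : ℝ) (hM : 1 ≤ M) (ε : ℝ) (hε : 0 < ε) :
    ∃ η : ℝ, 0 < η ∧ ∀ U1 U2 : ℝ → ℝ → ℝ, LrB (q * G.maxDegree) C U1 →
      LrB (q * G.maxDegree) C U2 → cutB η (fun s t => U1 s t - U2 s t) →
      ∀ g : ℝ → ℝ, Measurable g → (∀ x, |g x| ≤ M) → |G1 G U1 g - G1 G U2 g| ≤ ε := by
  classical
  have hp := hpq.pos
  have hq := hpq.symm.pos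
  by_cases hE : edgeF G = ∅
  · refine ⟨1, one_pos, fun U1 U2 _ _ _ g _ _ => ?_⟩
    have : G1 G U1 g = G1 G U2 g := by
      unfold G1 edgeProd
      unfold edgeF at hE
      rw [hE]; simp
    rw [this]; simpa using hε.le
  obtain ⟨e1, he1⟩ := Finset.nonempty_iff_ne_empty.2 hE
  set r := q * (G.maxDegree : ℝ) with hr
  have hD1 : (1 : ℝ) ≤ G.maxDegree := by exact_mod_cast maxDegree_pos G he1
  have hr1 : 1 ≤ r := by
    have := hpq.symm.lt
    nlinarith
  set m := (edgeF G).card with hm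
  set C2 : ℝ≥0∞ := 2 ^ (r - 1) * (C + C) with hC2
  have hC2C : C ≤ C2 := by
    have h1 : (1 : ℝ≥0∞) ≤ 2 ^ (r - 1) := by
      calc (1 : ℝ≥0∞) = 1 ^ (r - 1) := (ENNReal.one_rpow _).symm
        _ ≤ 2 ^ (r - 1) := ENNReal.rpow_le_rpow (by norm_num) (by linarith)
    calc C = 1 * C := (one_mul C).symm
      _ ≤ C2 := mul_le_mul' h1 le_self_add
  have hC2' : C2 ≠ ⊤ := ENNReal.mul_ne_top
    (ENNReal.rpow_ne_top_of_nonneg (by linarith) (by norm_num)) (ENNReal.add_ne_top.2 ⟨hC', hC'⟩)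
  have hC21 := hC.trans hC2C
  have hm0 : 0 < (m : ℝ) := by exact_mod_cast Finset.card_pos.2 ⟨e1, he1⟩
  set δ := ε / (2 * m) with hδ
  have hδ0 : 0 < δ := by positivity
  obtain ⟨T, hT1, hT⟩ := T_choice (M := M ^ v) (by linarith : 0 < r) hp hq (C2 ^ m) (m * C2)
    (ENNReal.pow_ne_top hC2') (ENNReal.mul_ne_top (by simp) hC2') δ hδ0
  have hT0 : 0 < T := by linarith
  have hM0 : 0 < M := by linarith
  refine ⟨δ / (4 * (T ^ m * M ^ v) ^ 2), by positivity, ?_⟩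
  intro U1 U2 hU1 hU2 hcut g hg hgM
  set mix : Finset (Fin v × Fin v) → Fin v × Fin v → ℝ → ℝ → ℝ :=
    fun S e => if e ∈ S then U1 else U2 with hmix
  have hmixL : ∀ S e, LrB r C2 (mix S e) := by
    intro S e
    simp only [hmix]
    split_ifs
    exacts [LrB_mono hC2C hU1, LrB_mono hC2C hU2]
  have hInt1 : ∀ S, Integrable (fun x => KV G (mix S) x * ∏ a, g (x a)) (piU v) := fun S =>
    (KV_int G hpq C2 hC21 hC2' (mix S) (hmixL S) _ (meas_prodg hg) _
      (ENNReal.rpow_ne_top_of_nonneg hp.le ENNReal.ofReal_ne_top) (prodP_bound hp hM g hgM)).1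
  have key : ∀ S : Finset (Fin v × Fin v), S ⊆ edgeF G →
      |∫ x, KV G (mix S) x * ∏ a, g (x a) ∂(piU v) -
        ∫ x, KV G (mix ∅) x * ∏ a, g (x a) ∂(piU v)| ≤ S.card * (2 * δ) := by
    intro S
    induction S using Finset.induction with
    | empty => intro _; simp
    | insert e0 S he0 ih =>
      intro hS
      have he0E : e0 ∈ edgeF G := hS (Finset.mem_insert_self _ _)
      have ih' := ih ((Finset.subset_insert _ _).trans hS)
      set V : Fin v × Fin v → ℝ → ℝ → ℝ := fun e => if e = e0 then (fun s t => U1 s t - U2 s t)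
        else mix S e with hVd
      have hVL : ∀ e, LrB r C2 (V e) := by
        intro e
        simp only [hVd]
        split_ifs
        · exact LrB_sub hr1 hU1 hU2
        · exact hmixL S e
      have hVe0 : V e0 = (fun s t => U1 s t - U2 s t) := by simp [hVd]
      have hse := single_edge G hpq C2 hC21 hC2' V hVL e0 he0E
        (δ / (4 * (T ^ m * M ^ v) ^ 2)) (by rw [hVe0]; exact hcut) M T hM hT1 g hg hgM
      have hdiff : ∀ x, KV G V x * ∏ a, g (x a) = KV G (mix (insert e0 S)) x * ∏ a, g (x a) -
          KV G (mix S) x * ∏ a, g (x a) := by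
        intro x
        rw [← sub_mul]
        congr 1
        unfold KV
        rw [← Finset.mul_prod_erase _ _ he0E, ← Finset.mul_prod_erase _ _ he0E,
          ← Finset.mul_prod_erase _ (fun e => mix S e (x e.1) (x e.2)) he0E]
        have h1 : ∏ e ∈ (edgeF G).erase e0, V e (x e.1) (x e.2) =
            ∏ e ∈ (edgeF G).erase e0, mix S e (x e.1) (x e.2) := by
          refine Finset.prod_congr rfl fun e he => ?_
          simp only [hVd, if_neg (Finset.ne_of_mem_erase he)]
        have h2 : ∏ e ∈ (edgeF G).erase e0, mix (insert e0 S) e (x e.1) (x e.2) =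
            ∏ e ∈ (edgeF G).erase e0, mix S e (x e.1) (x e.2) := by
          refine Finset.prod_congr rfl fun e he => ?_
          simp only [hmix, Finset.mem_insert, Finset.ne_of_mem_erase he, false_or]
        rw [h1, h2, hVe0]
        have h3 : mix (insert e0 S) e0 = U1 := by simp [hmix]
        have h4 : mix S e0 = U2 := by simp [hmix, he0]
        rw [h3, h4]; ring
      rw [integral_congr_ae (ae_of_all _ hdiff), integral_sub (hInt1 _) (hInt1 _)] at hse
      have h5 : 4 * (T ^ m * M ^ v) ^ 2 * (δ / (4 * (T ^ m * M ^ v) ^ 2)) = δ := by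
        field_simp
      rw [h5] at hse
      rw [Finset.card_insert_of_notMem he0]
      push_cast
      have h6 := abs_sub_le (∫ x, KV G (mix (insert e0 S)) x * ∏ a, g (x a) ∂(piU v))
        (∫ x, KV G (mix S) x * ∏ a, g (x a) ∂(piU v))
        (∫ x, KV G (mix ∅) x * ∏ a, g (x a) ∂(piU v))
      linarith
  have hfin := key (edgeF G) subset_rfl
  have e1 : ∫ x, KV G (mix (edgeF G)) x * ∏ a, g (x a) ∂(piU v) = G1 G U1 g := by
    unfold G1 piU
    refine integral_congr_ae (ae_of_all _ fun x => ?_)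
    show _ * _ = _ * _
    congr 1
    exact Finset.prod_congr rfl fun e he => by
      have he' : e ∈ edgeF G := he
      simp [hmix, he']
  have e2 : ∫ x, KV G (mix ∅) x * ∏ a, g (x a) ∂(piU v) = G1 G U2 g := by
    unfold G1 piU
    refine integral_congr_ae (ae_of_all _ fun x => ?_)
    show _ * _ = _ * _
    congr 1
  rw [e1, e2] at hfin
  refine hfin.trans (le_of_eq ?_)
  rw [hδ]; field_simp; rfl

end MGL

namespace MGL

theorem prod_diff {ι : Type*} [DecidableEq ι] (s : Finset ι) (g h : ι → ℝ) (d : ι → ℝ≥0∞)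
    (hg : ∀ i, ‖g i‖ₑ ≤ d i) (hh : ∀ i, ‖h i‖ₑ ≤ d i) :
    ‖∏ i ∈ s, g i - ∏ i ∈ s, h i‖ₑ ≤ ∑ a ∈ s, ‖g a - h a‖ₑ * ∏ c ∈ s.erase a, d c := by
  induction s using Finset.induction with
  | empty => simp
  | insert i s hi ih =>
    rw [Finset.prod_insert hi, Finset.prod_insert hi, Finset.sum_insert hi,
      Finset.erase_insert hi]
    have e : g i * ∏ j ∈ s, g j - h i * ∏ j ∈ s, h j =
        (g i - h i) * ∏ j ∈ s, g j + h i * (∏ j ∈ s, g j - ∏ j ∈ s, h j) := by ring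
    rw [e]
    refine (enorm_add_le _ _).trans (add_le_add ?_ ?_)
    · rw [enorm_mul, enorm_prodR]
      gcongr with j hj
      exact hg j
    · rw [enorm_mul]
      calc ‖h i‖ₑ * ‖∏ j ∈ s, g j - ∏ j ∈ s, h j‖ₑ
          ≤ d i * ∑ a ∈ s, ‖g a - h a‖ₑ * ∏ c ∈ s.erase a, d c := by
            gcongr; exact hh i
        _ = ∑ a ∈ s, ‖g a - h a‖ₑ * ∏ c ∈ (insert i s).erase a, d c := by
            rw [Finset.mul_sum]
            refine Finset.sum_congr rfl fun a ha => ?_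
            have hne : a ≠ i := fun h => hi (h ▸ ha)
            rw [Finset.erase_insert_of_ne hne.symm, Finset.prod_insert (by simp [hi])]
            ring
        _ ≤ _ := le_rfl

theorem prod_moment {v : ℕ} {p : ℝ} (hp : 0 < p) (d : ℝ → ℝ≥0∞) (hd : Measurable d)
    (L : ℝ≥0∞) (hL : ∫⁻ x, d x ^ p ∂unif01 ≤ L) :
    ∫⁻ x : Fin v → ℝ, (∏ a, d (x a)) ^ p ∂(piU v) ≤ L ^ v := by
  have h : ∀ x : Fin v → ℝ, (∏ a, d (x a)) ^ p = ∏ a, (d (x a)) ^ p := fun x =>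
    (ENNReal.prod_rpow_of_nonneg hp.le).symm
  simp_rw [h]
  unfold piU
  rw [lintegral_pi_prod (fun _ : Fin v => unif01) (fun _ y => d y ^ p)
    (fun _ => hd.pow_const _)]
  calc ∏ _a : Fin v, ∫⁻ y, d y ^ p ∂unif01 ≤ ∏ _a : Fin v, L :=
        Finset.prod_le_prod' fun _ _ => hL
    _ = L ^ v := by simp

theorem prod_diff_moment {v : ℕ} {p : ℝ} (hp : 1 ≤ p) (g h : ℝ → ℝ) (hg : Measurable g)
    (hh : Measurable h) (d : ℝ → ℝ≥0∞) (hd : Measurable d) (hgd : ∀ x, ‖g x‖ₑ ≤ d x)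
    (hhd : ∀ x, ‖h x‖ₑ ≤ d x) (L D : ℝ≥0∞) (hL : ∫⁻ x, d x ^ p ∂unif01 ≤ L)
    (hD : ∫⁻ x, ‖g x - h x‖ₑ ^ p ∂unif01 ≤ D) :
    ∫⁻ x : Fin v → ℝ, ‖∏ a, g (x a) - ∏ a, h (x a)‖ₑ ^ p ∂(piU v) ≤
      (v : ℝ≥0∞) ^ (p - 1) * (v * (D * L ^ (v - 1))) := by
  have hp0 : 0 < p := by linarith
  set t : Fin v → Fin v → ℝ → ℝ≥0∞ := fun a c y =>
    if c = a then ‖g y - h y‖ₑ ^ p else d y ^ p with ht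
  have htm : ∀ a c, Measurable (t a c) := by
    intro a c
    simp only [ht]
    split_ifs
    · exact (hg.sub hh).enorm.pow_const _
    · exact hd.pow_const _
  have hbd : ∀ x : Fin v → ℝ, ‖∏ a, g (x a) - ∏ a, h (x a)‖ₑ ^ p ≤
      (v : ℝ≥0∞) ^ (p - 1) * ∑ a : Fin v, ∏ c, t a c (x c) := by
    intro x
    calc _ ≤ (∑ a : Fin v, ‖g (x a) - h (x a)‖ₑ * ∏ c ∈ Finset.univ.erase a, d (x c)) ^ p := by
          refine ENNReal.rpow_le_rpow ?_ hp0.le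
          exact prod_diff Finset.univ (fun a => g (x a)) (fun a => h (x a)) (fun a => d (x a))
            (fun a => hgd _) (fun a => hhd _)
      _ ≤ (Finset.univ : Finset (Fin v)).card ^ (p - 1) * ∑ a : Fin v,
            (‖g (x a) - h (x a)‖ₑ * ∏ c ∈ Finset.univ.erase a, d (x c)) ^ p :=
          ENNReal.rpow_sum_le_const_mul_sum_rpow _ _ hp
      _ = _ := by
          rw [Finset.card_univ, Fintype.card_fin]
          congr 1
          refine Finset.sum_congr rfl fun a _ => ?_
          rw [← Finset.mul_prod_erase Finset.univ (fun c => t a c (x c)) (Finset.mem_univ a),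
            ENNReal.mul_rpow_of_nonneg _ _ hp0.le, ← ENNReal.prod_rpow_of_nonneg hp0.le]
          congr 1
          · simp [ht]
          · refine Finset.prod_congr rfl fun c hc => ?_
            simp [ht, Finset.ne_of_mem_erase hc]
  have htm' : ∀ a : Fin v, Measurable fun x : Fin v → ℝ => ∏ c, t a c (x c) := fun a =>
    Finset.measurable_fun_prod _ fun c _ => (htm a c).comp (measurable_pi_apply c)
  calc _ ≤ ∫⁻ x : Fin v → ℝ, (v : ℝ≥0∞) ^ (p - 1) * ∑ a : Fin v, ∏ c, t a c (x c) ∂(piU v) :=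
        lintegral_mono hbd
    _ = (v : ℝ≥0∞) ^ (p - 1) * ∑ a : Fin v, ∫⁻ x : Fin v → ℝ, ∏ c, t a c (x c) ∂(piU v) := by
        rw [lintegral_const_mul, lintegral_finsetSum]
        · exact fun a _ => htm' a
        · exact Finset.measurable_fun_sum _ fun a _ => htm' a
    _ ≤ (v : ℝ≥0∞) ^ (p - 1) * ∑ _a : Fin v, (D * L ^ (v - 1)) := by
        gcongr with a
        unfold piU
        rw [lintegral_pi_prod (fun _ : Fin v => unif01) (t a) (htm a),
          ← Finset.mul_prod_erase _ _ (Finset.mem_univ a)]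
        gcongr
        · simpa [ht] using hD
        · calc _ ≤ ∏ _c ∈ Finset.univ.erase a, L := by
                refine Finset.prod_le_prod' fun c hc => ?_
                simpa [ht, Finset.ne_of_mem_erase hc] using hL
            _ = L ^ (v - 1) := by simp
    _ = _ := by simp

theorem G1_eq {v : ℕ} (G : SimpleGraph (Fin v)) [DecidableRel G.Adj] (U : ℝ → ℝ → ℝ) (g : ℝ → ℝ) :
    G1 G U g = ∫ x, KV G (fun _ => U) x * ∏ a, g (x a) ∂(piU v) := rfl

theorem G1_int {v : ℕ} (G : SimpleGraph (Fin v)) [DecidableRel G.Adj] {p q : ℝ}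
    (hpq : p.HolderConjugate q) (C : ℝ≥0∞) (hC : 1 ≤ C) (hC' : C ≠ ⊤) (U : ℝ → ℝ → ℝ)
    (hU : LrB (q * G.maxDegree) C U) (g : ℝ → ℝ) (hg : Measurable g)
    (hgL : ∫⁻ x, ‖g x‖ₑ ^ p ∂unif01 ≠ ⊤) :
    Integrable (fun x => KV G (fun _ => U) x * ∏ a, g (x a)) (piU v) := by
  refine (KV_int G hpq C hC hC' (fun _ => U) (fun _ => hU) _ (meas_prodg hg)
    ((∫⁻ x, ‖g x‖ₑ ^ p ∂unif01) ^ v) (ENNReal.pow_ne_top hgL) ?_).1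
  simp_rw [enorm_prodR]
  exact prod_moment hpq.pos (fun y => ‖g y‖ₑ) hg.enorm _ le_rfl

/-- The Lipschitz constant -/
noncomputable def lipK (v m : ℕ) (p q : ℝ) (C L D : ℝ≥0∞) : ℝ≥0∞ :=
  (C ^ m) ^ (1 / q) * ((v : ℝ≥0∞) ^ (p - 1) * (v * (D * L ^ (v - 1)))) ^ (1 / p)

theorem lipK_tendsto (v m : ℕ) {p q : ℝ} (hp : 1 ≤ p) (hq : 0 < q) {C L : ℝ≥0∞} (hC : C ≠ ⊤)
    (hL : L ≠ ⊤) {ι : Type*} {l : Filter ι} (D : ι → ℝ≥0∞) (hD : Tendsto D l (nhds 0)) :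
    Tendsto (fun i => (lipK v m p q C L (D i)).toReal) l (nhds 0) := by
  have hp0 : 0 < p := by linarith
  have h1 : Tendsto (fun i => D i * L ^ (v - 1)) l (nhds 0) := by
    have := ENNReal.Tendsto.mul_const hD (Or.inr (ENNReal.pow_ne_top (n := v - 1) hL))
    simpa using this
  have h2 : Tendsto (fun i => (v : ℝ≥0∞) * (D i * L ^ (v - 1))) l (nhds 0) := by
    have := ENNReal.Tendsto.const_mul h1 (Or.inr (ENNReal.natCast_ne_top v))
    simpa using this
  have h3 : Tendsto (fun i => (v : ℝ≥0∞) ^ (p - 1) * ((v : ℝ≥0∞) * (D i * L ^ (v - 1)))) l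
      (nhds 0) := by
    have := ENNReal.Tendsto.const_mul h2
      (Or.inr (ENNReal.rpow_ne_top_of_nonneg (by linarith : 0 ≤ p - 1) (ENNReal.natCast_ne_top v)))
    simpa using this
  have h4 := h3.ennrpow_const (1 / p)
  rw [ENNReal.zero_rpow_of_pos (by positivity)] at h4
  have h5 : Tendsto (fun i => lipK v m p q C L (D i)) l (nhds 0) := by
    have := ENNReal.Tendsto.const_mul h4
      (Or.inr (ENNReal.rpow_ne_top_of_nonneg (by positivity : 0 ≤ 1 / q)
        (ENNReal.pow_ne_top (n := m) hC)))
    simpa [lipK] using this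
  exact (ENNReal.tendsto_toReal ENNReal.zero_ne_top).comp h5

theorem G1_lip {v : ℕ} (G : SimpleGraph (Fin v)) [DecidableRel G.Adj] {p q : ℝ}
    (hpq : p.HolderConjugate q) (C : ℝ≥0∞) (hC : 1 ≤ C) (hC' : C ≠ ⊤) (U : ℝ → ℝ → ℝ)
    (hU : LrB (q * G.maxDegree) C U) (g h : ℝ → ℝ) (hg : Measurable g)
    (hh : Measurable h) (d : ℝ → ℝ≥0∞) (hd : Measurable d) (hgd : ∀ x, ‖g x‖ₑ ≤ d x)
    (hhd : ∀ x, ‖h x‖ₑ ≤ d x) (L D : ℝ≥0∞) (hL : ∫⁻ x, d x ^ p ∂unif01 ≤ L)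
    (hD : ∫⁻ x, ‖g x - h x‖ₑ ^ p ∂unif01 ≤ D) (hL' : L ≠ ⊤) (hD' : D ≠ ⊤) :
    |G1 G U g - G1 G U h| ≤ (lipK v (edgeF G).card p q C L D).toReal := by
  have hp1 := hpq.lt.le
  have hp := hpq.pos
  have fin : ∀ f : ℝ → ℝ, (∀ x, ‖f x‖ₑ ≤ d x) → ∫⁻ x, ‖f x‖ₑ ^ p ∂unif01 ≠ ⊤ := fun f hf =>
    (((lintegral_mono fun x => ENNReal.rpow_le_rpow (hf x) hp.le).trans hL).trans_lt
      hL'.lt_top).ne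
  rw [G1_eq, G1_eq, ← integral_sub (G1_int G hpq C hC hC' U hU g hg (fin g hgd))
    (G1_int G hpq C hC hC' U hU h hh (fin h hhd))]
  simp_rw [← mul_sub]
  refine (KV_int G hpq C hC hC' (fun _ => U) (fun _ => hU)
    (fun x => ∏ a, g (x a) - ∏ a, h (x a)) ((meas_prodg hg).sub (meas_prodg hh)) _ ?_
    (prod_diff_moment hp1 g h hg hh d hd hgd hhd L D hL hD)).2
  refine ENNReal.mul_ne_top (ENNReal.rpow_ne_top_of_nonneg (by linarith)
    (ENNReal.natCast_ne_top v)) (ENNReal.mul_ne_top (ENNReal.natCast_ne_top v)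
      (ENNReal.mul_ne_top hD' (ENNReal.pow_ne_top hL')))

/-- Clipping. -/
noncomputable def clip (M y : ℝ) : ℝ := max (-M) (min M y)

theorem clip_meas (M : ℝ) : Measurable (clip M) :=
  measurable_const.max (measurable_const.min measurable_id)

theorem clip_abs_le {M : ℝ} (hM : 0 ≤ M) (y : ℝ) : |clip M y| ≤ M := by
  unfold clip
  rw [abs_le]
  exact ⟨le_max_left _ _, max_le (by linarith) (min_le_left _ _)⟩

theorem clip_abs_le' {M : ℝ} (hM : 0 ≤ M) (y : ℝ) : |clip M y| ≤ |y| := by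
  unfold clip
  rcases le_total y 0 with h | h
  · rw [min_eq_right (by linarith), abs_of_nonpos (max_le (by linarith) h), abs_of_nonpos h]
    linarith [le_max_right (-M) y]
  · rw [max_eq_right (by have := le_min hM h; linarith), abs_of_nonneg (le_min hM h),
      abs_of_nonneg h]
    exact min_le_right _ _

theorem clip_sub {M : ℝ} (hM : 0 ≤ M) (y : ℝ) : |y - clip M y| = max (|y| - M) 0 := by
  unfold clip
  rcases le_total y 0 with h | h
  · rw [min_eq_right (by linarith), abs_of_nonpos h]
    rcases le_total (-M) y with h2 | h2
    · rw [max_eq_right h2, max_eq_right (by linarith)]; simp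
    · rw [max_eq_left h2, max_eq_left (by linarith), abs_of_nonpos (by linarith)]; ring
  · rw [max_eq_right (by have := le_min hM h; linarith), abs_of_nonneg h]
    rcases le_total M y with h2 | h2
    · rw [min_eq_left h2, max_eq_left (by linarith), abs_of_nonneg (by linarith)]
    · rw [min_eq_right h2, max_eq_right (by linarith)]; simp

/-- The class of functions with moment and tail bounds. -/
def inCls (p : ℝ) (L b : ℝ≥0∞) (M : ℝ) (g : ℝ → ℝ) : Prop :=
  Measurable g ∧ ∫⁻ x, ‖g x‖ₑ ^ p ∂unif01 ≤ L ∧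
    ∫⁻ x, ENNReal.ofReal (max (|g x| - M) 0) ^ p ∂unif01 ≤ b

theorem counting {v : ℕ} (G : SimpleGraph (Fin v)) [DecidableRel G.Adj] {p q : ℝ}
    (hpq : p.HolderConjugate q) (C : ℝ≥0∞) (hC : 1 ≤ C) (hC' : C ≠ ⊤) (L : ℝ≥0∞) (hL : L ≠ ⊤)
    (ε : ℝ) (hε : 0 < ε) :
    ∃ b : ℝ, 0 < b ∧ ∀ M : ℝ, 1 ≤ M → ∃ η : ℝ, 0 < η ∧ ∀ U1 U2 : ℝ → ℝ → ℝ,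
      LrB (q * G.maxDegree) C U1 →
      LrB (q * G.maxDegree) C U2 → cutB η (fun s t => U1 s t - U2 s t) →
      ∀ g : ℝ → ℝ, inCls p L (ENNReal.ofReal b) M g → |G1 G U1 g - G1 G U2 g| ≤ ε := by
  have hlim : Tendsto (fun b : ℝ => (lipK v (edgeF G).card p q C L (ENNReal.ofReal b)).toReal)
      (nhdsWithin 0 (Set.Ioi 0)) (nhds 0) := by
    refine lipK_tendsto v _ hpq.lt.le hpq.symm.pos hC' hL _ ?_
    have h0 : Tendsto (fun b : ℝ => ENNReal.ofReal b) (nhds 0) (nhds (ENNReal.ofReal 0)) :=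
      ENNReal.continuous_ofReal.tendsto 0
    rw [ENNReal.ofReal_zero] at h0
    exact h0.mono_left nhdsWithin_le_nhds
  obtain ⟨b, hb1, hb2⟩ := ((hlim.eventually_le_const (u := ε / 3) (by linarith)).and
    self_mem_nhdsWithin).exists
  refine ⟨b, hb2, fun M hM => ?_⟩
  obtain ⟨η, hη, H⟩ := counting_bounded G hpq C hC hC' M hM (ε / 3) (by linarith)
  refine ⟨η, hη, fun U1 U2 hU1 hU2 hcut g hg => ?_⟩
  have hM0 : 0 ≤ M := by linarith
  have hcm : Measurable (fun x => clip M (g x)) := (clip_meas M).comp hg.1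
  have h1 := H U1 U2 hU1 hU2 hcut (fun x => clip M (g x)) hcm (fun x => clip_abs_le hM0 _)
  have h2 : ∀ U, LrB (q * G.maxDegree) C U →
      |G1 G U g - G1 G U (fun x => clip M (g x))| ≤ ε / 3 := by
    intro U hU
    refine le_trans (G1_lip G hpq C hC hC' U hU g _ hg.1 hcm (fun x => ‖g x‖ₑ) hg.1.enorm
      (fun x => le_rfl) (fun x => ?_) L (ENNReal.ofReal b) hg.2.1 ?_ hL
      ENNReal.ofReal_ne_top) hb1
    · rw [Real.enorm_eq_ofReal_abs, Real.enorm_eq_ofReal_abs]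
      exact ENNReal.ofReal_le_ofReal (clip_abs_le' hM0 _)
    · refine le_trans (le_of_eq ?_) hg.2.2
      refine lintegral_congr fun x => ?_
      rw [Real.enorm_eq_ofReal_abs, clip_sub hM0]
  have h3 := h2 U1 hU1
  have h4 := h2 U2 hU2
  rw [abs_le] at *
  constructor <;> linarith [h1.1, h1.2, h3.1, h3.2, h4.1, h4.2]

end MGL

namespace MGL

/-- Cell index. -/
noncomputable def idx (n : ℕ) [NeZero n] (s : ℝ) : Fin n := Fin.ofNat n (⌈(n : ℝ) * s⌉₊ - 1)

theorem idx_meas (n : ℕ) [NeZero n] : Measurable (idx n) := by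
  have h : Measurable fun s : ℝ => ⌈(n : ℝ) * s⌉₊ :=
    Nat.measurable_ceil.comp (measurable_const.mul measurable_id)
  exact (measurable_of_countable (fun m : ℕ => Fin.ofNat n (m - 1))).comp h

theorem idx_iff (n : ℕ) [NeZero n] {s : ℝ} (hs : s ∈ Set.Ioc (0 : ℝ) 1) (i : Fin n) :
    idx n s = i ↔ s ∈ Set.Ioc (((i : ℕ) : ℝ) / n) ((((i : ℕ) : ℝ) + 1) / n) := by
  have hn : 0 < (n : ℝ) := by exact_mod_cast Nat.pos_of_ne_zero (NeZero.ne n)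
  have h1 : 0 < ⌈(n : ℝ) * s⌉₊ := Nat.ceil_pos.2 (mul_pos hn hs.1)
  have h2 : ⌈(n : ℝ) * s⌉₊ ≤ n := Nat.ceil_le.2 (by nlinarith [hs.2])
  have h3 : ((idx n s : Fin n) : ℕ) = ⌈(n : ℝ) * s⌉₊ - 1 := by
    simp only [idx, Fin.val_ofNat]
    exact Nat.mod_eq_of_lt (by omega)
  rw [Fin.ext_iff, h3, Set.mem_Ioc, div_lt_iff₀ hn, le_div_iff₀ hn]
  have h4 : ⌈(n : ℝ) * s⌉₊ - 1 = (i : ℕ) ↔ ⌈(n : ℝ) * s⌉₊ = (i : ℕ) + 1 := by omega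
  rw [h4, Nat.ceil_eq_iff (by omega)]
  push_cast
  rw [mul_comm s]

/-- Equidistributed index maps. -/
def equi {n : ℕ} (τ : ℝ → Fin n) : Prop :=
  Measurable τ ∧ ∀ i, unif01 (τ ⁻¹' {i}) = (n : ℝ≥0∞)⁻¹

theorem ae_Ioc : ∀ᵐ s ∂unif01, s ∈ Set.Ioc (0 : ℝ) 1 := by
  unfold unif01
  rw [← restrict_Ioc_eq_restrict_Icc]
  exact ae_restrict_mem measurableSet_Ioc

theorem idx_equi (n : ℕ) [NeZero n] : equi (idx n) := by
  refine ⟨idx_meas n, fun i => ?_⟩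
  have hn : 0 < (n : ℝ) := by exact_mod_cast Nat.pos_of_ne_zero (NeZero.ne n)
  have h1 : unif01 (idx n ⁻¹' {i}) =
      unif01 (Set.Ioc (((i : ℕ) : ℝ) / n) ((((i : ℕ) : ℝ) + 1) / n)) := by
    refine measure_congr ?_
    filter_upwards [ae_Ioc] with s hs
    exact propext (idx_iff n hs i)
  rw [h1, unif01, Measure.restrict_apply measurableSet_Ioc, Set.inter_eq_left.2, Real.volume_Ioc]
  · rw [← sub_div, add_sub_cancel_left, one_div, ENNReal.ofReal_inv_of_pos hn,
      ENNReal.ofReal_natCast]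
  · intro s hs
    have h2 : 0 ≤ ((i : ℕ) : ℝ) / n := by positivity
    have h3 : (((i : ℕ) : ℝ) + 1) / n ≤ 1 := by
      rw [div_le_one hn]; exact_mod_cast i.2
    exact ⟨h2.trans hs.1.le, hs.2.trans h3⟩

theorem equi_comp {n : ℕ} {τ : ℝ → Fin n} (hτ : equi τ) {σ : ℝ → ℝ}
    (hσ : MeasurePreserving σ unif01 unif01) : equi (τ ∘ σ) :=
  ⟨hτ.1.comp hσ.measurable, fun i => by
    rw [Set.preimage_comp, hσ.measure_preimage (hτ.1 (measurableSet_singleton i)).nullMeasurableSet]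
    exact hτ.2 i⟩

theorem stepKernel_idx (n : ℕ) [NeZero n] (Q : Fin n → Fin n → ℝ) {s t : ℝ}
    (hs : s ∈ Set.Ioc (0 : ℝ) 1) (ht : t ∈ Set.Ioc (0 : ℝ) 1) :
    stepKernel n Q s t = Q (idx n s) (idx n t) := by
  unfold stepKernel
  simp_rw [← idx_iff n hs, ← idx_iff n ht]
  simp [ite_and]

/-- Kernel from a matrix. -/
def ker {n : ℕ} (τ : ℝ → Fin n) (Q : Fin n → Fin n → ℝ) : ℝ → ℝ → ℝ := fun s t => Q (τ s) (τ t)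

theorem ker_meas {n : ℕ} {τ : ℝ → Fin n} (hτ : Measurable τ) (Q : Fin n → Fin n → ℝ) :
    Measurable (Function.uncurry (ker τ Q)) := by
  have h : Measurable (fun z : ℝ × ℝ => (τ z.1, τ z.2)) :=
    (hτ.comp measurable_fst).prodMk (hτ.comp measurable_snd)
  exact (measurable_of_countable (fun z : Fin n × Fin n => Q z.1 z.2)).comp h

theorem ite_meas {n : ℕ} {τ : ℝ → Fin n} (hτ : Measurable τ) (i : Fin n) {f : ℝ → ℝ}
    (hf : Integrable f unif01) : Integrable (fun s => if τ s = i then f s else 0) unif01 := by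
  have : (fun s => if τ s = i then f s else 0) = (τ ⁻¹' {i}).indicator f := by
    funext s; simp [Set.indicator]
  rw [this]
  exact hf.indicator (hτ (measurableSet_singleton i))

/-- Cell averages of a function. -/
noncomputable def cavg {n : ℕ} (τ : ℝ → Fin n) (f : ℝ → ℝ) (i : Fin n) : ℝ :=
  n * ∫ s, (if τ s = i then f s else 0) ∂unif01

theorem block_gen {v n : ℕ} {τ : ℝ → Fin n} (hτ : Measurable τ)
    (F : (Fin v → Fin n) → ℝ) (f : ℝ → ℝ) (hf : Integrable f unif01) :
    ∫ x : Fin v → ℝ, F (fun a => τ (x a)) * ∏ a, f (x a) ∂(piU v) =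
      ∑ i : Fin v → Fin n, F i * ∏ a, ∫ s, (if τ s = i a then f s else 0) ∂unif01 := by
  have h1 : ∀ x : Fin v → ℝ, F (fun a => τ (x a)) * ∏ a, f (x a) =
      ∑ i : Fin v → Fin n, F i * ∏ a, (if τ (x a) = i a then f (x a) else 0) := by
    intro x
    rw [Finset.sum_eq_single (fun a => τ (x a))]
    · simp
    · intro i _ hi
      have : ∃ a, τ (x a) ≠ i a := by
        by_contra hcon
        push Not at hcon
        exact hi (funext fun a => (hcon a).symm)
      obtain ⟨a, ha⟩ := this
      rw [Finset.prod_eq_zero (Finset.mem_univ a) (by simp [ha]), mul_zero]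
    · intro h; exact absurd (Finset.mem_univ _) h
  simp_rw [h1]
  rw [integral_finsetSum]
  · refine Finset.sum_congr rfl fun i _ => ?_
    rw [integral_const_mul]
    congr 1
    unfold piU
    exact integral_fintype_prod_eq_prod (𝕜 := ℝ)
      (fun a s => if τ s = i a then f s else 0)
  · intro i _
    refine Integrable.const_mul ?_ _
    unfold piU
    exact Integrable.fintype_prod (f := fun a s => if τ s = i a then f s else 0)
      fun a => ite_meas hτ (i a) hf

theorem prod_cavg {v n : ℕ} [NeZero n] (τ : ℝ → Fin n) (f : ℝ → ℝ) (i : Fin v → Fin n) :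
    (∏ a, cavg τ f (i a)) / (n : ℝ) ^ v =
      ∏ a, ∫ s, (if τ s = i a then f s else 0) ∂unif01 := by
  have hn : (n : ℝ) ≠ 0 := by exact_mod_cast NeZero.ne n
  unfold cavg
  rw [Finset.prod_mul_distrib]
  simp only [Finset.prod_const, Finset.card_univ, Fintype.card_fin]
  field_simp

theorem G1_block {v n : ℕ} [NeZero n] (G : SimpleGraph (Fin v)) [DecidableRel G.Adj]
    {τ : ℝ → Fin n} (hτ : Measurable τ) (Q : Fin n → Fin n → ℝ) (f : ℝ → ℝ)
    (hf : Integrable f unif01) :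
    G1 G (ker τ Q) f = Vstat G (fun y : Fin v → ℝ => ∏ a, y a) n Q (cavg τ f) := by
  unfold Vstat
  have := block_gen (v := v) hτ (fun i => edgeProd G (fun a b => Q (i a) (i b))) f hf
  refine this.trans ?_
  rw [Finset.sum_div]
  refine Finset.sum_congr rfl fun i _ => ?_
  rw [← prod_cavg]
  simp only [Function.comp]
  ring

theorem cavg_comp {n : ℕ} [NeZero n] {τ : ℝ → Fin n} (hτ : equi τ) (x : Fin n → ℝ) :
    cavg τ (fun s => x (τ s)) = x := by
  have hn : (n : ℝ) ≠ 0 := by exact_mod_cast NeZero.ne n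
  funext i
  unfold cavg
  have : (fun s => if τ s = i then x (τ s) else 0) = (τ ⁻¹' {i}).indicator (fun _ => x i) := by
    funext s
    by_cases h : τ s = i
    · simp [h]
    · simp [h]
  rw [this, integral_indicator_const _ (hτ.1 (measurableSet_singleton i)), Measure.real, hτ.2 i]
  simp [hn]

theorem comp_integrable {n : ℕ} {τ : ℝ → Fin n} (hτ : Measurable τ) (x : Fin n → ℝ) :
    Integrable (fun s => x (τ s)) unif01 := by
  refine Integrable.of_bound (C := ∑ i, |x i|)
    ((measurable_of_countable x).comp hτ).aestronglyMeasurable (ae_of_all _ fun s => ?_)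
  rw [Real.norm_eq_abs]
  exact Finset.single_le_sum (f := fun i => |x i|) (fun i _ => abs_nonneg _) (Finset.mem_univ _)

theorem Vstat_eq {v n : ℕ} [NeZero n] (G : SimpleGraph (Fin v)) [DecidableRel G.Adj]
    {τ : ℝ → Fin n} (hτ : equi τ) (Q : Fin n → Fin n → ℝ) (x : Fin n → ℝ) :
    Vstat G (fun y : Fin v → ℝ => ∏ a, y a) n Q x = G1 G (ker τ Q) (fun s => x (τ s)) := by
  rw [G1_block G hτ.1 Q _ (comp_integrable hτ.1 x), cavg_comp hτ]

open Classical in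
theorem Ustat_eq {v n : ℕ} [NeZero n] (G : SimpleGraph (Fin v)) [DecidableRel G.Adj]
    {τ : ℝ → Fin n} (hτ : equi τ) (Q : Fin n → Fin n → ℝ) (x : Fin n → ℝ) :
    Ustat G (fun y : Fin v → ℝ => ∏ a, y a) n Q x =
      ∫ y : Fin v → ℝ, KV G (fun _ => ker τ Q) y *
        ((if Function.Injective (fun a => τ (y a)) then 1 else 0) * ∏ a, x (τ (y a)))
          ∂(piU v) := by
  have := block_gen (v := v) hτ.1 (fun i => edgeProd G (fun a b => Q (i a) (i b)) *
    (if Function.Injective i then 1 else 0)) (fun s => x (τ s)) (comp_integrable hτ.1 x)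
  simp_rw [← mul_assoc]
  refine Eq.trans ?_ this.symm
  unfold Ustat
  rw [Finset.sum_filter, Finset.sum_div]
  refine Finset.sum_congr rfl fun i _ => ?_
  rw [← prod_cavg, cavg_comp hτ]
  simp only [Function.comp]
  split_ifs <;> ring

end MGL

namespace MGL

theorem coll_pair {n : ℕ} [NeZero n] {τ : ℝ → Fin n} (hτ : equi τ) :
    (unif01.prod unif01) {z | τ z.1 = τ z.2} = (n : ℝ≥0∞)⁻¹ := by
  have hn : (n : ℝ≥0∞) ≠ 0 := by exact_mod_cast NeZero.ne n
  have h : {z : ℝ × ℝ | τ z.1 = τ z.2} = ⋃ i : Fin n, (τ ⁻¹' {i}) ×ˢ (τ ⁻¹' {i}) := by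
    ext z; simp [eq_comm]
  rw [h, measure_iUnion]
  · simp_rw [Measure.prod_prod, hτ.2, tsum_fintype]
    simp [ENNReal.mul_inv_cancel hn (ENNReal.natCast_ne_top n), ← mul_assoc]
  · intro i j hij
    rw [Function.onFun, Set.disjoint_left]
    rintro z ⟨h1, _⟩ ⟨h2, _⟩
    exact hij (h1.symm.trans h2)
  · exact fun i => (hτ.1 (measurableSet_singleton i)).prod (hτ.1 (measurableSet_singleton i))

theorem noninj_bound {v n : ℕ} [NeZero n] {τ : ℝ → Fin n} (hτ : equi τ) :
    piU v {y | ¬ Function.Injective (fun a => τ (y a))} ≤ (v : ℝ≥0∞) ^ 2 * (n : ℝ≥0∞)⁻¹ := by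
  have hsub : {y : Fin v → ℝ | ¬ Function.Injective (fun a => τ (y a))} ⊆
      ⋃ e ∈ (Finset.univ.filter fun e : Fin v × Fin v => e.1 ≠ e.2),
        {y | τ (y e.1) = τ (y e.2)} := by
    intro y hy
    have hy' : ¬ Function.Injective (fun a => τ (y a)) := hy
    rw [Function.not_injective_iff] at hy'
    obtain ⟨a, b, hab, hne⟩ := hy'
    simp only [Set.mem_iUnion]
    exact ⟨(a, b), by simpa using hne, hab⟩
  refine (measure_mono hsub).trans ((measure_biUnion_finset_le _ _).trans ?_)
  calc _ ≤ ∑ _e ∈ (Finset.univ.filter fun e : Fin v × Fin v => e.1 ≠ e.2), (n : ℝ≥0∞)⁻¹ := by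
        refine Finset.sum_le_sum fun e he => ?_
        have hne : e.1 ≠ e.2 := (Finset.mem_filter.1 he).2
        have h1 := (mp_pair (fun _ : Fin v => unif01) hne).measure_preimage
          (s := {z | τ z.1 = τ z.2}) (measurableSet_eq_fun (hτ.1.comp measurable_fst)
            (hτ.1.comp measurable_snd)).nullMeasurableSet
        rw [coll_pair hτ] at h1
        exact h1.le
    _ ≤ ∑ _e : Fin v × Fin v, (n : ℝ≥0∞)⁻¹ :=
        Finset.sum_le_sum_of_subset (Finset.filter_subset _ _)
    _ = _ := by simp [sq]

theorem noninj_meas {v n : ℕ} {τ : ℝ → Fin n} (hτ : Measurable τ) :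
    MeasurableSet {y : Fin v → ℝ | ¬ Function.Injective (fun a => τ (y a))} := by
  have h : Measurable (fun y : Fin v → ℝ => fun a => τ (y a)) :=
    measurable_pi_lambda _ fun a => hτ.comp (measurable_pi_apply a)
  exact h (MeasurableSet.of_discrete (s := {i | ¬ Function.Injective i}))

theorem UV_bound {v n : ℕ} [NeZero n] (G : SimpleGraph (Fin v)) [DecidableRel G.Adj]
    {p q : ℝ} (hpq : p.HolderConjugate q) (C : ℝ≥0∞) (hC : 1 ≤ C) (hC' : C ≠ ⊤) (L : ℝ≥0∞)
    (hL : L ≠ ⊤) (b M : ℝ) (hM : 1 ≤ M) {τ : ℝ → Fin n} (hτ : equi τ) (Q : Fin n → Fin n → ℝ)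
    (hQ : LrB (q * G.maxDegree) C (ker τ Q)) (x : Fin n → ℝ)
    (hx : inCls p L (ENNReal.ofReal b) M (fun s => x (τ s))) :
    |Ustat G (fun y : Fin v → ℝ => ∏ a, y a) n Q x -
      Vstat G (fun y : Fin v → ℝ => ∏ a, y a) n Q x| ≤
      (lipK v (edgeF G).card p q C L (ENNReal.ofReal b)).toReal +
      ((C ^ (edgeF G).card) ^ (1 / q) * (ENNReal.ofReal (M ^ v) ^ p *
        ((v : ℝ≥0∞) ^ 2 * (n : ℝ≥0∞)⁻¹)) ^ (1 / p)).toReal := by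
  classical
  have hn : (n : ℝ≥0∞) ≠ 0 := by exact_mod_cast NeZero.ne n
  have hp := hpq.pos
  have hM0 : 0 ≤ M := by linarith
  set N : Set (Fin v → ℝ) := {y | ¬ Function.Injective (fun a => τ (y a))} with hN
  have hNm : MeasurableSet N := noninj_meas hτ.1
  set g : ℝ → ℝ := fun s => x (τ s) with hg
  set h : ℝ → ℝ := fun s => clip M (g s) with hh
  have hgm : Measurable g := hx.1
  have hhm : Measurable h := (clip_meas M).comp hgm
  set Ψ1 : (Fin v → ℝ) → ℝ := N.indicator (fun y => ∏ a, g (y a) - ∏ a, h (y a)) with hΨ1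
  set Ψ2 : (Fin v → ℝ) → ℝ := N.indicator (fun y => ∏ a, h (y a)) with hΨ2
  have hKg := G1_int G hpq C hC hC' _ hQ g hgm (hx.2.1.trans_lt hL.lt_top).ne
  have hdm := prod_diff_moment (v := v) hpq.lt.le g h hgm hhm (fun s => ‖g s‖ₑ) hgm.enorm
    (fun _ => le_rfl) (fun s => by
      rw [Real.enorm_eq_ofReal_abs, Real.enorm_eq_ofReal_abs]
      exact ENNReal.ofReal_le_ofReal (clip_abs_le' hM0 _)) L (ENNReal.ofReal b) hx.2.1
    (by
      refine le_trans (le_of_eq ?_) hx.2.2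
      refine lintegral_congr fun s => ?_
      rw [Real.enorm_eq_ofReal_abs, clip_sub hM0])
  have h1 := KV_int G hpq C hC hC' (fun _ => ker τ Q) (fun _ => hQ) Ψ1
    (((meas_prodg hgm).sub (meas_prodg hhm)).indicator hNm) _ (by
      refine ENNReal.mul_ne_top (ENNReal.rpow_ne_top_of_nonneg (by linarith [hpq.lt])
        (ENNReal.natCast_ne_top v)) (ENNReal.mul_ne_top (ENNReal.natCast_ne_top v)
        (ENNReal.mul_ne_top ENNReal.ofReal_ne_top (ENNReal.pow_ne_top hL))))
    (le_trans (lintegral_mono fun y => ENNReal.rpow_le_rpow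
      (enorm_indicator_le_enorm_self _ y) hp.le) hdm)
  have h2 := KV_int G hpq C hC hC' (fun _ => ker τ Q) (fun _ => hQ) Ψ2
    ((meas_prodg hhm).indicator hNm) (ENNReal.ofReal (M ^ v) ^ p *
        ((v : ℝ≥0∞) ^ 2 * (n : ℝ≥0∞)⁻¹)) (by
      refine ENNReal.mul_ne_top (ENNReal.rpow_ne_top_of_nonneg hp.le ENNReal.ofReal_ne_top)
        (ENNReal.mul_ne_top (by simp) (by simpa using hn)))
    (by
      calc _ ≤ ∫⁻ y, N.indicator (fun _ => ENNReal.ofReal (M ^ v) ^ p) y ∂(piU v) := by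
            refine lintegral_mono fun y => ?_
            by_cases hy : y ∈ N
            · simp only [hΨ2, Set.indicator_of_mem hy]
              refine ENNReal.rpow_le_rpow ?_ hp.le
              rw [Real.enorm_eq_ofReal_abs]
              exact ENNReal.ofReal_le_ofReal (prod_abs_le _ _ M hM v (by simp)
                fun a _ => clip_abs_le hM0 _)
            · simp [hΨ2, Set.indicator_of_notMem hy, hp]
        _ = ENNReal.ofReal (M ^ v) ^ p * piU v N := lintegral_indicator_const hNm _
        _ ≤ _ := by gcongr; exact noninj_bound hτ)
  have hdiff : Vstat G (fun y : Fin v → ℝ => ∏ a, y a) n Q x -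
      Ustat G (fun y : Fin v → ℝ => ∏ a, y a) n Q x =
      ∫ y, KV G (fun _ => ker τ Q) y * Ψ1 y ∂(piU v) +
      ∫ y, KV G (fun _ => ker τ Q) y * Ψ2 y ∂(piU v) := by
    have hs : ∫ y, KV G (fun _ => ker τ Q) y * Ψ1 y ∂(piU v) +
      ∫ y, KV G (fun _ => ker τ Q) y * Ψ2 y ∂(piU v) =
      ∫ y, (KV G (fun _ => ker τ Q) y * ∏ a, g (y a) - KV G (fun _ => ker τ Q) y *
        ((if Function.Injective (fun a => τ (y a)) then 1 else 0) * ∏ a, g (y a))) ∂(piU v) := by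
      rw [← integral_add h1.1 h2.1]
      refine integral_congr_ae (ae_of_all _ fun y => ?_)
      by_cases hy : Function.Injective (fun a => τ (y a))
      · have : y ∉ N := fun h => h hy
        simp [hΨ1, hΨ2, Set.indicator_of_notMem this, hy]
      · have : y ∈ N := hy
        simp only [hΨ1, hΨ2, Set.indicator_of_mem this, hy, if_false]
        ring
    rw [hs, Vstat_eq G hτ, Ustat_eq G hτ, integral_sub hKg, G1_eq]
    have hNc : Measurable fun y : Fin v → ℝ =>
        (if Function.Injective (fun a => τ (y a)) then (1 : ℝ) else 0) := by
      refine Measurable.ite ?_ measurable_const measurable_const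
      have := hNm.compl
      simpa [hN, Set.compl_ofPred] using this
    have := hKg.mul_bdd (c := 1) hNc.aestronglyMeasurable (ae_of_all _ fun y => by
      split_ifs <;> simp)
    refine this.congr (ae_of_all _ fun y => ?_)
    simp only []
    ring
  rw [abs_sub_comm, hdiff]
  exact (abs_add_le _ _).trans (add_le_add h1.2 h2.2)

theorem inCls_mono {p : ℝ} {L L' b b' : ℝ≥0∞} {M : ℝ} {g : ℝ → ℝ} (h : inCls p L b M g)
    (hL : L ≤ L') (hb : b ≤ b') : inCls p L' b' M g := ⟨h.1, h.2.1.trans hL, h.2.2.trans hb⟩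

theorem UV {v : ℕ} (G : SimpleGraph (Fin v)) [DecidableRel G.Adj]
    {p q : ℝ} (hpq : p.HolderConjugate q) (C : ℝ≥0∞) (hC : 1 ≤ C) (hC' : C ≠ ⊤) (L : ℝ≥0∞)
    (hL : L ≠ ⊤) (ε : ℝ) (hε : 0 < ε) :
    ∃ b : ℝ, 0 < b ∧ ∀ M : ℝ, 1 ≤ M → ∃ n0 : ℕ, ∀ n, n0 ≤ n → ∀ [NeZero n], ∀ τ : ℝ → Fin n,
      equi τ → ∀ Q : Fin n → Fin n → ℝ, LrB (q * G.maxDegree) C (ker τ Q) → ∀ x : Fin n → ℝ,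
      inCls p L (ENNReal.ofReal b) M (fun s => x (τ s)) →
      |Ustat G (fun y : Fin v → ℝ => ∏ a, y a) n Q x -
      Vstat G (fun y : Fin v → ℝ => ∏ a, y a) n Q x| ≤ ε := by
  have hp := hpq.pos
  have hq := hpq.symm.pos
  have hlim : Tendsto (fun b : ℝ => (lipK v (edgeF G).card p q C L (ENNReal.ofReal b)).toReal)
      (nhdsWithin 0 (Set.Ioi 0)) (nhds 0) := by
    refine lipK_tendsto v _ hpq.lt.le hpq.symm.pos hC' hL _ ?_
    have h0 : Tendsto (fun b : ℝ => ENNReal.ofReal b) (nhds 0) (nhds (ENNReal.ofReal 0)) :=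
      ENNReal.continuous_ofReal.tendsto 0
    rw [ENNReal.ofReal_zero] at h0
    exact h0.mono_left nhdsWithin_le_nhds
  obtain ⟨b, hb1, hb2⟩ := ((hlim.eventually_le_const (u := ε / 2) (by linarith)).and
    self_mem_nhdsWithin).exists
  refine ⟨b, hb2, fun M hM => ?_⟩
  have hl2 : Tendsto (fun n : ℕ => ((C ^ (edgeF G).card) ^ (1 / q) * (ENNReal.ofReal (M ^ v) ^ p *
        ((v : ℝ≥0∞) ^ 2 * (n : ℝ≥0∞)⁻¹)) ^ (1 / p)).toReal) atTop (nhds 0) := by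
    have h1 : Tendsto (fun n : ℕ => (n : ℝ≥0∞)⁻¹) atTop (nhds 0) :=
      ENNReal.tendsto_inv_nat_nhds_zero
    have h2 := ENNReal.Tendsto.const_mul h1
      (Or.inr (ENNReal.pow_ne_top (n := 2) (ENNReal.natCast_ne_top v)))
    rw [mul_zero] at h2
    have h3 := ENNReal.Tendsto.const_mul h2
      (Or.inr (ENNReal.rpow_ne_top_of_nonneg hp.le (ENNReal.ofReal_ne_top (r := M ^ v))))
    rw [mul_zero] at h3
    have h4 := h3.ennrpow_const (1 / p)
    rw [ENNReal.zero_rpow_of_pos (by positivity)] at h4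
    have h5 := ENNReal.Tendsto.const_mul h4
      (Or.inr (ENNReal.rpow_ne_top_of_nonneg (by positivity : 0 ≤ 1 / q)
        (ENNReal.pow_ne_top (n := (edgeF G).card) hC')))
    rw [mul_zero] at h5
    exact (ENNReal.tendsto_toReal ENNReal.zero_ne_top).comp h5
  obtain ⟨n0, hn0⟩ := eventually_atTop.1 (hl2.eventually_le_const (u := ε / 2) (by linarith))
  refine ⟨n0, fun n hn _ τ hτ Q hQ x hx => ?_⟩
  have := UV_bound G hpq C hC hC' L hL b M hM hτ Q hQ x hx
  have h2 := hn0 n hn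
  linarith

/-- Combined approximation of the U-statistic by a limiting functional. -/
theorem Ustat_approx {v : ℕ} (G : SimpleGraph (Fin v)) [DecidableRel G.Adj]
    {p q : ℝ} (hpq : p.HolderConjugate q) (C : ℝ≥0∞) (hC : 1 ≤ C) (hC' : C ≠ ⊤) (L : ℝ≥0∞)
    (hL : L ≠ ⊤) (ε : ℝ) (hε : 0 < ε) :
    ∃ b : ℝ, 0 < b ∧ ∀ M : ℝ, 1 ≤ M → ∃ η : ℝ, 0 < η ∧ (∃ n0 : ℕ, ∀ n, n0 ≤ n → ∀ [NeZero n],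
      ∀ τ : ℝ → Fin n,
      equi τ → ∀ Q : Fin n → Fin n → ℝ, LrB (q * G.maxDegree) C (ker τ Q) → ∀ x : Fin n → ℝ,
      inCls p L (ENNReal.ofReal b) M (fun s => x (τ s)) →
      |Ustat G (fun y : Fin v → ℝ => ∏ a, y a) n Q x -
      Vstat G (fun y : Fin v → ℝ => ∏ a, y a) n Q x| ≤ ε) ∧ ∀ U1 U2 : ℝ → ℝ → ℝ,
      LrB (q * G.maxDegree) C U1 →
      LrB (q * G.maxDegree) C U2 → cutB η (fun s t => U1 s t - U2 s t) →
      ∀ g : ℝ → ℝ, inCls p L (ENNReal.ofReal b) M g → |G1 G U1 g - G1 G U2 g| ≤ ε := by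
  obtain ⟨b1, hb1, H1⟩ := UV G hpq C hC hC' L hL ε hε
  obtain ⟨b2, hb2, H2⟩ := counting G hpq C hC hC' L hL ε hε
  refine ⟨min b1 b2, lt_min hb1 hb2, fun M hM => ?_⟩
  obtain ⟨n0, h1⟩ := H1 M hM
  obtain ⟨η, hη, h2⟩ := H2 M hM
  refine ⟨η, hη, ⟨n0, fun n hn _ τ hτ Q hQ x hx => h1 n hn τ hτ Q hQ x
    (inCls_mono hx le_rfl (ENNReal.ofReal_le_ofReal (min_le_left _ _)))⟩,
    fun U1 U2 hU1 hU2 hc g hg => h2 U1 U2 hU1 hU2 hc g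
    (inCls_mono hg le_rfl (ENNReal.ofReal_le_ofReal (min_le_right _ _)))⟩

end MGL

namespace MGL

theorem MPB_id : MPB id := ⟨Set.bijOn_id _, MeasurePreserving.id _⟩

theorem restr_eq {S : Set ℝ} (hS : MeasurableSet S) :
    (volume : Measure ℝ).restrict (Set.Icc (0 : ℝ) 1 ∩ S) = unif01.restrict S := by
  rw [unif01, Measure.restrict_restrict hS, Set.inter_comm]

theorem setint_bound {U : ℝ → ℝ → ℝ} (hU : Integrable (Function.uncurry U) (unif01.prod unif01))
    {S T : Set ℝ} :
    |∫ s in S, ∫ t in T, U s t ∂unif01 ∂unif01| ≤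
      ∫ z, |Function.uncurry U z| ∂(unif01.prod unif01) := by
  have h1 : ∫ s in S, ∫ t in T, U s t ∂unif01 ∂unif01 =
      ∫ z in S ×ˢ T, Function.uncurry U z ∂(unif01.prod unif01) :=
    (setIntegral_prod _ hU.integrableOn).symm
  rw [h1, ← Real.norm_eq_abs]
  refine (norm_integral_le_integral_norm _).trans ?_
  exact setIntegral_le_integral hU.norm (ae_of_all _ fun z => norm_nonneg _)

theorem cutB_of_L1 {U : ℝ → ℝ → ℝ} (hU : Integrable (Function.uncurry U) (unif01.prod unif01))
    {η : ℝ} (h : ∫ z, |Function.uncurry U z| ∂(unif01.prod unif01) ≤ η) : cutB η U :=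
  fun _ _ _ _ => (setint_bound hU).trans h

theorem cutB_of_cutDist {U V : ℝ → ℝ → ℝ}
    (hU : Integrable (Function.uncurry U) (unif01.prod unif01))
    (hV : Integrable (Function.uncurry V) (unif01.prod unif01)) {η : ℝ}
    (h : cutDist U V ≤ η) : cutB η (fun s t => U s t - V s t) := by
  intro S T hS hT
  set B := ∫ z, |Function.uncurry (fun s t => U s t - V s t) z| ∂(unif01.prod unif01) with hB
  have hInt1 : Integrable (Function.uncurry (fun s t => U s t - V s t)) (unif01.prod unif01) :=
    hU.sub hV
  have hb : ∀ (S T : {S : Set ℝ // MeasurableSet S}),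
      |∫ x in Set.Icc (0:ℝ) 1 ∩ S.1, ∫ y in Set.Icc (0:ℝ) 1 ∩ T.1, (U x y - V x y)| ≤ B := by
    intro S T
    rw [restr_eq S.2, restr_eq T.2]
    exact setint_bound hInt1
  have hB0 : 0 ≤ B := integral_nonneg fun z => abs_nonneg _
  refine le_trans ?_ h
  unfold cutDist
  have h1 := le_ciSup (f := fun T : {T : Set ℝ // MeasurableSet T} =>
    |∫ x in Set.Icc (0:ℝ) 1 ∩ S, ∫ y in Set.Icc (0:ℝ) 1 ∩ T.1, (U x y - V x y)|)
    ⟨B, by rintro _ ⟨T, rfl⟩; exact hb ⟨S, hS⟩ T⟩ ⟨T, hT⟩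
  have h2 := le_ciSup (f := fun S : {S : Set ℝ // MeasurableSet S} =>
    ⨆ T : {T : Set ℝ // MeasurableSet T},
    |∫ x in Set.Icc (0:ℝ) 1 ∩ S.1, ∫ y in Set.Icc (0:ℝ) 1 ∩ T.1, (U x y - V x y)|)
    ⟨B, by rintro _ ⟨S, rfl⟩; exact ciSup_le fun T => hb S T⟩ ⟨S, hS⟩
  refine le_trans (le_of_eq ?_) (h1.trans h2)
  simp only []
  rw [restr_eq hS, restr_eq hT]

theorem ker_integrable {n : ℕ} {τ : ℝ → Fin n} (hτ : Measurable τ) (Q : Fin n → Fin n → ℝ) :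
    Integrable (Function.uncurry (ker τ Q)) (unif01.prod unif01) := by
  refine Integrable.of_bound (C := ∑ i, ∑ j, |Q i j|)
    (ker_meas hτ Q).aestronglyMeasurable (ae_of_all _ fun z => ?_)
  rw [Real.norm_eq_abs]
  refine le_trans ?_ (Finset.single_le_sum (f := fun i => ∑ j, |Q i j|)
    (fun i _ => Finset.sum_nonneg fun j _ => abs_nonneg _) (Finset.mem_univ (τ z.1)))
  exact Finset.single_le_sum (f := fun j => |Q (τ z.1) j|) (fun i _ => abs_nonneg _)
    (Finset.mem_univ (τ z.2))

theorem prod_ae_Ioc : ∀ᵐ z ∂(unif01.prod unif01),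
    z.1 ∈ Set.Ioc (0 : ℝ) 1 ∧ z.2 ∈ Set.Ioc (0 : ℝ) 1 := by
  have h1 : ∀ᵐ z ∂(unif01.prod unif01), z.1 ∈ Set.Ioc (0 : ℝ) 1 :=
    (Measure.quasiMeasurePreserving_fst).ae ae_Ioc
  have h2 : ∀ᵐ z ∂(unif01.prod unif01), z.2 ∈ Set.Ioc (0 : ℝ) 1 :=
    (Measure.quasiMeasurePreserving_snd).ae ae_Ioc
  filter_upwards [h1, h2] with z a b using ⟨a, b⟩

theorem step_ae (n : ℕ) [NeZero n] (Q : Fin n → Fin n → ℝ) {σ : ℝ → ℝ}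
    (hσ : MeasurePreserving σ unif01 unif01) :
    (Function.uncurry fun x y => stepKernel n Q (σ x) (σ y)) =ᵐ[unif01.prod unif01]
      Function.uncurry (ker (idx n ∘ σ) Q) := by
  have := (hσ.prod hσ).quasiMeasurePreserving.ae prod_ae_Ioc
  filter_upwards [this] with z hz
  exact stepKernel_idx n Q hz.1 hz.2

theorem cutB_congr {U V : ℝ → ℝ → ℝ}
    (hU : Integrable (Function.uncurry U) (unif01.prod unif01)) {η : ℝ}
    (hUV : Function.uncurry U =ᵐ[unif01.prod unif01] Function.uncurry V) (h : cutB η U) :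
    cutB η V := by
  intro S T hS hT
  have hV := hU.congr hUV
  have h1 := h S T hS hT
  have e1 : ∫ s in S, ∫ t in T, U s t ∂unif01 ∂unif01 =
      ∫ z in S ×ˢ T, Function.uncurry U z ∂(unif01.prod unif01) :=
    (setIntegral_prod _ hU.integrableOn).symm
  have e2 : ∫ s in S, ∫ t in T, V s t ∂unif01 ∂unif01 =
      ∫ z in S ×ˢ T, Function.uncurry V z ∂(unif01.prod unif01) :=
    (setIntegral_prod _ hV.integrableOn).symm
  rw [e2, ← integral_congr_ae (ae_restrict_of_ae hUV), ← e1]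
  exact h1

theorem kernels_approx (Q : ∀ n : ℕ, Fin n → Fin n → ℝ)
    (W : ℝ → ℝ → ℝ) (hWmeas : Measurable (Function.uncurry W)) (hWL1 : kerNorm W 1 ≠ ⊤)
    (hcut : Tendsto (fun n => weakCutDist (stepKernel n (Q n)) W) atTop (nhds 0))
    (D : ℕ) (q : ℝ≥0∞) (q' : ℝ) (hq' : 0 < q') (hqq : ENNReal.ofReal q' ≤ q)
    (hnorm : Filter.atTop.limsup
        (fun n => kerNorm (stepKernel n (Q n)) (q * (D : ℝ≥0∞))) ≠ ⊤) :
    ∃ C : ℝ≥0∞, 1 ≤ C ∧ C ≠ ⊤ ∧ ∀ η : ℝ, 0 < η → ∀ᶠ n : ℕ in atTop, ∀ [NeZero n],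
      ∃ τ : ℝ → Fin n, equi τ ∧ LrB (q' * D) C (ker τ (Q n)) ∧
        cutB η (fun s t => ker τ (Q n) s t - W s t) := by
  obtain ⟨C0, hC0, hC0'⟩ := exists_between (lt_top_iff_ne_top.2 hnorm)
  have hev := eventually_lt_of_limsup_lt hC0
  have hWi : Integrable (Function.uncurry W) (unif01.prod unif01) := by
    rw [← memLp_one_iff_integrable]
    exact ⟨hWmeas.aestronglyMeasurable, hWL1.lt_top⟩
  refine ⟨max 1 (C0 ^ (q' * D)), le_max_left _ _, ?_, ?_⟩
  · exact (max_lt ENNReal.one_lt_top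
      (ENNReal.rpow_lt_top_of_nonneg (by positivity) hC0'.ne)).ne
  intro η hη
  filter_upwards [hev, hcut.eventually_lt_const hη] with n hn1 hn2
  intro _
  haveI : Nonempty {σ : ℝ → ℝ // MPB σ} := ⟨⟨id, MPB_id⟩⟩
  obtain ⟨⟨σ, hσ⟩, hσ2⟩ := exists_lt_of_ciInf_lt hn2
  have hmp := hσ.2
  have hτ : equi (idx n ∘ σ) := equi_comp (idx_equi n) hmp
  refine ⟨idx n ∘ σ, hτ, ⟨ker_meas hτ.1 _, ?_⟩, ?_⟩
  · by_cases hD : D = 0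
    · subst hD
      simp
    have hr : 0 < q' * D := mul_pos hq' (by exact_mod_cast Nat.pos_of_ne_zero hD)
    refine le_trans ?_ (le_max_right _ _)
    have e1 : ∫⁻ z : ℝ × ℝ, ‖ker (idx n ∘ σ) (Q n) z.1 z.2‖ₑ ^ (q' * (D : ℝ))
        ∂(unif01.prod unif01) =
        ∫⁻ z : ℝ × ℝ, ‖ker (idx n) (Q n) z.1 z.2‖ₑ ^ (q' * (D : ℝ)) ∂(unif01.prod unif01) :=
      (hmp.prod hmp).lintegral_comp
        (f := fun z : ℝ × ℝ => ‖ker (idx n) (Q n) z.1 z.2‖ₑ ^ (q' * (D : ℝ)))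
        ((ker_meas (idx_meas n) (Q n)).enorm.pow_const _)
    have e2 : ∫⁻ z : ℝ × ℝ, ‖ker (idx n) (Q n) z.1 z.2‖ₑ ^ (q' * (D : ℝ))
        ∂(unif01.prod unif01) =
        ∫⁻ z : ℝ × ℝ, ‖stepKernel n (Q n) z.1 z.2‖ₑ ^ (q' * (D : ℝ)) ∂(unif01.prod unif01) := by
      refine lintegral_congr_ae ?_
      filter_upwards [prod_ae_Ioc] with z hz
      rw [stepKernel_idx n (Q n) hz.1 hz.2]
      rfl
    rw [e1, e2]
    have hsm : AEStronglyMeasurable (fun z : ℝ × ℝ => stepKernel n (Q n) z.1 z.2)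
        (unif01.prod unif01) :=
      (ker_meas (idx_meas n) (Q n)).aestronglyMeasurable.congr
        (by
          filter_upwards [prod_ae_Ioc] with z hz
          rw [stepKernel_idx n (Q n) hz.1 hz.2]
          rfl)
    have h3 : kerNorm (stepKernel n (Q n)) (ENNReal.ofReal (q' * D)) ≤ C0 := by
      refine le_trans ?_ hn1.le
      unfold kerNorm
      refine eLpNorm_le_eLpNorm_of_exponent_le ?_ hsm
      rw [ENNReal.ofReal_mul hq'.le, ENNReal.ofReal_natCast]
      gcongr
    unfold kerNorm at h3
    rw [eLpNorm_eq_lintegral_rpow_enorm_toReal (by simpa using hr) ENNReal.ofReal_ne_top,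
      ENNReal.toReal_ofReal hr.le] at h3
    have h4 := ENNReal.rpow_le_rpow h3 hr.le
    rwa [← ENNReal.rpow_mul, one_div, inv_mul_cancel₀ hr.ne', ENNReal.rpow_one] at h4
  · have hae := step_ae n (Q n) hmp
    have hki := ker_integrable hτ.1 (Q n)
    have hsi := hki.congr hae.symm
    have h1 := cutB_of_cutDist hsi hWi hσ2.le
    refine cutB_congr (U := fun s t => stepKernel n (Q n) (σ s) (σ t) - W s t)
      (hsi.sub hWi) ?_ h1
    filter_upwards [hae] with z hz
    show stepKernel n (Q n) (σ z.1) (σ z.2) - W z.1 z.2 = _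
    have hz' : stepKernel n (Q n) (σ z.1) (σ z.2) = ker (idx n ∘ σ) (Q n) z.1 z.2 := hz
    rw [hz']; rfl

end MGL

namespace MGL

theorem lpow_jensen {Ω : Type*} [MeasurableSpace Ω] (P : Measure Ω) [IsProbabilityMeasure P]
    {p : ℝ} (hp : 1 ≤ p) (h : Ω → ℝ≥0∞) (hh : Measurable h) :
    (∫⁻ ω, h ω ∂P) ^ p ≤ ∫⁻ ω, h ω ^ p ∂P := by
  rcases eq_or_lt_of_le hp with h1 | h1
  · subst h1; simp
  have hpq := Real.HolderConjugate.conjExponent h1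
  have := ENNReal.lintegral_mul_le_Lp_mul_Lq P hpq hh.aemeasurable
    (aemeasurable_const (b := (1 : ℝ≥0∞)))
  simp only [Pi.mul_apply, mul_one, ENNReal.one_rpow, lintegral_const, measure_univ] at this
  have h2 := ENNReal.rpow_le_rpow this (by linarith : 0 ≤ p)
  rwa [← ENNReal.rpow_mul, one_div, inv_mul_cancel₀ (by linarith), ENNReal.rpow_one] at h2

/-- Jensen property. -/
def JP (φ : ℝ → ℝ≥0∞) : Prop :=
  ∀ (Ω : Type) [MeasurableSpace Ω] (P : Measure Ω) [IsProbabilityMeasure P] (f : Ω → ℝ),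
    Measurable f → Integrable f P → φ (∫ ω, f ω ∂P) ≤ ∫⁻ ω, φ (f ω) ∂P

theorem JP_tail {p : ℝ} (hp : 1 ≤ p) (M : ℝ) :
    JP (fun y => ENNReal.ofReal (max (|y| - M) 0) ^ p) := by
  intro Ω _ P _ f hfm hf
  simp only []
  have hm : Measurable fun ω => ENNReal.ofReal (max (|f ω| - M) 0) :=
    ((hfm.abs.sub_const M).max measurable_const).ennreal_ofReal
  refine le_trans (ENNReal.rpow_le_rpow ?_ (by linarith)) (lpow_jensen P hp _ hm)
  have hi : Integrable (fun ω => |f ω| - M) P := hf.abs.sub (integrable_const M)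
  have hi2 : Integrable (fun ω => max (|f ω| - M) 0) P := hi.pos_part
  rw [← ofReal_integral_eq_lintegral_ofReal hi2 (ae_of_all _ fun ω => le_max_right _ _)]
  refine ENNReal.ofReal_le_ofReal (max_le ?_ (integral_nonneg fun ω => le_max_right _ _))
  calc |∫ ω, f ω ∂P| - M ≤ ∫ ω, |f ω| ∂P - M := by
        gcongr
        exact abs_integral_le_integral_abs
    _ = ∫ ω, (|f ω| - M) ∂P := by
        rw [integral_sub hf.abs (integrable_const M)]; simp
    _ ≤ _ := integral_mono hi hi2 fun ω => le_max_left _ _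

theorem JP_pow {p : ℝ} (hp : 1 ≤ p) : JP (fun y => ‖y‖ₑ ^ p) := by
  intro Ω _ P _ f hfm hf
  have := JP_tail hp 0 Ω P f hfm hf
  simpa [Real.enorm_eq_ofReal_abs] using this

theorem JP_gamma (μ : Measure ℝ) : JP (gammaBeta μ) := by
  intro Ω _ P _ f hfm hf
  unfold gammaBeta
  refine iSup_le fun t => ?_
  have hi : Integrable (fun ω => t * f ω - cgf' μ t) P :=
    (hf.const_mul t).sub (integrable_const _)
  have e : t * ∫ ω, f ω ∂P - cgf' μ t = ∫ ω, (t * f ω - cgf' μ t) ∂P := by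
    rw [integral_sub (hf.const_mul t) (integrable_const _), integral_const_mul]; simp
  rw [e]
  refine le_trans ?_ (lintegral_mono fun ω =>
    le_iSup (fun t => ENNReal.ofReal (t * f ω - cgf' μ t)) t)
  refine le_trans (ENNReal.ofReal_le_ofReal (integral_mono hi hi.pos_part
    fun ω => le_max_left _ _)) ?_
  rw [ofReal_integral_eq_lintegral_ofReal hi.pos_part (ae_of_all _ fun ω => le_max_right _ _)]
  refine lintegral_mono fun ω => ?_
  simp

/-- cell averages, general -/
noncomputable def avgG {Ω ι : Type*} [MeasurableSpace Ω] [Fintype ι] [DecidableEq ι]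
    (P : Measure Ω) (τ : Ω → ι) (f : Ω → ℝ) (i : ι) : ℝ :=
  Fintype.card ι * ∫ ω, (if τ ω = i then f ω else 0) ∂P

section
variable {Ω ι : Type} [MeasurableSpace Ω] [Fintype ι] [DecidableEq ι] [MeasurableSpace ι]
  [MeasurableSingletonClass ι]

/-- The normalized cell measure. -/
noncomputable def cellM (P : Measure Ω) (τ : Ω → ι) (i : ι) : Measure Ω :=
  (Fintype.card ι : ℝ≥0∞) • P.restrict (τ ⁻¹' {i})

theorem cellM_prob [Nonempty ι] (P : Measure Ω) {τ : Ω → ι}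
    (hP : ∀ i, P (τ ⁻¹' {i}) = (Fintype.card ι : ℝ≥0∞)⁻¹) (i : ι) :
    IsProbabilityMeasure (cellM P τ i) := ⟨by
  have : (Fintype.card ι : ℝ≥0∞) ≠ 0 := by simp
  simp [cellM, hP, ENNReal.mul_inv_cancel this]⟩

theorem avgG_eq (P : Measure Ω) {τ : Ω → ι} (hτ : Measurable τ) (f : Ω → ℝ) (i : ι) :
    avgG P τ f i = ∫ ω, f ω ∂(cellM P τ i) := by
  unfold avgG cellM
  rw [integral_smul_measure, ← integral_indicator (hτ (measurableSet_singleton i))]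
  simp only [ENNReal.toReal_natCast, smul_eq_mul]
  congr 2
  funext ω
  simp [Set.indicator]

theorem cellM_int (P : Measure Ω) {τ : Ω → ι} {f : Ω → ℝ} (hf : Integrable f P) (i : ι) :
    Integrable f (cellM P τ i) :=
  (hf.restrict (s := τ ⁻¹' {i})).smul_measure (ENNReal.natCast_ne_top _)

theorem lint_cells [Nonempty ι] (P : Measure Ω) {τ : Ω → ι} (hτ : Measurable τ)
    (hP : ∀ i, P (τ ⁻¹' {i}) = (Fintype.card ι : ℝ≥0∞)⁻¹) (F : ι → ℝ≥0∞) :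
    ∫⁻ ω, F (τ ω) ∂P = ∑ i, (Fintype.card ι : ℝ≥0∞)⁻¹ * F i := by
  have h1 : ∀ ω, F (τ ω) = ∑ i, (τ ⁻¹' {i}).indicator (fun _ => F i) ω := by
    intro ω
    rw [Finset.sum_eq_single (τ ω)]
    · simp
    · intro i _ hi
      rw [Set.indicator_of_notMem]
      simpa using hi.symm
    · simp
  simp_rw [h1]
  rw [lintegral_finsetSum]
  · refine Finset.sum_congr rfl fun i _ => ?_
    rw [lintegral_indicator_const (hτ (measurableSet_singleton i)), hP, mul_comm]
  · exact fun i _ => measurable_const.indicator (hτ (measurableSet_singleton i))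

theorem lint_split (P : Measure Ω) {τ : Ω → ι} (hτ : Measurable τ) (F : Ω → ℝ≥0∞) :
    ∑ i, ∫⁻ ω in τ ⁻¹' {i}, F ω ∂P = ∫⁻ ω, F ω ∂P := by
  have h : (⋃ i, τ ⁻¹' {i}) = Set.univ := by ext; simp
  rw [← setLIntegral_univ, ← h, lintegral_iUnion, tsum_fintype]
  · exact fun i => hτ (measurableSet_singleton i)
  · intro i j hij
    rw [Function.onFun, Set.disjoint_left]
    intro ω h1 h2
    exact hij (h1.symm.trans h2)

theorem jensen_avg [Nonempty ι] (P : Measure Ω) {τ : Ω → ι} (hτ : Measurable τ)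
    (hP : ∀ i, P (τ ⁻¹' {i}) = (Fintype.card ι : ℝ≥0∞)⁻¹) {φ : ℝ → ℝ≥0∞} (hφ : JP φ)
    (f : Ω → ℝ) (hfm : Measurable f) (hf : Integrable f P) :
    ∫⁻ ω, φ (avgG P τ f (τ ω)) ∂P ≤ ∫⁻ ω, φ (f ω) ∂P := by
  rw [lint_cells P hτ hP (fun i => φ (avgG P τ f i)), ← lint_split P hτ]
  refine Finset.sum_le_sum fun i _ => ?_
  have := cellM_prob P hP i
  have h1 := hφ _ (cellM P τ i) f hfm (cellM_int P hf i)
  rw [← avgG_eq P hτ] at h1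
  have h0 : (Fintype.card ι : ℝ≥0∞) ≠ 0 := by simp
  calc _ ≤ (Fintype.card ι : ℝ≥0∞)⁻¹ * ∫⁻ ω, φ (f ω) ∂(cellM P τ i) := by gcongr
    _ = _ := by
      unfold cellM
      rw [lintegral_smul_measure, smul_eq_mul, ← mul_assoc,
        ENNReal.inv_mul_cancel h0 (ENNReal.natCast_ne_top _), one_mul]

theorem avgG_sub (P : Measure Ω) {τ : Ω → ι} (hτ : Measurable τ) {f g : Ω → ℝ}
    (hf : Integrable f P) (hg : Integrable g P) (i : ι) :
    avgG P τ (fun ω => f ω - g ω) i = avgG P τ f i - avgG P τ g i := by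
  rw [avgG_eq P hτ, avgG_eq P hτ, avgG_eq P hτ,
    integral_sub (cellM_int P hf i) (cellM_int P hg i)]

end

/-- Pair of indices. -/
def pairτ {n : ℕ} (τ : ℝ → Fin n) (z : ℝ × ℝ) : Fin n × Fin n := (τ z.1, τ z.2)

theorem pairτ_meas {n : ℕ} {τ : ℝ → Fin n} (hτ : Measurable τ) : Measurable (pairτ τ) :=
  (hτ.comp measurable_fst).prodMk (hτ.comp measurable_snd)

theorem pairτ_equi {n : ℕ} {τ : ℝ → Fin n} (hτ : equi τ) (i : Fin n × Fin n) :
    (unif01.prod unif01) (pairτ τ ⁻¹' {i}) = (Fintype.card (Fin n × Fin n) : ℝ≥0∞)⁻¹ := by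
  have : pairτ τ ⁻¹' {i} = (τ ⁻¹' {i.1}) ×ˢ (τ ⁻¹' {i.2}) := by
    ext z; simp [pairτ, Prod.ext_iff]
  rw [this, Measure.prod_prod, hτ.2, hτ.2]
  simp only [Fintype.card_prod, Fintype.card_fin, Nat.cast_mul]
  rw [ENNReal.mul_inv] <;> simp

/-- block averages of a kernel. -/
noncomputable def bavg {n : ℕ} (τ : ℝ → Fin n) (U : ℝ → ℝ → ℝ) (i j : Fin n) : ℝ :=
  avgG (unif01.prod unif01) (pairτ τ) (Function.uncurry U) (i, j)

theorem cavg_eq {n : ℕ} (τ : ℝ → Fin n) (f : ℝ → ℝ) : cavg τ f = avgG unif01 τ f := by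
  funext i
  simp [cavg, avgG]

theorem jensen_cavg {n : ℕ} [NeZero n] {τ : ℝ → Fin n} (hτ : equi τ) {φ : ℝ → ℝ≥0∞} (hφ : JP φ)
    (f : ℝ → ℝ) (hfm : Measurable f) (hf : Integrable f unif01) :
    ∫⁻ s, φ (cavg τ f (τ s)) ∂unif01 ≤ ∫⁻ s, φ (f s) ∂unif01 := by
  rw [cavg_eq]
  exact jensen_avg unif01 hτ.1 (by simpa using hτ.2) hφ f hfm hf

theorem bavg_LrB {n : ℕ} [NeZero n] {τ : ℝ → Fin n} (hτ : equi τ) {r : ℝ} (hr : 1 ≤ r) {C : ℝ≥0∞}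
    {U : ℝ → ℝ → ℝ} (hU : LrB r C U)
    (hUi : Integrable (Function.uncurry U) (unif01.prod unif01)) :
    LrB r C (ker τ (bavg τ U)) := by
  refine ⟨ker_meas hτ.1 _, le_trans ?_ hU.2⟩
  exact jensen_avg (unif01.prod unif01) (pairτ_meas hτ.1) (pairτ_equi hτ)
    (φ := fun y => ‖y‖ₑ ^ r) (JP_pow hr)
    (Function.uncurry U) hU.1 hUi

end MGL

namespace MGL

theorem cell_close (k : ℕ) [NeZero k] {z w : ℝ × ℝ}
    (hz : z.1 ∈ Set.Ioc (0 : ℝ) 1 ∧ z.2 ∈ Set.Ioc (0 : ℝ) 1)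
    (hw : w.1 ∈ Set.Ioc (0 : ℝ) 1 ∧ w.2 ∈ Set.Ioc (0 : ℝ) 1)
    (h : pairτ (idx k) w = pairτ (idx k) z) : dist w z ≤ 1 / k := by
  have key : ∀ s t : ℝ, s ∈ Set.Ioc (0 : ℝ) 1 → t ∈ Set.Ioc (0 : ℝ) 1 → idx k s = idx k t →
      dist s t ≤ 1 / k := by
    intro s t hs ht e
    have h1 := (idx_iff k hs _).1 e
    have h2 := (idx_iff k ht _).1 rfl
    rw [Real.dist_eq, abs_le]
    rw [add_div] at h1 h2
    constructor <;> linarith [h1.1, h1.2, h2.1, h2.2]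
  rw [Prod.dist_eq]
  have := Prod.ext_iff.1 h
  exact max_le (key _ _ hw.1 hz.1 this.1) (key _ _ hw.2 hz.2 this.2)

theorem avg_cont (k : ℕ) [NeZero k] (φ : ℝ × ℝ → ℝ) (hφ : Integrable φ (unif01.prod unif01))
    {ε δ : ℝ} (hδ : ∀ w z, dist w z < δ → dist (φ w) (φ z) < ε) (hk : 1 / (k : ℝ) < δ)
    {z : ℝ × ℝ} (hz : z.1 ∈ Set.Ioc (0 : ℝ) 1 ∧ z.2 ∈ Set.Ioc (0 : ℝ) 1) :
    |avgG (unif01.prod unif01) (pairτ (idx k)) φ (pairτ (idx k) z) - φ z| ≤ ε := by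
  have hm := pairτ_meas (idx_equi k).1
  rw [avgG_eq _ hm]
  have := cellM_prob (unif01.prod unif01) (pairτ_equi (idx_equi k)) (pairτ (idx k) z)
  have e : ∫ ω, φ ω ∂(cellM (unif01.prod unif01) (pairτ (idx k)) (pairτ (idx k) z)) - φ z =
      ∫ ω, (φ ω - φ z) ∂(cellM (unif01.prod unif01) (pairτ (idx k)) (pairτ (idx k) z)) := by
    rw [integral_sub (cellM_int _ hφ _) (integrable_const _)]; simp
  rw [e, ← Real.norm_eq_abs]
  refine (norm_integral_le_of_norm_le_const (C := ε) ?_).trans (by simp)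
  unfold cellM
  refine Measure.ae_smul_measure ?_ _
  have h1 : ∀ᵐ w ∂((unif01.prod unif01).restrict (pairτ (idx k) ⁻¹' {pairτ (idx k) z})),
      pairτ (idx k) w = pairτ (idx k) z :=
    ae_restrict_mem (hm (measurableSet_singleton _))
  filter_upwards [h1, ae_restrict_of_ae prod_ae_Ioc] with w hw hw2
  have := hδ w z ((cell_close k hz hw2 hw).trans_lt hk)
  rw [Real.dist_eq] at this
  exact this.le

theorem bavg_L1 {W : ℝ → ℝ → ℝ} (hWm : Measurable (Function.uncurry W))
    (hW : Integrable (Function.uncurry W) (unif01.prod unif01)) {η : ℝ} (hη : 0 < η) :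
    ∃ k0 : ℕ, ∀ k ≥ k0, ∀ [NeZero k],
      ∫⁻ z, ‖ker (idx k) (bavg (idx k) W) z.1 z.2 - W z.1 z.2‖ₑ ∂(unif01.prod unif01) ≤
        ENNReal.ofReal η := by
  obtain ⟨φ, hcs, hφ, hc, hφi⟩ := hW.exists_hasCompactSupport_integral_sub_le
    (by positivity : 0 < η / 3)
  have huc : UniformContinuous φ := hcs.uniformContinuous_of_continuous hc
  obtain ⟨δ, hδ, hδ'⟩ := Metric.uniformContinuous_iff.1 huc (η / 3) (by positivity)
  obtain ⟨k0, hk0⟩ := exists_nat_one_div_lt hδ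
  refine ⟨k0 + 1, fun k hk _ => ?_⟩
  have hkk : 1 / (k : ℝ) < δ := by
    refine lt_of_le_of_lt ?_ hk0
    gcongr
    exact_mod_cast hk
  set P := unif01.prod unif01
  have hm := pairτ_meas (idx_equi k).1
  have hφ2 : ∫⁻ z, ‖Function.uncurry W z - φ z‖ₑ ∂P ≤ ENNReal.ofReal (η / 3) := by
    have e := ofReal_integral_norm_eq_lintegral_enorm (hW.sub hφi)
    simp only [Pi.sub_apply] at e
    rw [← e]
    exact ENNReal.ofReal_le_ofReal hφ
  have hmd : Measurable fun z => Function.uncurry W z - φ z := hWm.sub hc.measurable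
  have h1 : ∫⁻ z, ‖avgG P (pairτ (idx k)) (fun z => Function.uncurry W z - φ z)
      (pairτ (idx k) z)‖ₑ ∂P ≤ ENNReal.ofReal (η / 3) := by
    refine le_trans ?_ hφ2
    have := jensen_avg P hm (pairτ_equi (idx_equi k)) (JP_pow le_rfl)
      (fun z => Function.uncurry W z - φ z) hmd (hW.sub hφi)
    simpa using this
  have hpt : ∀ᵐ z ∂P, ‖ker (idx k) (bavg (idx k) W) z.1 z.2 - W z.1 z.2‖ₑ ≤
      ‖avgG P (pairτ (idx k)) (fun z => Function.uncurry W z - φ z) (pairτ (idx k) z)‖ₑ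
      + ENNReal.ofReal (η / 3) + ‖Function.uncurry W z - φ z‖ₑ := by
    filter_upwards [prod_ae_Ioc] with z hz
    have h2 := avg_cont k φ hφi (fun w z h => hδ' h) hkk hz
    rw [avgG_sub P hm hW hφi]
    have e : ker (idx k) (bavg (idx k) W) z.1 z.2 =
      avgG P (pairτ (idx k)) (Function.uncurry W) (pairτ (idx k) z) := rfl
    rw [e]
    simp only [Real.enorm_eq_ofReal_abs]
    rw [← ENNReal.ofReal_add (by positivity) (by positivity),
      ← ENNReal.ofReal_add (by positivity) (by positivity)]
    refine ENNReal.ofReal_le_ofReal ?_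
    have e2 : W z.1 z.2 = Function.uncurry W z := rfl
    rw [e2]
    have a1 := abs_sub_le (avgG P (pairτ (idx k)) (Function.uncurry W) (pairτ (idx k) z))
      (avgG P (pairτ (idx k)) φ (pairτ (idx k) z)) (Function.uncurry W z)
    have a2 := abs_sub_le (avgG P (pairτ (idx k)) φ (pairτ (idx k) z)) (φ z)
      (Function.uncurry W z)
    rw [abs_sub_comm (φ z)] at a2
    linarith
  refine (lintegral_mono_ae hpt).trans ?_
  rw [lintegral_add_right _ hmd.enorm, lintegral_add_right _ measurable_const]
  refine (add_le_add (add_le_add h1 le_rfl) hφ2).trans ?_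
  simp only [lintegral_const, measure_univ, mul_one]
  rw [← ENNReal.ofReal_add (by positivity) (by positivity),
      ← ENNReal.ofReal_add (by positivity) (by positivity)]
  refine ENNReal.ofReal_le_ofReal (by linarith)

theorem bavg_cut {k : ℕ} [NeZero k] {τ : ℝ → Fin k} (hτ : equi τ) {U W : ℝ → ℝ → ℝ}
    (hU : Integrable (Function.uncurry U) (unif01.prod unif01))
    (hW : Integrable (Function.uncurry W) (unif01.prod unif01)) {η : ℝ}
    (h : cutB η (fun s t => U s t - W s t)) (i j : Fin k) :
    |bavg τ U i j - bavg τ W i j| ≤ k * k * η := by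
  unfold bavg
  rw [← avgG_sub _ (pairτ_meas hτ.1) hU hW]
  unfold avgG
  have h1 := h (τ ⁻¹' {i}) (τ ⁻¹' {j}) (hτ.1 (measurableSet_singleton i))
    (hτ.1 (measurableSet_singleton j))
  rw [← setIntegral_prod (fun z : ℝ × ℝ => U z.1 z.2 - W z.1 z.2) (hU.sub hW).integrableOn,
    ← integral_indicator ((hτ.1 (measurableSet_singleton i)).prod
      (hτ.1 (measurableSet_singleton j)))] at h1
  rw [abs_mul]
  simp only [Fintype.card_prod, Fintype.card_fin, Nat.cast_mul, Nat.abs_cast, abs_mul]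
  refine mul_le_mul_of_nonneg_left (le_trans (le_of_eq ?_) h1) (by positivity)
  congr 2
  funext z
  simp [Set.indicator, pairτ, Function.uncurry]

theorem LrB_block_limit {k : ℕ} [NeZero k] {τ : ℝ → Fin k} (hτ : equi τ) {r : ℝ} (hr : 1 ≤ r)
    {C : ℝ≥0∞} (hC : C ≠ ⊤) {W : ℝ → ℝ → ℝ}
    (hW : Integrable (Function.uncurry W) (unif01.prod unif01))
    (h : ∀ η : ℝ, 0 < η → ∃ U, LrB r C U ∧ cutB η (fun s t => U s t - W s t)) :
    LrB r C (ker τ (bavg τ W)) := by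
  refine ⟨ker_meas hτ.1 _, ?_⟩
  have hpos : ∀ m : ℕ, (0 : ℝ) < 1 / (m + 1) := fun m => by positivity
  choose U hU hcut using fun m : ℕ => h (1 / (m + 1)) (hpos m)
  have hl : ∀ i j, Tendsto (fun m => bavg τ (U m) i j) atTop (nhds (bavg τ W i j)) := by
    intro i j
    rw [tendsto_iff_dist_tendsto_zero]
    refine squeeze_zero (fun _ => dist_nonneg) (fun m => ?_)
      (g := fun m : ℕ => (k : ℝ) * k * (1 / ((m : ℝ) + 1))) ?_
    · rw [Real.dist_eq]
      exact bavg_cut hτ (LrB_integrable hr hC (hU m)) hW (hcut m) i j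
    · simpa using tendsto_one_div_add_atTop_nhds_zero_nat.const_mul ((k : ℝ) * k)
  have hform : ∀ B : Fin k → Fin k → ℝ, ∫⁻ z, ‖ker τ B z.1 z.2‖ₑ ^ r ∂(unif01.prod unif01) =
      ∑ i : Fin k × Fin k, (Fintype.card (Fin k × Fin k) : ℝ≥0∞)⁻¹ * ‖B i.1 i.2‖ₑ ^ r :=
    fun B => lint_cells (unif01.prod unif01) (pairτ_meas hτ.1) (pairτ_equi hτ)
      (fun i => ‖B i.1 i.2‖ₑ ^ r)
  rw [hform]
  refine le_of_tendsto' (x := atTop) (f := fun m => ∑ i : Fin k × Fin k,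
    (Fintype.card (Fin k × Fin k) : ℝ≥0∞)⁻¹ * ‖bavg τ (U m) i.1 i.2‖ₑ ^ r) ?_ (fun m => ?_)
  · refine tendsto_finsetSum _ fun i _ => ENNReal.Tendsto.const_mul ?_ (Or.inr ?_)
    · exact ((ENNReal.continuous_rpow_const.tendsto _).comp
        ((continuous_enorm.tendsto _).comp (hl i.1 i.2)))
    · simp [NeZero.ne k]
  · rw [← hform]
    exact (bavg_LrB hτ hr (hU m) (LrB_integrable hr hC (hU m))).2

theorem LrB_limit {r : ℝ} (hr : 1 ≤ r)
    {C : ℝ≥0∞} (hC : C ≠ ⊤) {W : ℝ → ℝ → ℝ} (hWm : Measurable (Function.uncurry W))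
    (hW : Integrable (Function.uncurry W) (unif01.prod unif01))
    (h : ∀ η : ℝ, 0 < η → ∃ U, LrB r C U ∧ cutB η (fun s t => U s t - W s t)) :
    LrB r C W := by
  refine ⟨hWm, ?_⟩
  let V : ℕ → ℝ × ℝ → ℝ := fun k z => ker (idx (k + 1)) (bavg (idx (k + 1)) W) z.1 z.2
  have hVm : ∀ k, Measurable (V k) := fun k => ker_meas (idx_equi (k + 1)).1 _
  have hV : ∀ k, ∫⁻ z, ‖V k z‖ₑ ^ r ∂(unif01.prod unif01) ≤ C := fun k =>
    (LrB_block_limit (idx_equi (k + 1)) hr hC hW h).2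
  have ht : Tendsto (fun k => eLpNorm (V k - Function.uncurry W) 1 (unif01.prod unif01)) atTop
      (nhds 0) := by
    rw [ENNReal.tendsto_nhds_zero]
    intro ε hε
    by_cases he : ε = ⊤
    · simp [he]
    obtain ⟨k0, hk0⟩ := bavg_L1 hWm hW (ENNReal.toReal_pos hε.ne' he)
    filter_upwards [eventually_ge_atTop k0] with k hk
    have := hk0 (k + 1) (by omega)
    rw [ENNReal.ofReal_toReal he] at this
    rw [eLpNorm_one_eq_lintegral_enorm]
    exact this
  have hm := tendstoInMeasure_of_tendsto_eLpNorm one_ne_zero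
    (fun k => (hVm k).aestronglyMeasurable) hWm.aestronglyMeasurable ht
  obtain ⟨ns, _, hns⟩ := hm.exists_seq_tendsto_ae
  calc ∫⁻ z : ℝ × ℝ, ‖W z.1 z.2‖ₑ ^ r ∂(unif01.prod unif01)
      = ∫⁻ z : ℝ × ℝ, liminf (fun i => ‖V (ns i) z‖ₑ ^ r) atTop ∂(unif01.prod unif01) := by
        refine lintegral_congr_ae ?_
        filter_upwards [hns] with z hz
        refine (Tendsto.liminf_eq ?_).symm
        exact ((ENNReal.continuous_rpow_const.tendsto _).comp
          ((continuous_enorm.tendsto _).comp hz))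
    _ ≤ liminf (fun i => ∫⁻ z : ℝ × ℝ, ‖V (ns i) z‖ₑ ^ r ∂(unif01.prod unif01)) atTop :=
        lintegral_liminf_le fun i => (hVm _).enorm.pow_const r
    _ ≤ C := by
        refine liminf_le_of_le (by isBoundedDefault) fun b hb => ?_
        obtain ⟨i, hi⟩ := hb.exists
        exact hi.trans (hV _)

end MGL

namespace MGL

section
variable {μ : Measure ℝ} [IsProbabilityMeasure μ]

theorem expset_univ (hE : ∀ t : ℝ, Integrable (fun x => Real.exp (t * x)) μ) :
    ProbabilityTheory.integrableExpSet id μ = Set.univ := by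
  ext t; simpa [ProbabilityTheory.integrableExpSet] using hE t

theorem mem_int (hE : ∀ t : ℝ, Integrable (fun x => Real.exp (t * x)) μ) (t : ℝ) :
    t ∈ interior (ProbabilityTheory.integrableExpSet id μ) := by
  simp [expset_univ hE]

theorem cgf_eq : cgf' μ = ProbabilityTheory.cgf id μ := rfl

theorem exp_int_pos (hE : ∀ t : ℝ, Integrable (fun x => Real.exp (t * x)) μ) (t : ℝ) :
    0 < ∫ x, Real.exp (t * x) ∂μ := integral_exp_pos (hE t)

theorem exp_cgf (hE : ∀ t : ℝ, Integrable (fun x => Real.exp (t * x)) μ) (t : ℝ) :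
    Real.exp (cgf' μ t) = ∫ x, Real.exp (t * x) ∂μ := Real.exp_log (exp_int_pos hE t)

theorem x_exp_int (hE : ∀ t : ℝ, Integrable (fun x => Real.exp (t * x)) μ) (t : ℝ) :
    Integrable (fun x => x * Real.exp (t * x)) μ := by
  simpa using ProbabilityTheory.integrable_pow_mul_exp_of_mem_interior_integrableExpSet
    (mem_int hE t) 1

theorem cgf_diff (hE : ∀ t : ℝ, Integrable (fun x => Real.exp (t * x)) μ) (t : ℝ) :
    DifferentiableAt ℝ (cgf' μ) t := by
  rw [cgf_eq]
  exact (ProbabilityTheory.analyticAt_cgf (mem_int hE t)).differentiableAt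

theorem x_exp_val (hE : ∀ t : ℝ, Integrable (fun x => Real.exp (t * x)) μ) (t : ℝ) :
    ∫ x, x * Real.exp (t * x) ∂μ = deriv (cgf' μ) t * Real.exp (cgf' μ t) := by
  rw [exp_cgf hE, cgf_eq, ProbabilityTheory.deriv_cgf (mem_int hE t)]
  exact (div_mul_cancel₀ _ (exp_int_pos hE t).ne').symm

theorem cgf_zero : cgf' μ 0 = 0 := by simp [cgf']

theorem cgf_deriv_zero (hE : ∀ t : ℝ, Integrable (fun x => Real.exp (t * x)) μ) :
    deriv (cgf' μ) 0 = ∫ x, x ∂μ := by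
  have := x_exp_val hE 0
  simpa [cgf_zero] using this.symm

theorem cgf_tangent (hE : ∀ t : ℝ, Integrable (fun x => Real.exp (t * x)) μ) (s t : ℝ) :
    cgf' μ s + deriv (cgf' μ) s * (t - s) ≤ cgf' μ t := by
  rw [← Real.exp_le_exp, exp_cgf hE t]
  set a := deriv (cgf' μ) s
  have h1 : ∀ x, Real.exp ((t - s) * a) *
      ((1 - (t - s) * a) * Real.exp (s * x) + (t - s) * (x * Real.exp (s * x))) ≤
      Real.exp (t * x) := by
    intro x
    have e : Real.exp (t * x) = Real.exp ((t - s) * a) * (Real.exp ((t - s) * x - (t - s) * a) *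
      Real.exp (s * x)) := by
      rw [← Real.exp_add, ← Real.exp_add]; congr 1; ring
    rw [e]
    refine mul_le_mul_of_nonneg_left ?_ (Real.exp_pos _).le
    have := mul_le_mul_of_nonneg_right (Real.add_one_le_exp ((t - s) * x - (t - s) * a))
      (Real.exp_pos (s * x)).le
    linarith
  have hi1 := (hE s).const_mul (1 - (t - s) * a)
  have hi2 := (x_exp_int hE s).const_mul (t - s)
  refine le_trans (le_of_eq ?_) (integral_mono ((hi1.add hi2).const_mul
    (Real.exp ((t - s) * a))) (hE t) h1)
  simp only [Pi.add_apply]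
  rw [integral_const_mul, integral_add hi1 hi2, integral_const_mul, integral_const_mul,
    x_exp_val hE, ← exp_cgf hE, Real.exp_add, mul_comm a]
  ring

theorem cgf_convex (hE : ∀ t : ℝ, Integrable (fun x => Real.exp (t * x)) μ) {ι : Type*}
    (I : Finset ι) (w t : ι → ℝ) (hw : ∀ i ∈ I, 0 ≤ w i) (hw1 : ∑ i ∈ I, w i = 1) :
    cgf' μ (∑ i ∈ I, w i * t i) ≤ ∑ i ∈ I, w i * cgf' μ (t i) := by
  set s := ∑ i ∈ I, w i * t i with hs
  have h : ∑ i ∈ I, w i * (cgf' μ s + deriv (cgf' μ) s * (t i - s)) ≤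
      ∑ i ∈ I, w i * cgf' μ (t i) :=
    Finset.sum_le_sum fun i hi => mul_le_mul_of_nonneg_left (cgf_tangent hE s (t i)) (hw i hi)
  refine le_trans (le_of_eq ?_) h
  have e : ∀ i, w i * (cgf' μ s + deriv (cgf' μ) s * (t i - s)) =
    w i * (cgf' μ s - deriv (cgf' μ) s * s) + deriv (cgf' μ) s * (w i * t i) := fun i => by ring
  simp_rw [e]
  rw [Finset.sum_add_distrib, ← Finset.sum_mul, ← Finset.mul_sum, hw1, ← hs]
  ring

theorem cgf_ge_mean (hE : ∀ t : ℝ, Integrable (fun x => Real.exp (t * x)) μ) (t : ℝ) :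
    t * (∫ x, x ∂μ) ≤ cgf' μ t := by
  have := cgf_tangent hE 0 t
  rw [cgf_zero, cgf_deriv_zero hE] at this
  linarith

theorem id_int (hE : ∀ t : ℝ, Integrable (fun x => Real.exp (t * x)) μ) :
    Integrable (fun x : ℝ => x) μ := by simpa using x_exp_int hE 0

/-- One-sided tails: positive mass strictly above the mean. -/
theorem mass_pos (hnd : ∀ x : ℝ, μ ≠ Measure.dirac x) (s m : ℝ) (hs : s ≠ 0)
    (hid : Integrable (fun x : ℝ => x) μ) (hm : m = ∫ x, x ∂μ) :
    ∃ δ > 0, 0 < μ.real {x | δ ≤ s * (x - m)} := by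
  by_contra hcon
  push Not at hcon
  have h0 : ∀ δ > 0, μ {x | δ ≤ s * (x - m)} = 0 := fun δ hδ => by
    have := le_antisymm (hcon δ hδ) measureReal_nonneg
    simpa using (measureReal_eq_zero_iff (by finiteness)).1 this
  have h1 : ∀ᵐ x ∂μ, 0 ≤ -(s * (x - m)) := by
    have : ∀ᵐ x ∂μ, ∀ k : ℕ, ¬ (1 / ((k : ℝ) + 1) ≤ s * (x - m)) := by
      rw [ae_all_iff]
      intro k
      rw [ae_iff]
      simpa using h0 (1 / ((k : ℝ) + 1)) (by positivity)
    filter_upwards [this] with x hx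
    by_contra hneg
    push Not at hneg
    obtain ⟨k, hk⟩ := exists_nat_one_div_lt (by linarith : 0 < s * (x - m))
    exact hx k hk.le
  have hi : Integrable (fun x => -(s * (x - m))) μ :=
    ((hid.sub (integrable_const m)).const_mul s).neg
  have h2 : ∫ x, -(s * (x - m)) ∂μ = 0 := by
    rw [integral_neg, integral_const_mul, integral_sub hid (integrable_const m)]
    simp [hm]
  have h3 := (integral_eq_zero_iff_of_nonneg_ae h1 hi).1 h2
  have h4 : ∀ᵐ x ∂μ, x = m := by
    filter_upwards [h3] with x hx
    simp only [Pi.zero_apply, neg_eq_zero, mul_eq_zero, hs, false_or] at hx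
    linarith
  refine hnd m ?_
  have h5 : μ = μ.map id := Measure.map_id.symm
  rw [h5, Measure.map_congr (f := id) (g := fun _ => m) h4, Measure.map_const]
  simp

theorem cgf_coercive (hE : ∀ t : ℝ, Integrable (fun x => Real.exp (t * x)) μ)
    (hnd : ∀ x : ℝ, μ ≠ Measure.dirac x) :
    ∃ δ > 0, ∃ B : ℝ, ∀ t : ℝ, t * (∫ x, x ∂μ) - cgf' μ t ≤ B - δ * |t| := by
  set m := ∫ x, x ∂μ with hm
  have key : ∀ s : ℝ, (s = 1 ∨ s = -1) → ∃ δ > 0, ∃ B : ℝ, ∀ t : ℝ, 0 ≤ t →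
      (s * t) * m - cgf' μ (s * t) ≤ B - δ * t := by
    intro s hs
    obtain ⟨δ, hδ, hpos⟩ := mass_pos hnd s m (by rcases hs with h | h <;> simp [h]) (id_int hE) hm
    refine ⟨δ, hδ, -Real.log (μ.real {x | δ ≤ s * (x - m)}), fun t ht => ?_⟩
    have hms : MeasurableSet {x : ℝ | δ ≤ s * (x - m)} :=
      measurableSet_le measurable_const (by fun_prop)
    have h1 : Real.exp (s * t * m + δ * t) * μ.real {x | δ ≤ s * (x - m)} ≤
        ∫ x, Real.exp (s * t * x) ∂μ := by
      calc _ = ∫ x in {x : ℝ | δ ≤ s * (x - m)}, Real.exp (s * t * m + δ * t) ∂μ := by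
            rw [setIntegral_const, smul_eq_mul, mul_comm]
        _ ≤ ∫ x in {x : ℝ | δ ≤ s * (x - m)}, Real.exp (s * t * x) ∂μ := by
            refine setIntegral_mono_on (integrable_const _).integrableOn (hE _).integrableOn hms ?_
            intro x hx
            have hx' : δ ≤ s * (x - m) := hx
            refine Real.exp_le_exp.2 ?_
            nlinarith
        _ ≤ _ := setIntegral_le_integral (hE _) (ae_of_all _ fun x => (Real.exp_pos _).le)
    have h2 := Real.log_le_log (by positivity) h1
    rw [Real.log_mul (Real.exp_pos _).ne' hpos.ne', Real.log_exp] at h2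
    unfold cgf'
    linarith
  obtain ⟨d1, hd1, B1, h1⟩ := key 1 (Or.inl rfl)
  obtain ⟨d2, hd2, B2, h2⟩ := key (-1) (Or.inr rfl)
  refine ⟨min d1 d2, lt_min hd1 hd2, max B1 B2, fun t => ?_⟩
  rcases le_total 0 t with ht | ht
  · have := h1 t ht
    simp only [one_mul] at this
    rw [abs_of_nonneg ht]
    have a := mul_le_mul_of_nonneg_right (min_le_left d1 d2) ht
    have b := le_max_left B1 B2
    linarith
  · have := h2 (-t) (by linarith)
    simp only [neg_mul, one_mul, neg_neg] at this
    rw [abs_of_nonpos ht]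
    have a := mul_le_mul_of_nonneg_right (min_le_right d1 d2) (by linarith : 0 ≤ -t)
    have b := le_max_right B1 B2
    linarith

theorem gamma_ge (u t : ℝ) (h : gammaBeta μ u ≠ ⊤) : t * u - cgf' μ t ≤ (gammaBeta μ u).toReal := by
  have := le_iSup (fun t => ENNReal.ofReal (t * u - cgf' μ t)) t
  exact (ENNReal.ofReal_le_iff_le_toReal h).1 this

theorem tilt_exists (hE : ∀ t : ℝ, Integrable (fun x => Real.exp (t * x)) μ)
    (hnd : ∀ x : ℝ, μ ≠ Measure.dirac x) {u ε : ℝ} (h : gammaBeta μ u ≠ ⊤) (hε : 0 < ε)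
    (hε1 : ε ≤ 1) :
    ∃ t : ℝ, deriv (cgf' μ) t = (1 - ε) * u + ε * ∫ x, x ∂μ ∧
      t * ((1 - ε) * u + ε * ∫ x, x ∂μ) - cgf' μ t ≤ (gammaBeta μ u).toReal := by
  set m := ∫ x, x ∂μ with hm
  set x := (1 - ε) * u + ε * m with hx
  obtain ⟨δ, hδ, B, hB⟩ := cgf_coercive hE hnd
  have hup : ∀ t, t * x - cgf' μ t ≤ (1 - ε) * (gammaBeta μ u).toReal + ε * (t * m - cgf' μ t) := by
    intro t
    have h1 := mul_le_mul_of_nonneg_left (gamma_ge u t h) (by linarith : 0 ≤ 1 - ε)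
    rw [hx]; linarith
  have hcont : Continuous fun t => cgf' μ t - t * x :=
    (continuous_iff_continuousAt.2 fun t => (cgf_diff hE t).continuousAt).sub
      (continuous_id.mul continuous_const)
  have hlim : Tendsto (fun t => cgf' μ t - t * x) (cocompact ℝ) atTop := by
    have h2 : Tendsto (fun t : ℝ => ε * δ * ‖t‖ + (-((1 - ε) * (gammaBeta μ u).toReal) - ε * B))
        (cocompact ℝ) atTop :=
      tendsto_atTop_add_const_right _ _
        ((tendsto_norm_cocompact_atTop).const_mul_atTop (by positivity))
    refine tendsto_atTop_mono (fun t => ?_) h2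
    have h3 := hup t
    have h4 := mul_le_mul_of_nonneg_left (hB t) hε.le
    rw [Real.norm_eq_abs]
    linarith
  obtain ⟨t, ht⟩ := hcont.exists_forall_le hlim
  refine ⟨t, ?_, ?_⟩
  · have hmin : IsLocalMin (fun t => cgf' μ t - t * x) t := Filter.Eventually.of_forall ht
    have hd : HasDerivAt (fun t => cgf' μ t - t * x) (deriv (cgf' μ) t - 1 * x) t :=
      (cgf_diff hE t).hasDerivAt.sub ((hasDerivAt_id t).mul_const x)
    have := hmin.hasDerivAt_eq_zero hd
    linarith
  · have h3 := hup t
    have h4 := cgf_ge_mean hE t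
    rw [← hm] at h4
    have h5 : 0 ≤ (gammaBeta μ u).toReal := ENNReal.toReal_nonneg
    nlinarith

theorem mem_closure_Ncal (hE : ∀ t : ℝ, Integrable (fun x => Real.exp (t * x)) μ)
    (hnd : ∀ x : ℝ, μ ≠ Measure.dirac x) {u : ℝ} (h : gammaBeta μ u ≠ ⊤) :
    u ∈ closure (Ncal μ) := by
  have hl : Tendsto (fun k : ℕ => (1 - 1 / ((k : ℝ) + 1)) * u + 1 / ((k : ℝ) + 1) * ∫ x, x ∂μ)
      atTop (nhds ((1 - 0) * u + 0 * ∫ x, x ∂μ)) :=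
    ((tendsto_const_nhds.sub tendsto_one_div_add_atTop_nhds_zero_nat).mul_const u).add
      (tendsto_one_div_add_atTop_nhds_zero_nat.mul_const _)
  simp only [sub_zero, one_mul, zero_mul, add_zero] at hl
  refine mem_closure_of_tendsto hl (Eventually.of_forall fun k => ?_)
  obtain ⟨t, ht, _⟩ := tilt_exists hE hnd h (ε := 1 / ((k : ℝ) + 1)) (by positivity)
    (by rw [div_le_one (by positivity)]; linarith [(Nat.cast_nonneg k : (0 : ℝ) ≤ k)])
  exact ⟨t, ht⟩

theorem gamma_mean (hE : ∀ t : ℝ, Integrable (fun x => Real.exp (t * x)) μ) :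
    gammaBeta μ (∫ x, x ∂μ) = 0 := by
  unfold gammaBeta
  simp only [ENNReal.iSup_eq_zero, ENNReal.ofReal_eq_zero]
  intro t
  linarith [cgf_ge_mean hE t]

end

end MGL

namespace MGL

section
variable {μ : Measure ℝ} [IsProbabilityMeasure μ]

/-- exponential tilt density -/
noncomputable def tl (μ : Measure ℝ) (t x : ℝ) : ℝ := Real.exp (t * x - cgf' μ t)

theorem tl_eq (t x : ℝ) : tl μ t x = Real.exp (-cgf' μ t) * Real.exp (t * x) := by
  unfold tl; rw [← Real.exp_add]; congr 1; ring

theorem tl_int (hE : ∀ t : ℝ, Integrable (fun x => Real.exp (t * x)) μ) (t : ℝ) :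
    Integrable (tl μ t) μ ∧ ∫ x, tl μ t x ∂μ = 1 := by
  have : tl μ t = fun x => Real.exp (-cgf' μ t) * Real.exp (t * x) := funext (tl_eq t)
  rw [this]
  refine ⟨(hE t).const_mul _, ?_⟩
  rw [integral_const_mul, ← exp_cgf hE, ← Real.exp_add]; simp

theorem tlx_int (hE : ∀ t : ℝ, Integrable (fun x => Real.exp (t * x)) μ) (t : ℝ) :
    Integrable (fun x => x * tl μ t x) μ ∧ ∫ x, x * tl μ t x ∂μ = deriv (cgf' μ) t := by
  have : (fun x => x * tl μ t x) = fun x => Real.exp (-cgf' μ t) * (x * Real.exp (t * x)) := by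
    funext x; rw [tl_eq]; ring
  rw [this]
  refine ⟨(x_exp_int hE t).const_mul _, ?_⟩
  rw [integral_const_mul, x_exp_val hE, mul_left_comm, ← Real.exp_add]; simp

theorem prod_tilt (hE : ∀ t : ℝ, Integrable (fun x => Real.exp (t * x)) μ) {n : ℕ}
    (t : Fin n → ℝ) (S : Finset (Fin n)) :
    Integrable (fun y : Fin n → ℝ => (∏ j ∈ S, y j) * ∏ j, tl μ (t j) (y j))
      (Measure.pi fun _ => μ) ∧
    ∫ y : Fin n → ℝ, (∏ j ∈ S, y j) * ∏ j, tl μ (t j) (y j) ∂(Measure.pi fun _ => μ) =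
      ∏ j ∈ S, deriv (cgf' μ) (t j) := by
  let h : Fin n → ℝ → ℝ := fun j y => (if j ∈ S then y else 1) * tl μ (t j) y
  have e : (fun y : Fin n → ℝ => (∏ j ∈ S, y j) * ∏ j, tl μ (t j) (y j)) =
      fun y => ∏ j, h j (y j) := by
    funext y
    simp only [h, Finset.prod_mul_distrib]
    congr 1
    simp
  have hh : ∀ j, Integrable (h j) μ ∧ ∫ y, h j y ∂μ = if j ∈ S then deriv (cgf' μ) (t j) else 1 := by
    intro j
    by_cases hj : j ∈ S
    · simpa [h, hj] using tlx_int hE (t j)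
    · simpa [h, hj] using tl_int hE (t j)
  rw [e]
  refine ⟨Integrable.fintype_prod (fun j => (hh j).1), ?_⟩
  rw [integral_fintype_prod_eq_prod (𝕜 := ℝ)]
  simp_rw [fun j => (hh j).2]
  simp

theorem Ustat_sum {v n : ℕ} (G : SimpleGraph (Fin v)) [DecidableRel G.Adj]
    (Q : Fin n → Fin n → ℝ) (y : Fin n → ℝ) :
    Ustat G (fun y : Fin v → ℝ => ∏ a, y a) n Q y =
      ∑ i ∈ Finset.univ.filter (fun i : Fin v → Fin n => Function.Injective i),
        (edgeProd G (fun a b => Q (i a) (i b)) / (n : ℝ) ^ v) *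
          ∏ j ∈ Finset.univ.image i, y j := by
  unfold Ustat
  rw [Finset.sum_div]
  refine Finset.sum_congr rfl fun i hi => ?_
  have hinj : Function.Injective i := (Finset.mem_filter.1 hi).2
  rw [Finset.prod_image (fun a _ b _ h => hinj h)]
  simp only [Function.comp]
  ring

theorem Ustat_meas {v n : ℕ} (G : SimpleGraph (Fin v)) [DecidableRel G.Adj]
    (Q : Fin n → Fin n → ℝ) :
    Measurable (Ustat G (fun y : Fin v → ℝ => ∏ a, y a) n Q) := by
  have : Ustat G (fun y : Fin v → ℝ => ∏ a, y a) n Q = fun y => _ := funext (Ustat_sum G Q)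
  rw [this]
  exact Finset.measurable_sum _ fun i _ => measurable_const.mul
    (Finset.measurable_prod _ fun j _ => measurable_pi_apply j)

theorem gibbs_lower (hE : ∀ t : ℝ, Integrable (fun x => Real.exp (t * x)) μ) {v n : ℕ}
    (G : SimpleGraph (Fin v)) [DecidableRel G.Adj]
    (Q : Fin n → Fin n → ℝ) (θ : ℝ) (t : Fin n → ℝ)
    (hInt1 : Integrable (fun y => Real.exp (n * θ * Ustat G (fun y : Fin v → ℝ => ∏ a, y a) n Q y))
      (Measure.pi fun _ => μ)) :
    n * θ * Ustat G (fun y : Fin v → ℝ => ∏ a, y a) n Q (fun i => deriv (cgf' μ) (t i)) -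
      ∑ i, (t i * deriv (cgf' μ) (t i) - cgf' μ (t i)) ≤
    Real.log (∫ y, Real.exp (n * θ * Ustat G (fun y : Fin v → ℝ => ∏ a, y a) n Q y)
      ∂(Measure.pi fun _ => μ)) := by
  set U := Ustat G (fun y : Fin v → ℝ => ∏ a, y a) n Q with hU
  set x : Fin n → ℝ := fun i => deriv (cgf' μ) (t i) with hx
  set P : Measure (Fin n → ℝ) := Measure.pi fun _ => μ with hP
  set D : (Fin n → ℝ) → ℝ := fun y => ∏ j, tl μ (t j) (y j) with hD
  set ℓ : (Fin n → ℝ) → ℝ := fun y => ∑ i, (t i * y i - cgf' μ (t i)) with hℓ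
  have hDl : ∀ y, D y = Real.exp (ℓ y) := by
    intro y; simp only [hD, hℓ, tl]; rw [Real.exp_sum]
  have hD1 : Integrable D P ∧ ∫ y, D y ∂P = 1 := by simpa using prod_tilt hE t ∅
  have hU1 : Integrable (fun y => U y * D y) P ∧ ∫ y, U y * D y ∂P = U x := by
    have e : (fun y => U y * D y) = fun y =>
      ∑ i ∈ Finset.univ.filter (fun i : Fin v → Fin n => Function.Injective i),
        (edgeProd G (fun a b => Q (i a) (i b)) / (n : ℝ) ^ v) *
          ((∏ j ∈ Finset.univ.image i, y j) * D y) := by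
      funext y
      rw [hU, Ustat_sum, Finset.sum_mul]
      refine Finset.sum_congr rfl fun i _ => by ring
    rw [e]
    refine ⟨integrable_finsetSum _ fun i _ => (prod_tilt hE t _).1.const_mul _, ?_⟩
    rw [integral_finsetSum _ fun i _ => (prod_tilt hE t _).1.const_mul _, hU, Ustat_sum]
    refine Finset.sum_congr rfl fun i _ => ?_
    rw [integral_const_mul, (prod_tilt hE t _).2]
  have hl1 : Integrable (fun y => ℓ y * D y) P ∧ ∫ y, ℓ y * D y ∂P = ℓ x := by
    have e : (fun y => ℓ y * D y) = fun y =>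
      ∑ i, (t i * ((∏ j ∈ {i}, y j) * D y) - cgf' μ (t i) * D y) := by
      funext y
      simp only [hℓ, Finset.sum_mul, Finset.prod_singleton]
      refine Finset.sum_congr rfl fun i _ => by ring
    have hi : ∀ i, Integrable (fun y => t i * ((∏ j ∈ {i}, y j) * D y) - cgf' μ (t i) * D y) P :=
      fun i => ((prod_tilt hE t {i}).1.const_mul _).sub (hD1.1.const_mul _)
    rw [e]
    refine ⟨integrable_finsetSum _ fun i _ => hi i, ?_⟩
    rw [integral_finsetSum _ fun i _ => hi i, hℓ]
    refine Finset.sum_congr rfl fun i _ => ?_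
    rw [integral_sub ((prod_tilt hE t {i}).1.const_mul _) (hD1.1.const_mul _),
      integral_const_mul, integral_const_mul, (prod_tilt hE t {i}).2, hD1.2]
    simp [hx]
  set c := n * θ * U x - ℓ x with hc
  have hpt : ∀ y, Real.exp c * ((1 - c) * D y + (n * θ * (U y * D y) - ℓ y * D y)) ≤
      Real.exp (n * θ * U y) := by
    intro y
    have e : Real.exp (n * θ * U y) = Real.exp c * (Real.exp (n * θ * U y - ℓ y - c) * D y) := by
      rw [hDl, ← Real.exp_add, ← Real.exp_add]; congr 1; ring
    rw [e]
    refine mul_le_mul_of_nonneg_left ?_ (Real.exp_pos _).le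
    have hDn : 0 ≤ D y := by rw [hDl]; exact (Real.exp_pos _).le
    have := mul_le_mul_of_nonneg_right (Real.add_one_le_exp (n * θ * U y - ℓ y - c)) hDn
    linarith
  have i1 := hD1.1.const_mul (1 - c)
  have i2 := hU1.1.const_mul (n * θ)
  have i3 : Integrable (fun y => n * θ * (U y * D y) - ℓ y * D y) P := i2.sub hl1.1
  have h := integral_mono ((i1.add i3).const_mul (Real.exp c)) hInt1 hpt
  have e2 : ∫ y, Real.exp c * ((1 - c) * D y + (n * θ * (U y * D y) - ℓ y * D y)) ∂P
      = Real.exp c := by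
    rw [integral_const_mul, integral_add i1 i3, integral_sub i2 hl1.1,
      integral_const_mul, integral_const_mul, hD1.2, hU1.2, hl1.2, ← hc]
    ring
  have h' : Real.exp c ≤ _ := e2 ▸ h
  exact (Real.le_log_iff_exp_le ((Real.exp_pos c).trans_le h')).2 h'

theorem chernoff (hE : ∀ t : ℝ, Integrable (fun x => Real.exp (t * x)) μ) {n : ℕ}
    (s : Fin n → ℝ) :
    ∫⁻ y : Fin n → ℝ, ENNReal.ofReal (Real.exp (∑ i, s i * y i)) ∂(Measure.pi fun _ => μ) =
      ENNReal.ofReal (Real.exp (∑ i, cgf' μ (s i))) := by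
  simp_rw [Real.exp_sum]
  have h1 : ∀ y : Fin n → ℝ, ENNReal.ofReal (∏ i, Real.exp (s i * y i)) =
    ∏ i, ENNReal.ofReal (Real.exp (s i * y i)) := fun y =>
      ENNReal.ofReal_prod_of_nonneg fun i _ => (Real.exp_pos _).le
  simp_rw [h1]
  rw [lintegral_pi_prod (fun _ => μ) (fun i y => ENNReal.ofReal (Real.exp (s i * y)))
    (fun i => by fun_prop), ENNReal.ofReal_prod_of_nonneg fun i _ => (Real.exp_pos _).le]
  refine Finset.prod_congr rfl fun i _ => ?_
  rw [exp_cgf hE, ofReal_integral_eq_lintegral_ofReal (hE _)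
    (ae_of_all _ fun x => (Real.exp_pos _).le)]

end

end MGL

namespace MGL

/-- empirical mean of `h` -/
noncomputable def emp {n : ℕ} (h : ℝ → ℝ) (x : Fin n → ℝ) : ℝ := (n : ℝ)⁻¹ * ∑ i, h (x i)

theorem emp_nonneg {n : ℕ} {h : ℝ → ℝ} (hh : ∀ y, 0 ≤ h y) (x : Fin n → ℝ) : 0 ≤ emp h x :=
  mul_nonneg (by positivity) (Finset.sum_nonneg fun i _ => hh _)

theorem lint_emp {n : ℕ} [NeZero n] {τ : ℝ → Fin n} (hτ : equi τ) {h : ℝ → ℝ} (hh : ∀ y, 0 ≤ h y)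
    (x : Fin n → ℝ) :
    ∫⁻ s, ENNReal.ofReal (h (x (τ s))) ∂unif01 = ENNReal.ofReal (emp h x) := by
  have hn : (0 : ℝ) < n := by exact_mod_cast Nat.pos_of_ne_zero (NeZero.ne n)
  rw [lint_cells unif01 hτ.1 (by simpa using hτ.2) (fun i => ENNReal.ofReal (h (x i)))]
  unfold emp
  rw [ENNReal.ofReal_mul (by positivity), ENNReal.ofReal_sum_of_nonneg (fun i _ => hh _),
    Finset.mul_sum, ENNReal.ofReal_inv_of_pos hn]
  simp

theorem lint_pow {n : ℕ} [NeZero n] {τ : ℝ → Fin n} (hτ : equi τ) {p : ℝ} (hp : 0 < p)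
    (x : Fin n → ℝ) :
    ∫⁻ s, ‖x (τ s)‖ₑ ^ p ∂unif01 = ENNReal.ofReal (emp (fun y => |y| ^ p) x) := by
  rw [← lint_emp hτ (fun y => by positivity) x]
  refine lintegral_congr fun s => ?_
  rw [Real.enorm_eq_ofReal_abs, ENNReal.ofReal_rpow_of_nonneg (abs_nonneg _) hp.le]

theorem lint_tail {n : ℕ} [NeZero n] {τ : ℝ → Fin n} (hτ : equi τ) {p : ℝ} (hp : 0 < p) (M : ℝ)
    (x : Fin n → ℝ) :
    ∫⁻ s, ENNReal.ofReal (max (|x (τ s)| - M) 0) ^ p ∂unif01 =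
      ENNReal.ofReal (emp (fun y => (max (|y| - M) 0) ^ p) x) := by
  rw [← lint_emp hτ (h := fun y => (max (|y| - M) 0) ^ p)
    (fun y => Real.rpow_nonneg (le_max_right _ _) _) x]
  refine lintegral_congr fun s => ?_
  rw [ENNReal.ofReal_rpow_of_nonneg (le_max_right _ _) hp.le]

theorem Ustat_le {v n : ℕ} [NeZero n] (G : SimpleGraph (Fin v)) [DecidableRel G.Adj]
    {p q : ℝ} (hpq : p.HolderConjugate q) (hvp : (v : ℝ) ≤ p) (C : ℝ≥0∞) (hC : 1 ≤ C) (hC' : C ≠ ⊤)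
    {τ : ℝ → Fin n} (hτ : equi τ) (Q : Fin n → Fin n → ℝ)
    (hQ : LrB (q * G.maxDegree) C (ker τ Q)) (x : Fin n → ℝ) :
    |Ustat G (fun y : Fin v → ℝ => ∏ a, y a) n Q x| ≤
      ((C ^ (edgeF G).card) ^ (1 / q)).toReal * (1 + emp (fun y => |y| ^ p) x) := by
  classical
  set A := emp (fun y => |y| ^ p) x with hA
  have hA0 : 0 ≤ A := emp_nonneg (fun y => by positivity) x
  have hp := hpq.pos
  rw [Ustat_eq G hτ]
  have hxm : Measurable fun s => x (τ s) := (measurable_of_finite x).comp hτ.1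
  have hind : Measurable fun y : Fin v → ℝ =>
      (if Function.Injective (fun a => τ (y a)) then (1 : ℝ) else 0) :=
    Measurable.ite (by simpa [Set.compl_ofPred] using (noninj_meas (v := v) hτ.1).compl)
      measurable_const measurable_const
  refine ((KV_int G hpq C hC hC' (fun _ => ker τ Q) (fun _ => hQ) _ (hind.mul (meas_prodg hxm))
    (ENNReal.ofReal A ^ v) (ENNReal.pow_ne_top ENNReal.ofReal_ne_top) ?_).2).trans ?_
  · refine le_trans (lintegral_mono fun y => ?_)
      (prod_moment hp (fun s => ‖x (τ s)‖ₑ) hxm.enorm _ (lint_pow hτ hp x).le)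
    refine ENNReal.rpow_le_rpow ?_ hp.le
    rw [← enorm_prodR]
    simp only [Pi.mul_apply]
    split_ifs
    · simp
    · simp
  · rw [ENNReal.toReal_mul]
    refine mul_le_mul_of_nonneg_left ?_ ENNReal.toReal_nonneg
    rw [← ENNReal.ofReal_pow hA0, ENNReal.ofReal_rpow_of_nonneg (by positivity) (by positivity),
      ENNReal.toReal_ofReal (by positivity), ← Real.rpow_natCast, ← Real.rpow_mul hA0]
    have h1 : (v : ℝ) * (1 / p) ≤ 1 := by
      rw [mul_one_div, div_le_one hp]; exact hvp
    have h0 : 0 ≤ (v : ℝ) * (1 / p) := by positivity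
    rcases le_total A 1 with h | h
    · exact (Real.rpow_le_one hA0 h h0).trans (by linarith)
    · calc A ^ ((v : ℝ) * (1 / p)) ≤ A ^ (1 : ℝ) := Real.rpow_le_rpow_of_exponent_le h h1
        _ ≤ _ := by simp

theorem exp_emp {μ : Measure ℝ} [IsProbabilityMeasure μ] {n : ℕ} [NeZero n] (c : ℝ) {h : ℝ → ℝ}
    (hh : Measurable h) :
    ∫⁻ x : Fin n → ℝ, ENNReal.ofReal (Real.exp (n * (c + emp h x))) ∂(Measure.pi fun _ => μ) =
      ENNReal.ofReal (Real.exp (n * c)) * (∫⁻ y, ENNReal.ofReal (Real.exp (h y)) ∂μ) ^ n := by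
  have hn : (n : ℝ) ≠ 0 := by exact_mod_cast NeZero.ne n
  have e : ∀ x : Fin n → ℝ, ENNReal.ofReal (Real.exp (n * (c + emp h x))) =
      ENNReal.ofReal (Real.exp (n * c)) * ∏ i, ENNReal.ofReal (Real.exp (h (x i))) := by
    intro x
    rw [← ENNReal.ofReal_prod_of_nonneg fun i _ => (Real.exp_pos _).le, ← Real.exp_sum,
      ← ENNReal.ofReal_mul (Real.exp_pos _).le, ← Real.exp_add]
    congr 2
    unfold emp
    field_simp
  simp_rw [e]
  have hm : Measurable fun y => ENNReal.ofReal (Real.exp (h y)) := hh.exp.ennreal_ofReal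
  have hmp : Measurable fun x : Fin n → ℝ => ∏ i, ENNReal.ofReal (Real.exp (h (x i))) :=
    Finset.measurable_fun_prod _ fun i _ => hm.comp (measurable_pi_apply i)
  rw [lintegral_const_mul _ hmp, lintegral_pi_prod (fun _ => μ) (fun _ y => ENNReal.ofReal (Real.exp (h y)))
    (fun i => hm)]
  simp

theorem ZnGen_le {μ : Measure ℝ} [IsProbabilityMeasure μ] (f : ∀ n : ℕ, (Fin n → ℝ) → ℝ) (n : ℕ)
    [NeZero n] (hf : Measurable (f n)) (θ c : ℝ)
    (h : ∫⁻ x, ENNReal.ofReal (Real.exp (n * θ * f n x)) ∂(Measure.pi fun _ : Fin n => μ) ≤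
      ENNReal.ofReal (Real.exp (n * c))) :
    Integrable (fun x => Real.exp (n * θ * f n x)) (Measure.pi fun _ : Fin n => μ) ∧
    ZnGen μ f n θ ≤ c := by
  have hn : (0 : ℝ) < n := by exact_mod_cast Nat.pos_of_ne_zero (NeZero.ne n)
  have hm : Measurable fun x => Real.exp (n * θ * f n x) := (hf.const_mul _).exp
  have hi : Integrable (fun x => Real.exp (n * θ * f n x)) (Measure.pi fun _ : Fin n => μ) := by
    refine ⟨hm.aestronglyMeasurable, ?_⟩
    rw [hasFiniteIntegral_iff_ofReal (ae_of_all _ fun x => (Real.exp_pos _).le)]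
    exact h.trans_lt ENNReal.ofReal_lt_top
  refine ⟨hi, ?_⟩
  unfold ZnGen
  rw [← ofReal_integral_eq_lintegral_ofReal hi (ae_of_all _ fun x => (Real.exp_pos _).le),
    ENNReal.ofReal_le_ofReal_iff (Real.exp_pos _).le] at h
  have h2 := Real.log_le_log (integral_exp_pos hi) h
  rw [Real.log_exp] at h2
  rw [inv_mul_le_iff₀ hn]
  exact h2

end MGL

namespace MGL

/-- The standing assumptions after reduction. -/
structure Setup (μ : Measure ℝ) {v : ℕ} (G : SimpleGraph (Fin v)) [DecidableRel G.Adj]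
    (Q : ∀ n : ℕ, Fin n → Fin n → ℝ) (W : ℝ → ℝ → ℝ) (p q : ℝ) (C : ℝ≥0∞) : Prop where
  hnd : ∀ x : ℝ, μ ≠ Measure.dirac x
  hpq : p.HolderConjugate q
  hvp : (v : ℝ) ≤ p
  hC : 1 ≤ C
  hC' : C ≠ ⊤
  hT : ∀ lam : ℝ, 0 < lam → ∫⁻ x, ENNReal.ofReal (Real.exp (lam * |x| ^ p)) ∂μ < ⊤
  hW : LrB (q * G.maxDegree) C W
  hWi : Integrable (Function.uncurry W) (unif01.prod unif01)
  happ : ∀ η : ℝ, 0 < η → ∀ᶠ n : ℕ in atTop, ∀ [NeZero n], ∃ τ : ℝ → Fin n, equi τ ∧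
    LrB (q * G.maxDegree) C (ker τ (Q n)) ∧ cutB η (fun s t => ker τ (Q n) s t - W s t)

section
variable {μ : Measure ℝ} [IsProbabilityMeasure μ] {v : ℕ} {G : SimpleGraph (Fin v)}
  [DecidableRel G.Adj] {Q : ∀ n : ℕ, Fin n → Fin n → ℝ} {W : ℝ → ℝ → ℝ} {p q : ℝ} {C : ℝ≥0∞}

theorem Setup.hE (S : Setup μ G Q W p q C) (t : ℝ) : Integrable (fun x => Real.exp (t * x)) μ := by
  have hm : Measurable fun x : ℝ => Real.exp (t * x) := by fun_prop
  refine ⟨hm.aestronglyMeasurable, ?_⟩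
  rw [hasFiniteIntegral_iff_ofReal (ae_of_all _ fun x => (Real.exp_pos _).le)]
  have hp1 := S.hpq.lt.le
  calc ∫⁻ x, ENNReal.ofReal (Real.exp (t * x)) ∂μ
      ≤ ∫⁻ x, ENNReal.ofReal (Real.exp (|t| + 1)) *
          ENNReal.ofReal (Real.exp ((|t| + 1) * |x| ^ p)) ∂μ := by
        refine lintegral_mono fun x => ?_
        rw [← ENNReal.ofReal_mul (Real.exp_pos _).le, ← Real.exp_add]
        refine ENNReal.ofReal_le_ofReal (Real.exp_le_exp.2 ?_)
        have h1 : |x| ≤ 1 + |x| ^ p := by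
          have h0 : 0 ≤ |x| ^ p := by positivity
          rcases le_total |x| 1 with h | h
          · linarith
          · have := Real.rpow_le_rpow_of_exponent_le h hp1
            rw [Real.rpow_one] at this
            linarith
        calc t * x ≤ |t * x| := le_abs_self _
          _ = |t| * |x| := abs_mul _ _
          _ ≤ (|t| + 1) * (1 + |x| ^ p) := by gcongr; linarith
          _ = _ := by ring
    _ = ENNReal.ofReal (Real.exp (|t| + 1)) *
          ∫⁻ x, ENNReal.ofReal (Real.exp ((|t| + 1) * |x| ^ p)) ∂μ :=
        lintegral_const_mul' _ _ ENNReal.ofReal_ne_top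
    _ < ⊤ := ENNReal.mul_lt_top ENNReal.ofReal_lt_top (S.hT _ (by positivity))

/-- log moment -/
noncomputable def lmom (μ : Measure ℝ) (h : ℝ → ℝ) : ℝ :=
  Real.log (∫⁻ x, ENNReal.ofReal (Real.exp (h x)) ∂μ).toReal

theorem lmom_spec {h : ℝ → ℝ} (hm : Measurable h)
    (hT : ∫⁻ x, ENNReal.ofReal (Real.exp (h x)) ∂μ < ⊤) :
    ∫⁻ x, ENNReal.ofReal (Real.exp (h x)) ∂μ = ENNReal.ofReal (Real.exp (lmom μ h)) := by
  have h0 : 0 < ∫⁻ x, ENNReal.ofReal (Real.exp (h x)) ∂μ := by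
    rw [lintegral_pos_iff_support hm.exp.ennreal_ofReal]
    have : Function.support (fun x => ENNReal.ofReal (Real.exp (h x))) = Set.univ := by
      ext x; simp [Real.exp_pos]
    rw [this]; simp
  unfold lmom
  rw [Real.exp_log (ENNReal.toReal_pos h0.ne' hT.ne), ENNReal.ofReal_toReal hT.ne]

theorem exp_emp_le {n : ℕ} [NeZero n] (c : ℝ) {h : ℝ → ℝ} (hm : Measurable h)
    (hT : ∫⁻ x, ENNReal.ofReal (Real.exp (h x)) ∂μ < ⊤) :
    ∫⁻ x : Fin n → ℝ, ENNReal.ofReal (Real.exp (n * (c + emp h x))) ∂(Measure.pi fun _ => μ) =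
      ENNReal.ofReal (Real.exp (n * (c + lmom μ h))) := by
  rw [exp_emp c hm, lmom_spec hm hT, ← ENNReal.ofReal_pow (Real.exp_pos _).le,
    ← ENNReal.ofReal_mul (Real.exp_pos _).le, ← Real.exp_nat_mul, ← Real.exp_add]
  congr 2; ring

/-- the Hölder constant -/
noncomputable def KC {v : ℕ} (G : SimpleGraph (Fin v)) [DecidableRel G.Adj] (q : ℝ) (C : ℝ≥0∞)
    (θ : ℝ) : ℝ := |θ| * ((C ^ (edgeF G).card) ^ (1 / q)).toReal + 1

theorem KC_pos (θ : ℝ) : 0 < KC G q C θ := by unfold KC; positivity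

theorem Setup.U_le (S : Setup μ G Q W p q C) {n : ℕ} [NeZero n] {τ : ℝ → Fin n} (hτ : equi τ)
    (hQ : LrB (q * G.maxDegree) C (ker τ (Q n))) (θ : ℝ) (x : Fin n → ℝ) :
    θ * Ustat G (fun y : Fin v → ℝ => ∏ a, y a) n (Q n) x ≤
      KC G q C θ * (1 + emp (fun y => |y| ^ p) x) := by
  have h := Ustat_le G S.hpq S.hvp C S.hC S.hC' hτ (Q n) hQ x
  have h0 : 0 ≤ emp (fun y => |y| ^ p) x := emp_nonneg (fun y => by positivity) x
  calc _ ≤ |θ * Ustat G (fun y : Fin v → ℝ => ∏ a, y a) n (Q n) x| := le_abs_self _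
    _ ≤ |θ| * (((C ^ (edgeF G).card) ^ (1 / q)).toReal * (1 + emp (fun y => |y| ^ p) x)) := by
      rw [abs_mul]; gcongr
    _ ≤ _ := by unfold KC; nlinarith

theorem emp_smul {n : ℕ} (c : ℝ) (h : ℝ → ℝ) (x : Fin n → ℝ) :
    emp (fun y => c * h y) x = c * emp h x := by
  unfold emp; rw [← Finset.mul_sum]; ring

theorem emp_add {n : ℕ} (g h : ℝ → ℝ) (x : Fin n → ℝ) :
    emp (fun y => g y + h y) x = emp g x + emp h x := by
  unfold emp; rw [Finset.sum_add_distrib]; ring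

theorem powm (c p : ℝ) : Measurable fun y : ℝ => c * |y| ^ p := by fun_prop

theorem Setup.finite (S : Setup μ G Q W p q C) {n : ℕ} [NeZero n] {τ : ℝ → Fin n} (hτ : equi τ)
    (hQ : LrB (q * G.maxDegree) C (ker τ (Q n))) (θ : ℝ) :
    ∫⁻ x, ENNReal.ofReal (Real.exp (n * θ * Ustat G (fun y : Fin v → ℝ => ∏ a, y a) n (Q n) x))
      ∂(Measure.pi fun _ : Fin n => μ) ≤ ENNReal.ofReal (Real.exp (n * (KC G q C θ +
        lmom μ (fun y => KC G q C θ * |y| ^ p)))) := by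
  rw [← exp_emp_le (KC G q C θ) (powm _ _) (S.hT _ (KC_pos θ))]
  refine lintegral_mono fun x => ENNReal.ofReal_le_ofReal (Real.exp_le_exp.2 ?_)
  rw [mul_assoc]
  refine mul_le_mul_of_nonneg_left ((S.U_le hτ hQ θ x).trans (le_of_eq ?_)) (by positivity)
  rw [emp_smul]; ring

theorem tail_small {g : ℝ → ℝ} (hg : Measurable g) {p : ℝ} (hp : 0 < p)
    (hgL : ∫⁻ x, ‖g x‖ₑ ^ p ∂unif01 ≠ ⊤) {b : ℝ} (hb : 0 < b) :
    ∃ M : ℝ, 1 ≤ M ∧ ∫⁻ x, ENNReal.ofReal (max (|g x| - M) 0) ^ p ∂unif01 ≤ ENNReal.ofReal b := by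
  have hl : Tendsto (fun k : ℕ => ∫⁻ x, ENNReal.ofReal (max (|g x| - k) 0) ^ p ∂unif01) atTop
      (nhds (∫⁻ _, 0 ∂unif01)) := by
    refine tendsto_lintegral_of_dominated_convergence (fun x => ‖g x‖ₑ ^ p)
      (fun k => (((hg.abs.sub_const _).max measurable_const).ennreal_ofReal).pow_const p)
      (fun k => ae_of_all _ fun x => ?_) hgL (ae_of_all _ fun x => ?_)
    · refine ENNReal.rpow_le_rpow ?_ hp.le
      rw [Real.enorm_eq_ofReal_abs]
      refine ENNReal.ofReal_le_ofReal (max_le ?_ (abs_nonneg _))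
      linarith [(Nat.cast_nonneg k : (0 : ℝ) ≤ k)]
    · refine tendsto_const_nhds.congr' ?_
      obtain ⟨k0, hk0⟩ := exists_nat_ge |g x|
      filter_upwards [eventually_ge_atTop k0] with k hk
      have : (k0 : ℝ) ≤ k := by exact_mod_cast hk
      rw [max_eq_right (by linarith)]
      simp [hp]
  rw [lintegral_zero] at hl
  have := (hl.eventually_le_const (u := ENNReal.ofReal b) (by simpa using hb)).and
    (eventually_ge_atTop 1)
  obtain ⟨k, hk, hk1⟩ := this.exists
  exact ⟨k, by exact_mod_cast hk1, hk⟩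

theorem int_of_Lp {g : ℝ → ℝ} (hg : Measurable g) {p : ℝ} (hp : 1 ≤ p)
    (hgL : ∫⁻ x, ‖g x‖ₑ ^ p ∂unif01 ≠ ⊤) : Integrable g unif01 := by
  refine ⟨hg.aestronglyMeasurable, ?_⟩
  have := lpow_jensen unif01 hp (fun x => ‖g x‖ₑ) hg.enorm
  by_contra hcon
  have h1 : ∫⁻ x, ‖g x‖ₑ ∂unif01 = ⊤ := by
    simpa [HasFiniteIntegral] using hcon
  rw [h1, ENNReal.top_rpow_of_pos (by linarith)] at this
  exact hgL (top_le_iff.1 this)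

end

end MGL

namespace MGL

theorem ite_int {n : ℕ} {τ : ℝ → Fin n} (hτ : Measurable τ) {f : ℝ → ℝ} (hf : Integrable f unif01)
    (i : Fin n) : Integrable (fun s => if τ s = i then f s else 0) unif01 := by
  have : (fun s => if τ s = i then f s else 0) = (τ ⁻¹' {i}).indicator f := by
    funext s; by_cases h : τ s = i <;> simp [h]
  rw [this]
  exact hf.indicator (hτ (measurableSet_singleton i))

theorem cavg_affine {n : ℕ} [NeZero n] {τ : ℝ → Fin n} (hτ : equi τ) {f : ℝ → ℝ}
    (hf : Integrable f unif01) (a b : ℝ) (i : Fin n) :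
    cavg τ (fun s => a * f s + b) i = a * cavg τ f i + b := by
  have hb : cavg τ (fun _ => b) i = b := congrFun (cavg_comp hτ (fun _ => b)) i
  unfold cavg at hb ⊢
  have e : (fun s => if τ s = i then a * f s + b else 0) =
      fun s => a * (if τ s = i then f s else 0) + (if τ s = i then b else 0) := by
    funext s; split_ifs <;> simp
  rw [e, integral_add ((ite_int hτ.1 hf i).const_mul a) (ite_int hτ.1 (integrable_const b) i),
    integral_const_mul, mul_add, hb]
  ring

theorem inCls_cavg {n : ℕ} [NeZero n] {τ : ℝ → Fin n} (hτ : equi τ) {p : ℝ} (hp : 1 ≤ p)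
    {L b : ℝ≥0∞} {M : ℝ} {g : ℝ → ℝ} (hg : inCls p L b M g) (hL : L ≠ ⊤) :
    inCls p L b M (fun s => cavg τ g (τ s)) := by
  have hi : Integrable g unif01 := int_of_Lp hg.1 hp (hg.2.1.trans_lt hL.lt_top).ne
  refine ⟨(measurable_of_countable (cavg τ g)).comp hτ.1, ?_, ?_⟩
  · exact (jensen_cavg hτ (φ := fun y => ‖y‖ₑ ^ p) (JP_pow hp) g hg.1 hi).trans hg.2.1
  · exact (jensen_cavg hτ (φ := fun y => ENNReal.ofReal (max (|y| - M) 0) ^ p)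
      (JP_tail hp M) g hg.1 hi).trans hg.2.2

section
variable {μ : Measure ℝ} [IsProbabilityMeasure μ] {v : ℕ} {G : SimpleGraph (Fin v)}
  [DecidableRel G.Adj] {Q : ∀ n : ℕ, Fin n → Fin n → ℝ} {W : ℝ → ℝ → ℝ} {p q : ℝ} {C : ℝ≥0∞}

/-- the shrunken profile -/
theorem shrink_close (S : Setup μ G Q W p q C) (m : ℝ) {f : ℝ → ℝ} (hf : Measurable f)
    (hfL : ∫⁻ s, ‖f s‖ₑ ^ p ∂unif01 ≠ ⊤) {ε : ℝ} (hε : 0 < ε) :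
    ∃ δ : ℝ, 0 < δ ∧ δ ≤ 1 ∧ |G1 G W (fun s => (1 - δ) * f s + δ * m) - G1 G W f| ≤ ε ∧
      ∫⁻ s, ‖(1 - δ) * f s + δ * m‖ₑ ^ p ∂unif01 ≠ ⊤ := by
  have hp1 := S.hpq.lt.le
  have hp0 := S.hpq.pos
  set d : ℝ → ℝ≥0∞ := fun s => ‖f s‖ₑ + ‖m‖ₑ with hd
  have hdm : Measurable d := hf.enorm.add_const _
  set L := ∫⁻ s, d s ^ p ∂unif01 with hL
  have hL' : L ≠ ⊤ := by
    have h1 : ∀ s, d s ^ p ≤ (2 : ℝ≥0∞) ^ (p - 1) * (‖f s‖ₑ ^ p + ‖m‖ₑ ^ p) := fun s =>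
      ENNReal.rpow_add_le_mul_rpow_add_rpow _ _ hp1
    refine ((lintegral_mono h1).trans_lt ?_).ne
    rw [lintegral_const_mul _ ((hf.enorm.pow_const p).add_const _),
      lintegral_add_right _ measurable_const, lintegral_const]
    refine ENNReal.mul_lt_top (ENNReal.rpow_lt_top_of_nonneg (by linarith) (by simp)) ?_
    refine ENNReal.add_lt_top.2 ⟨hfL.lt_top, ?_⟩
    simpa using ENNReal.rpow_lt_top_of_nonneg hp0.le (by simp)
  have hlim : Tendsto (fun δ : ℝ => ENNReal.ofReal δ ^ p * L) (nhdsWithin 0 (Set.Ioi 0))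
      (nhds 0) := by
    have h1 : Tendsto (fun δ : ℝ => ENNReal.ofReal δ ^ p) (nhds 0) (nhds 0) := by
      have : Continuous fun δ : ℝ => ENNReal.ofReal δ ^ p :=
        ENNReal.continuous_rpow_const.comp ENNReal.continuous_ofReal
      simpa [hp0] using this.tendsto 0
    have := ENNReal.Tendsto.mul_const 
      (h1.mono_left (nhdsWithin_le_nhds (s := Set.Ioi 0))) (Or.inr hL')
    simpa using this
  have hk := lipK_tendsto v (edgeF G).card hp1 S.hpq.symm.pos S.hC' hL' _ hlim
  have hev := (hk.eventually_le_const hε).and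
    (Ioc_mem_nhdsGT (zero_lt_one : (0 : ℝ) < 1))
  obtain ⟨δ, h1, h2, h3⟩ := hev.exists
  have hgd : ∀ s, ‖(1 - δ) * f s + δ * m‖ₑ ≤ d s := fun s => by
    refine (enorm_add_le _ _).trans (add_le_add ?_ ?_)
    · rw [enorm_mul]
      refine mul_le_of_le_one_left' ?_
      rw [Real.enorm_eq_ofReal_abs, abs_of_nonneg (by linarith)]
      exact ENNReal.ofReal_le_one.2 (by linarith)
    · rw [enorm_mul]
      refine mul_le_of_le_one_left' ?_
      rw [Real.enorm_eq_ofReal_abs, abs_of_nonneg h2.le]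
      exact ENNReal.ofReal_le_one.2 (by linarith)
  have hgm : Measurable fun s => (1 - δ) * f s + δ * m := (hf.const_mul _).add_const _
  refine ⟨δ, h2, h3, ?_, ?_⟩
  · refine (G1_lip G S.hpq C S.hC S.hC' W S.hW _ f hgm hf d hdm hgd
      (fun s => le_self_add) L (ENNReal.ofReal δ ^ p * L) le_rfl ?_ hL' ?_).trans h1
    · rw [hL, ← lintegral_const_mul' _ _ (by
        exact (ENNReal.rpow_lt_top_of_nonneg hp0.le ENNReal.ofReal_ne_top).ne)]
      refine lintegral_mono fun s => ?_
      rw [← ENNReal.mul_rpow_of_nonneg _ _ hp0.le]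
      refine ENNReal.rpow_le_rpow ?_ hp0.le
      have : (1 - δ) * f s + δ * m - f s = δ * (m - f s) := by ring
      rw [this, enorm_mul, Real.enorm_eq_ofReal_abs, abs_of_nonneg h2.le]
      gcongr
      refine (enorm_sub_le).trans ?_
      rw [add_comm]
    · exact ENNReal.mul_ne_top (ENNReal.rpow_lt_top_of_nonneg hp0.le ENNReal.ofReal_ne_top).ne hL'
  · exact ((lintegral_mono fun s => ENNReal.rpow_le_rpow (hgd s) hp0.le).trans_lt hL'.lt_top).ne

/-- U-statistics at cell averages approximate the functional. -/
theorem ustat_cavg (S : Setup μ G Q W p q C) {g : ℝ → ℝ} (hg : Measurable g)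
    (hgL : ∫⁻ s, ‖g s‖ₑ ^ p ∂unif01 ≠ ⊤) {ε : ℝ} (hε : 0 < ε) :
    ∀ᶠ n : ℕ in atTop, ∀ [NeZero n], ∃ τ : ℝ → Fin n, equi τ ∧
      LrB (q * G.maxDegree) C (ker τ (Q n)) ∧
      |Ustat G (fun y : Fin v → ℝ => ∏ a, y a) n (Q n) (cavg τ g) - G1 G W g| ≤ ε := by
  have hp1 := S.hpq.lt.le
  obtain ⟨b, hb, H⟩ := Ustat_approx G S.hpq C S.hC S.hC' _ hgL (ε / 2) (half_pos hε)
  obtain ⟨M, hM, hMb⟩ := tail_small hg S.hpq.pos hgL hb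
  obtain ⟨η, hη, ⟨n0, h1⟩, h2⟩ := H M hM
  have hcls : inCls p (∫⁻ s, ‖g s‖ₑ ^ p ∂unif01) (ENNReal.ofReal b) M g := ⟨hg, le_rfl, hMb⟩
  filter_upwards [S.happ η hη, eventually_ge_atTop n0] with n hn hn0 _
  obtain ⟨τ, hτ, hQ, hcut⟩ := hn
  refine ⟨τ, hτ, hQ, ?_⟩
  have e1 := h1 n hn0 τ hτ (Q n) hQ (cavg τ g) (inCls_cavg hτ hp1 hcls hgL)
  have e2 := h2 _ _ hQ S.hW hcut g hcls
  rw [G1_block G hτ.1 (Q n) g (int_of_Lp hg hp1 hgL)] at e2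
  have := abs_add_le (Ustat G (fun y : Fin v → ℝ => ∏ a, y a) n (Q n) (cavg τ g) -
    Vstat G (fun y : Fin v → ℝ => ∏ a, y a) n (Q n) (cavg τ g))
    (Vstat G (fun y : Fin v → ℝ => ∏ a, y a) n (Q n) (cavg τ g) - G1 G W g)
  rw [sub_add_sub_cancel] at this
  linarith

/-- the sequence of free energies -/
noncomputable abbrev Zn (μ : Measure ℝ) [IsProbabilityMeasure μ] {v : ℕ}
    (G : SimpleGraph (Fin v)) [DecidableRel G.Adj]
    (Q : ∀ n : ℕ, Fin n → Fin n → ℝ) (θ : ℝ) (n : ℕ) : ℝ :=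
  ZnGen μ (fun n => Ustat G (fun y : Fin v → ℝ => ∏ a, y a) n (Q n)) n θ

theorem lower_aux (S : Setup μ G Q W p q C) (θ : ℝ) {f : ℝ → ℝ} (hf : Measurable f)
    (hfL : ∫⁻ s, ‖f s‖ₑ ^ p ∂unif01 ≠ ⊤) (hI : ∫⁻ s, gammaBeta μ (f s) ∂unif01 ≠ ⊤)
    {n : ℕ} [NeZero n] {τ : ℝ → Fin n} (hτ : equi τ)
    (hQ : LrB (q * G.maxDegree) C (ker τ (Q n))) {δ : ℝ} (hδ : 0 < δ) (hδ1 : δ ≤ 1) :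
    θ * Ustat G (fun y : Fin v → ℝ => ∏ a, y a) n (Q n)
      (cavg τ (fun s => (1 - δ) * f s + δ * ∫ x, x ∂μ)) -
      (∫⁻ s, gammaBeta μ (f s) ∂unif01).toReal ≤ Zn μ G Q θ n := by
  have hn : (0 : ℝ) < n := by exact_mod_cast Nat.pos_of_ne_zero (NeZero.ne n)
  have hp1 := S.hpq.lt.le
  have hfi := int_of_Lp hf hp1 hfL
  have hJ := jensen_cavg hτ (JP_gamma μ) f hf hfi
  rw [lint_cells unif01 hτ.1 (by simpa using hτ.2) (fun i => gammaBeta μ (cavg τ f i))] at hJ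
  have hsum := (hJ.trans_lt hI.lt_top).ne
  have hcard : ((Fintype.card (Fin n) : ℝ≥0∞)⁻¹) ≠ 0 := by simp
  have hfin : ∀ i, gammaBeta μ (cavg τ f i) ≠ ⊤ := fun i h => by
    have := (ENNReal.sum_ne_top.1 hsum) i (Finset.mem_univ i)
    rw [h, ENNReal.mul_top hcard] at this
    exact this rfl
  choose t ht1 ht2 using fun i => tilt_exists S.hE S.hnd (hfin i) hδ hδ1
  have hInt1 := (ZnGen_le (μ := μ) (fun n => Ustat G (fun y : Fin v → ℝ => ∏ a, y a) n (Q n)) n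
    (Ustat_meas G (Q n)) θ _ (S.finite hτ hQ θ)).1
  have hg := gibbs_lower S.hE G (Q n) θ t hInt1
  have hx : (fun i => deriv (cgf' μ) (t i)) =
      cavg τ (fun s => (1 - δ) * f s + δ * ∫ x, x ∂μ) := by
    funext i
    rw [ht1, cavg_affine hτ hfi]
  rw [hx] at hg
  have hs : ∑ i, (t i * deriv (cgf' μ) (t i) - cgf' μ (t i)) ≤
      n * (∫⁻ s, gammaBeta μ (f s) ∂unif01).toReal := by
    have h1 := ENNReal.toReal_mono hI hJ
    rw [ENNReal.toReal_sum (fun i _ => (ENNReal.sum_ne_top.1 hsum) i (Finset.mem_univ i))] at h1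
    simp only [ENNReal.toReal_mul, Fintype.card_fin, ENNReal.toReal_inv,
      ENNReal.toReal_natCast] at h1
    rw [← Finset.mul_sum, inv_mul_le_iff₀ hn] at h1
    refine le_trans (Finset.sum_le_sum fun i _ => ?_) h1
    rw [ht1]; exact ht2 i
  unfold Zn ZnGen
  rw [← div_eq_inv_mul, le_div_iff₀ hn]
  nlinarith [hg, hs]

theorem lower (S : Setup μ G Q W p q C) (θ : ℝ) {f : ℝ → ℝ} (hf : Measurable f)
    (hfL : ∫⁻ s, ‖f s‖ₑ ^ p ∂unif01 ≠ ⊤) (hI : ∫⁻ s, gammaBeta μ (f s) ∂unif01 ≠ ⊤)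
    {ε : ℝ} (hε : 0 < ε) :
    ∀ᶠ n : ℕ in atTop,
      θ * G1 G W f - (∫⁻ s, gammaBeta μ (f s) ∂unif01).toReal - ε ≤ Zn μ G Q θ n := by
  have hε' : 0 < ε / (2 * (|θ| + 1)) := by positivity
  obtain ⟨δ, hδ, hδ1, hd, hL⟩ := shrink_close S (∫ x, x ∂μ) hf hfL hε'
  filter_upwards [ustat_cavg S ((hf.const_mul (1 - δ)).add_const (δ * ∫ x, x ∂μ)) hL hε',
    eventually_gt_atTop 0] with n hn hn0
  haveI : NeZero n := ⟨hn0.ne'⟩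
  obtain ⟨τ, hτ, hQ, hU⟩ := hn
  have h := lower_aux S θ hf hfL hI hτ hQ hδ hδ1
  set A := Ustat G (fun y : Fin v → ℝ => ∏ a, y a) n (Q n)
      (cavg τ (fun s => (1 - δ) * f s + δ * ∫ x, x ∂μ))
  set B := G1 G W (fun s => (1 - δ) * f s + δ * ∫ x, x ∂μ)
  have h1 : |A - G1 G W f| ≤ ε / (|θ| + 1) := by
    have := abs_add_le (A - B) (B - G1 G W f)
    rw [sub_add_sub_cancel] at this
    have e : ε / (|θ| + 1) = ε / (2 * (|θ| + 1)) + ε / (2 * (|θ| + 1)) := by field_simp; norm_num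
    rw [e]
    exact this.trans (add_le_add hU hd)
  have h2 : θ * (G1 G W f - A) ≤ ε := by
    calc θ * (G1 G W f - A) ≤ |θ * (G1 G W f - A)| := le_abs_self _
      _ = |θ| * |A - G1 G W f| := by rw [abs_mul, abs_sub_comm]
      _ ≤ (|θ| + 1) * (ε / (|θ| + 1)) := by gcongr; linarith
      _ = ε := by field_simp
  linarith

/-- uniform upper bound -/
theorem Zn_bdd (S : Setup μ G Q W p q C) (θ : ℝ) : ∀ᶠ n : ℕ in atTop,
    Zn μ G Q θ n ≤ KC G q C θ + lmom μ (fun y => KC G q C θ * |y| ^ p) := by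
  filter_upwards [S.happ 1 one_pos, eventually_gt_atTop 0] with n hn hn0
  haveI : NeZero n := ⟨hn0.ne'⟩
  obtain ⟨τ, hτ, hQ, -⟩ := hn
  exact (ZnGen_le (μ := μ) (fun n => Ustat G (fun y : Fin v → ℝ => ∏ a, y a) n (Q n)) n
    (Ustat_meas G (Q n)) θ _ (S.finite hτ hQ θ)).2

theorem val_bdd (S : Setup μ G Q W p q C) (θ : ℝ) {f : ℝ → ℝ} (hf : Measurable f)
    (hfL : ∫⁻ s, ‖f s‖ₑ ^ p ∂unif01 ≠ ⊤) (hI : ∫⁻ s, gammaBeta μ (f s) ∂unif01 ≠ ⊤) :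
    θ * G1 G W f - (∫⁻ s, gammaBeta μ (f s) ∂unif01).toReal ≤
      KC G q C θ + lmom μ (fun y => KC G q C θ * |y| ^ p) := by
  refine le_of_forall_pos_le_add fun ε hε => ?_
  obtain ⟨n, h1, h2⟩ := ((lower S θ hf hfL hI hε).and (Zn_bdd S θ)).exists
  linarith

end

end MGL

namespace MGL

section
variable {μ : Measure ℝ} [IsProbabilityMeasure μ]

theorem dual_one {ε : ℝ} (hε : 0 < ε) (R y : ℝ) :
    ∃ t : ℝ, 0 ≤ t * y - cgf' μ t ∧
      (gammaBeta μ y ≠ ⊤ → (gammaBeta μ y).toReal - ε ≤ t * y - cgf' μ t) ∧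
      (gammaBeta μ y = ⊤ → R ≤ t * y - cgf' μ t) := by
  have key : ∀ r : ℝ, ENNReal.ofReal r < gammaBeta μ y →
      ∃ t : ℝ, 0 ≤ t * y - cgf' μ t ∧ r ≤ t * y - cgf' μ t := by
    intro r hr
    by_cases h0 : r ≤ 0
    · exact ⟨0, by simp [cgf_zero], by simpa [cgf_zero] using h0⟩
    · unfold gammaBeta at hr
      obtain ⟨t, ht⟩ := lt_iSup_iff.1 hr
      have := (ENNReal.ofReal_lt_ofReal_iff_of_nonneg (not_le.1 h0).le).1 ht
      exact ⟨t, by linarith, this.le⟩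
  by_cases h : gammaBeta μ y = ⊤
  · obtain ⟨t, h1, h2⟩ := key R (by rw [h]; exact ENNReal.ofReal_lt_top)
    exact ⟨t, h1, fun h' => absurd h h', fun _ => h2⟩
  · by_cases h0 : (gammaBeta μ y).toReal - ε ≤ 0
    · exact ⟨0, by simp [cgf_zero], fun _ => by simpa [cgf_zero] using h0, fun h' => absurd h' h⟩
    · obtain ⟨t, h1, h2⟩ := key ((gammaBeta μ y).toReal - ε) (by
        rw [ENNReal.ofReal_lt_iff_lt_toReal (not_le.1 h0).le h]; linarith)
      exact ⟨t, h1, fun _ => h2, fun h' => absurd h' h⟩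

variable {v : ℕ} {G : SimpleGraph (Fin v)}
  [DecidableRel G.Adj] {Q : ∀ n : ℕ, Fin n → Fin n → ℝ} {W : ℝ → ℝ → ℝ} {p q : ℝ} {C : ℝ≥0∞}

/-- finite-dimensional duality -/
theorem dual_block (S : Setup μ G Q W p q C) {θ Z : ℝ}
    (hZ : ∀ f : ℝ → ℝ, Measurable f → ∫⁻ s, ‖f s‖ₑ ^ p ∂unif01 ≠ ⊤ →
      (∀ s, gammaBeta μ (f s) ≠ ⊤) →
      ∫⁻ s, gammaBeta μ (f s) ∂unif01 ≠ ⊤ →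
      θ * G1 G W f - (∫⁻ s, gammaBeta μ (f s) ∂unif01).toReal ≤ Z)
    {k : ℕ} [NeZero k] (y : Fin k → ℝ) {ε : ℝ} (hε : 0 < ε) :
    ∃ t : Fin k → ℝ, θ * G1 G W (fun s => y (idx k s)) -
      (k : ℝ)⁻¹ * ∑ l, (t l * y l - cgf' μ (t l)) ≤ Z + ε := by
  have hk : (0 : ℝ) < k := by exact_mod_cast Nat.pos_of_ne_zero (NeZero.ne k)
  have hτ := idx_equi k
  set g := θ * G1 G W (fun s => y (idx k s)) with hg
  choose t h0 h1 h2 using fun l => dual_one (μ := μ) hε (k * (g - Z)) (y l)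
  refine ⟨t, ?_⟩
  by_cases hfin : ∀ l, gammaBeta μ (y l) ≠ ⊤
  · have e := lint_cells unif01 hτ.1 (by simpa using hτ.2) (fun i => gammaBeta μ (y i))
    have hne : ∀ i ∈ Finset.univ, ((Fintype.card (Fin k) : ℝ≥0∞)⁻¹) * gammaBeta μ (y i) ≠ ⊤ :=
      fun i _ => ENNReal.mul_ne_top (by simp [NeZero.ne k]) (hfin i)
    have hI : ∫⁻ s, gammaBeta μ (y (idx k s)) ∂unif01 ≠ ⊤ := by
      rw [e]; exact ENNReal.sum_ne_top.2 hne
    have hz := hZ (fun s => y (idx k s)) ((measurable_of_countable y).comp hτ.1)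
      (by rw [lint_pow hτ S.hpq.pos]; exact ENNReal.ofReal_ne_top) (fun s => hfin _) hI
    rw [e, ENNReal.toReal_sum hne] at hz
    simp only [ENNReal.toReal_mul, Fintype.card_fin, ENNReal.toReal_inv,
      ENNReal.toReal_natCast] at hz
    rw [← Finset.mul_sum] at hz
    have hs : ∑ l, ((gammaBeta μ (y l)).toReal - ε) ≤ ∑ l, (t l * y l - cgf' μ (t l)) :=
      Finset.sum_le_sum fun l _ => h1 l (hfin l)
    rw [Finset.sum_sub_distrib] at hs
    simp only [Finset.sum_const, Finset.card_univ, Fintype.card_fin, nsmul_eq_mul] at hs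
    have := mul_le_mul_of_nonneg_left hs (inv_nonneg.2 hk.le)
    rw [mul_sub, inv_mul_cancel_left₀ hk.ne'] at this
    linarith
  · push Not at hfin
    obtain ⟨l, hl⟩ := hfin
    have hs : k * (g - Z) ≤ ∑ l, (t l * y l - cgf' μ (t l)) :=
      (h2 l hl).trans (Finset.single_le_sum (f := fun l => t l * y l - cgf' μ (t l))
        (fun i _ => h0 i) (Finset.mem_univ l))
    have := mul_le_mul_of_nonneg_left hs (inv_nonneg.2 hk.le)
    rw [inv_mul_cancel_left₀ hk.ne'] at this
    linarith

theorem emp_cont {k : ℕ} {h : ℝ → ℝ} (hh : Continuous h) :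
    Continuous fun y : Fin k → ℝ => emp h y := by
  unfold emp
  exact continuous_const.mul (continuous_finset_sum _ fun i _ => hh.comp (continuous_apply i))

theorem tail_cont {p : ℝ} (hp : 0 < p) (M : ℝ) :
    Continuous fun y : ℝ => (max (|y| - M) 0) ^ p :=
  ((continuous_abs.sub continuous_const).max continuous_const).rpow_const fun _ => Or.inr hp.le

theorem K_compact {k : ℕ} [NeZero k] {p : ℝ} (hp : 1 ≤ p) (L b M : ℝ) :
    IsCompact {y : Fin k → ℝ | emp (fun y => |y| ^ p) y ≤ L ∧
      emp (fun y => (max (|y| - M) 0) ^ p) y ≤ b} := by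
  have hk : (0 : ℝ) < k := by exact_mod_cast Nat.pos_of_ne_zero (NeZero.ne k)
  have hp0 : 0 < p := by linarith
  refine Metric.isCompact_of_isClosed_isBounded ?_ ?_
  · refine IsClosed.inter (isClosed_le (emp_cont (continuous_abs.rpow_const fun _ => Or.inr hp0.le))
      continuous_const) (isClosed_le (emp_cont (tail_cont hp0 M)) continuous_const)
  · refine (Metric.isBounded_closedBall (x := (0 : Fin k → ℝ)) (r := 1 + k * max L 0)).subset ?_
    rintro y ⟨hy, -⟩
    rw [mem_closedBall_zero_iff, pi_norm_le_iff_of_nonneg (by positivity)]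
    intro i
    rw [Real.norm_eq_abs]
    have h1 : |y i| ≤ 1 + |y i| ^ p := by
      have h0 : 0 ≤ |y i| ^ p := by positivity
      rcases le_total |y i| 1 with h | h
      · linarith
      · have := Real.rpow_le_rpow_of_exponent_le h hp
        rw [Real.rpow_one] at this
        linarith
    have h2 : |y i| ^ p ≤ ∑ i, |y i| ^ p :=
      Finset.single_le_sum (f := fun i => |y i| ^ p) (fun i _ => by positivity) (Finset.mem_univ i)
    unfold emp at hy
    rw [inv_mul_le_iff₀ hk] at hy
    have h3 : k * L ≤ k * max L 0 := by gcongr; exact le_max_left _ _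
    linarith

theorem Vstat_cont {k : ℕ} (G : SimpleGraph (Fin v)) [DecidableRel G.Adj] (U : Fin k → Fin k → ℝ) :
    Continuous (Vstat G (fun y : Fin v → ℝ => ∏ a, y a) k U) := by
  unfold Vstat
  refine Continuous.div_const (continuous_finset_sum _ fun i _ => Continuous.mul ?_
    continuous_const) _
  exact continuous_finset_prod _ fun a _ => continuous_apply (i a)

theorem cover (S : Setup μ G Q W p q C) {θ Z : ℝ}
    (hZ : ∀ f : ℝ → ℝ, Measurable f → ∫⁻ s, ‖f s‖ₑ ^ p ∂unif01 ≠ ⊤ →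
      (∀ s, gammaBeta μ (f s) ≠ ⊤) →
      ∫⁻ s, gammaBeta μ (f s) ∂unif01 ≠ ⊤ →
      θ * G1 G W f - (∫⁻ s, gammaBeta μ (f s) ∂unif01).toReal ≤ Z)
    {k : ℕ} [NeZero k] {ε : ℝ} (hε : 0 < ε) (U : Fin k → Fin k → ℝ) (L b M : ℝ)
    (hU : ∀ y : Fin k → ℝ, emp (fun y => |y| ^ p) y ≤ L →
      emp (fun y => (max (|y| - M) 0) ^ p) y ≤ b →
      θ * Vstat G (fun y : Fin v → ℝ => ∏ a, y a) k U y ≤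
        θ * G1 G W (fun s => y (idx k s)) + ε) :
    ∃ T : Finset (Fin k → ℝ), ∀ y : Fin k → ℝ, emp (fun y => |y| ^ p) y ≤ L →
      emp (fun y => (max (|y| - M) 0) ^ p) y ≤ b → ∃ t ∈ T,
      θ * Vstat G (fun y : Fin v → ℝ => ∏ a, y a) k U y ≤ Z + 3 * ε +
        (k : ℝ)⁻¹ * ∑ l, (t l * y l - cgf' μ (t l)) := by
  have hK := K_compact (k := k) S.hpq.lt.le L b M
  let O : (Fin k → ℝ) → Set (Fin k → ℝ) := fun t =>
    {y | θ * Vstat G (fun y : Fin v → ℝ => ∏ a, y a) k U y <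
      Z + 3 * ε + (k : ℝ)⁻¹ * ∑ l, (t l * y l - cgf' μ (t l))}
  have hO : ∀ t, IsOpen (O t) := fun t => by
    refine isOpen_lt (continuous_const.mul (Vstat_cont G U)) ?_
    refine continuous_const.add (continuous_const.mul (continuous_finset_sum _ fun l _ => ?_))
    exact (continuous_const.mul (continuous_apply l)).sub continuous_const
  obtain ⟨T, hT⟩ := hK.elim_finite_subcover O hO (by
    rintro y ⟨h1, h2⟩
    obtain ⟨t, ht⟩ := dual_block S hZ y hε
    refine Set.mem_iUnion.2 ⟨t, ?_⟩
    have := hU y h1 h2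
    change θ * Vstat G (fun y : Fin v → ℝ => ∏ a, y a) k U y <
      Z + 3 * ε + (k : ℝ)⁻¹ * ∑ l, (t l * y l - cgf' μ (t l))
    linarith)
  refine ⟨T, fun y h1 h2 => ?_⟩
  obtain ⟨t, ht, hy⟩ := Set.mem_iUnion₂.1 (hT ⟨h1, h2⟩)
  exact ⟨t, ht, le_of_lt hy⟩

/-- Chernoff for block averages -/
theorem chernoff_block (hE : ∀ t : ℝ, Integrable (fun x => Real.exp (t * x)) μ) {n k : ℕ} [NeZero n]
    [NeZero k] {τ : ℝ → Fin n} (hτ : equi τ) (t : Fin k → ℝ) :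
    ∫⁻ x : Fin n → ℝ, ENNReal.ofReal (Real.exp (n * ((k : ℝ)⁻¹ *
      ∑ l, t l * cavg (idx k) (fun s => x (τ s)) l))) ∂(Measure.pi fun _ => μ) ≤
      ENNReal.ofReal (Real.exp (n * ((k : ℝ)⁻¹ * ∑ l, cgf' μ (t l)))) := by
  have hn : (0 : ℝ) < n := by exact_mod_cast Nat.pos_of_ne_zero (NeZero.ne n)
  have hk : (0 : ℝ) < k := by exact_mod_cast Nat.pos_of_ne_zero (NeZero.ne k)
  have hκ := idx_equi k
  let w : Fin k → Fin n → ℝ := fun l i => unif01.real (idx k ⁻¹' {l} ∩ τ ⁻¹' {i})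
  have hm : ∀ l i, MeasurableSet (idx k ⁻¹' {l} ∩ τ ⁻¹' {i}) := fun l i =>
    (hκ.1 (measurableSet_singleton l)).inter (hτ.1 (measurableSet_singleton i))
  have hY : ∀ (x : Fin n → ℝ) l, cavg (idx k) (fun s => x (τ s)) l = k * ∑ i, w l i * x i := by
    intro x l
    unfold cavg
    congr 1
    have e : (fun s => if idx k s = l then x (τ s) else 0) =
        fun s => ∑ i, (idx k ⁻¹' {l} ∩ τ ⁻¹' {i}).indicator (fun _ => x i) s := by
      funext s
      rw [Finset.sum_eq_single (τ s)]
      · by_cases h : idx k s = l <;> simp [h]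
      · intro i _ hi
        exact Set.indicator_of_notMem (fun h => hi h.2.symm) _
      · simp
    rw [e, integral_finsetSum _ fun i _ => (integrable_const _).indicator (hm l i)]
    refine Finset.sum_congr rfl fun i _ => ?_
    rw [integral_indicator (hm l i), setIntegral_const, smul_eq_mul]
  have hw1 : ∀ i, ∑ l, n * w l i = 1 := by
    intro i
    rw [← Finset.mul_sum]
    have : ∑ l, w l i = unif01.real (τ ⁻¹' {i}) := by
      have h := measureReal_biUnion_finset (μ := unif01) (s := Finset.univ)
        (f := fun l => idx k ⁻¹' {l} ∩ τ ⁻¹' {i}) (by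
          intro a _ c _ hac
          rw [Function.onFun, Set.disjoint_left]
          rintro s ⟨h1, -⟩ ⟨h2, -⟩
          exact hac (h1.symm.trans h2)) (fun l _ => hm l i)
      rw [← h]
      congr 1
      ext s; simp
    rw [this, measureReal_def, hτ.2]
    simp [hn.ne']
  have hw2 : ∀ l, ∑ i, w l i = (k : ℝ)⁻¹ := by
    intro l
    have : ∑ i, w l i = unif01.real (idx k ⁻¹' {l}) := by
      have h := measureReal_biUnion_finset (μ := unif01) (s := Finset.univ)
        (f := fun i => idx k ⁻¹' {l} ∩ τ ⁻¹' {i}) (by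
          intro a _ c _ hac
          rw [Function.onFun, Set.disjoint_left]
          rintro s ⟨-, h1⟩ ⟨-, h2⟩
          exact hac (h1.symm.trans h2)) (fun i _ => hm l i)
      rw [← h]
      congr 1
      ext s; simp
    rw [this, measureReal_def, hκ.2]
    simp
  have e1 : ∀ x : Fin n → ℝ, n * ((k : ℝ)⁻¹ *
      ∑ l, t l * cavg (idx k) (fun s => x (τ s)) l) = ∑ i, (∑ l, (n * w l i) * t l) * x i := by
    intro x
    simp_rw [hY, Finset.sum_mul]
    rw [Finset.sum_comm, Finset.mul_sum, Finset.mul_sum]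
    refine Finset.sum_congr rfl fun l _ => ?_
    rw [Finset.mul_sum, Finset.mul_sum, Finset.mul_sum, Finset.mul_sum]
    refine Finset.sum_congr rfl fun i _ => ?_
    field_simp
  simp_rw [e1]
  rw [chernoff hE]
  refine ENNReal.ofReal_le_ofReal (Real.exp_le_exp.2 ?_)
  calc ∑ i, cgf' μ (∑ l, (n * w l i) * t l) ≤ ∑ i, ∑ l, (n * w l i) * cgf' μ (t l) :=
        Finset.sum_le_sum fun i _ => cgf_convex hE _ _ _ (fun l _ => by positivity) (hw1 i)
    _ = _ := by
        rw [Finset.sum_comm, Finset.mul_sum, Finset.mul_sum]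
        refine Finset.sum_congr rfl fun l _ => ?_
        rw [← Finset.sum_mul, ← Finset.mul_sum, hw2]; ring

end

end MGL

namespace MGL

section
variable {μ : Measure ℝ} [IsProbabilityMeasure μ] {v : ℕ} {G : SimpleGraph (Fin v)}
  [DecidableRel G.Adj] {Q : ∀ n : ℕ, Fin n → Fin n → ℝ} {W : ℝ → ℝ → ℝ} {p q : ℝ} {C : ℝ≥0∞}

theorem tail_lmom (S : Setup μ G Q W p q C) {K lam : ℝ} (hK : 0 < K) (hl : 0 < lam) :
    ∃ M : ℝ, 1 ≤ M ∧
      ∫⁻ x, ENNReal.ofReal (Real.exp (K * |x| ^ p + lam * (max (|x| - M) 0) ^ p)) ∂μ ≤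
        ENNReal.ofReal (Real.exp (lmom μ (fun y => K * |y| ^ p) + 1)) := by
  have hp := S.hpq.pos
  have hl' : Tendsto (fun k : ℕ => ∫⁻ x, ENNReal.ofReal
      (Real.exp (K * |x| ^ p + lam * (max (|x| - k) 0) ^ p)) ∂μ) atTop
      (nhds (∫⁻ x, ENNReal.ofReal (Real.exp (K * |x| ^ p)) ∂μ)) := by
    refine tendsto_lintegral_of_dominated_convergence
      (fun x => ENNReal.ofReal (Real.exp ((K + lam) * |x| ^ p)))
      (fun k => ?_)
      (fun k => ae_of_all _ fun x => ?_) (S.hT _ (by positivity)).ne (ae_of_all _ fun x => ?_)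
    · have := (tail_cont hp (k : ℝ)).measurable
      exact ((powm K p).add (this.const_mul lam)).exp.ennreal_ofReal
    · refine ENNReal.ofReal_le_ofReal (Real.exp_le_exp.2 ?_)
      rw [add_mul]
      have hmx : max (|x| - (k : ℝ)) 0 ≤ |x| := max_le (by simp) (abs_nonneg _)
      have : (max (|x| - (k : ℝ)) 0) ^ p ≤ |x| ^ p :=
        Real.rpow_le_rpow (le_max_right _ _) hmx hp.le
      nlinarith
    · refine tendsto_const_nhds.congr' ?_
      obtain ⟨N, hN⟩ := exists_nat_ge |x|
      filter_upwards [eventually_ge_atTop N] with k hk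
      have : |x| - (k : ℝ) ≤ 0 := by
        have : (N : ℝ) ≤ k := by exact_mod_cast hk
        linarith
      rw [max_eq_right this, Real.zero_rpow hp.ne']
      simp
  rw [lmom_spec (powm K p) (S.hT K hK)] at hl'
  have hlt : ENNReal.ofReal (Real.exp (lmom μ (fun y => K * |y| ^ p))) <
      ENNReal.ofReal (Real.exp (lmom μ (fun y => K * |y| ^ p) + 1)) :=
    (ENNReal.ofReal_lt_ofReal_iff (Real.exp_pos _)).2 (Real.exp_lt_exp.2 (by linarith))
  obtain ⟨k, h1, h2⟩ := ((hl'.eventually_lt_const hlt).and (eventually_ge_atTop 1)).exists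
  exact ⟨k, by exact_mod_cast h2, h1.le⟩

theorem Setup.bavgLrB (S : Setup μ G Q W p q C) (k : ℕ) [NeZero k] :
    LrB (q * G.maxDegree) C (ker (idx k) (bavg (idx k) W)) := by
  have hκ := idx_equi k
  by_cases h : G.maxDegree = 0
  · refine ⟨ker_meas hκ.1 _, ?_⟩
    simp only [h, Nat.cast_zero, mul_zero, ENNReal.rpow_zero, lintegral_one, measure_univ]
    exact S.hC
  · refine bavg_LrB hκ ?_ S.hW S.hWi
    have h1 : (1 : ℝ) ≤ G.maxDegree := by exact_mod_cast Nat.one_le_iff_ne_zero.2 h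
    have h2 := S.hpq.symm.lt
    nlinarith

/-- truncation bound, pointwise split -/
theorem upper (S : Setup μ G Q W p q C) {θ Z : ℝ}
    (hZ : ∀ f : ℝ → ℝ, Measurable f → ∫⁻ s, ‖f s‖ₑ ^ p ∂unif01 ≠ ⊤ →
      (∀ s, gammaBeta μ (f s) ≠ ⊤) →
      ∫⁻ s, gammaBeta μ (f s) ∂unif01 ≠ ⊤ →
      θ * G1 G W f - (∫⁻ s, gammaBeta μ (f s) ∂unif01).toReal ≤ Z)
    {ε : ℝ} (hε : 0 < ε) :
    ∀ᶠ n : ℕ in atTop, Zn μ G Q θ n ≤ Z + 7 * ε := by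
  have hp := S.hpq.pos
  have hp1 := S.hpq.lt.le
  set K := KC G q C θ with hKdef
  have hK : 0 < K := KC_pos θ
  set L := |K + lmom μ (fun y => (K + 1) * |y| ^ p) - Z| with hLdef
  have hL0 : 0 ≤ L := abs_nonneg _
  have hL : K + lmom μ (fun y => (K + 1) * |y| ^ p) - L ≤ Z := by
    have := le_abs_self (K + lmom μ (fun y => (K + 1) * |y| ^ p) - Z)
    linarith
  set ε' := ε / (|θ| + 1) with hε'def
  have hε' : 0 < ε' := by positivity
  have hθ : ∀ a c : ℝ, |a - c| ≤ ε' → θ * a ≤ θ * c + ε := by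
    intro a c h
    have : θ * (a - c) ≤ ε := by
      calc θ * (a - c) ≤ |θ * (a - c)| := le_abs_self _
        _ = |θ| * |a - c| := abs_mul _ _
        _ ≤ (|θ| + 1) * (ε / (|θ| + 1)) := by gcongr; linarith
        _ = ε := by field_simp
    linarith
  obtain ⟨b, hb, H⟩ := Ustat_approx G S.hpq C S.hC S.hC' (ENNReal.ofReal L) ENNReal.ofReal_ne_top
    ε' hε'
  set R := lmom μ (fun y => K * |y| ^ p) + 1 with hR
  set lam := |K + R - Z| / b + 1 with hlamdef
  have hlam : 0 < lam := by positivity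
  have hlamb : K + R - lam * b ≤ Z := by
    have h1 := le_abs_self (K + R - Z)
    have h2 : lam * b = |K + R - Z| + b := by rw [hlamdef]; field_simp
    linarith
  obtain ⟨M, hM, hMt⟩ := tail_lmom S hK hlam
  obtain ⟨η, hη, ⟨n0, h1⟩, h2⟩ := H M hM
  obtain ⟨k0, hk0⟩ := bavg_L1 S.hW.1 S.hWi hη
  have hk1 := hk0 (k0 + 1) (by omega)
  set k := k0 + 1 with hk
  have hκ := idx_equi k
  set Wk := ker (idx k) (bavg (idx k) W) with hWk
  have hWkL : LrB (q * G.maxDegree) C Wk := S.bavgLrB k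
  have hWcut : cutB η (fun s t => W s t - Wk s t) := by
    have hi : Integrable (Function.uncurry fun s t => W s t - Wk s t) (unif01.prod unif01) :=
      S.hWi.sub (ker_integrable hκ.1 _)
    refine cutB_of_L1 hi ?_
    rw [← ENNReal.ofReal_le_ofReal_iff hη.le,
      ofReal_integral_eq_lintegral_ofReal hi.abs (ae_of_all _ fun _ => abs_nonneg _)]
    refine le_trans (le_of_eq (lintegral_congr fun z => ?_)) hk1
    rw [← Real.enorm_eq_ofReal_abs, ← enorm_neg]
    simp [Function.uncurry, Wk]
  have hcls : ∀ {n : ℕ} [NeZero n] {τ : ℝ → Fin n} (_ : equi τ) (x : Fin n → ℝ),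
      emp (fun y => |y| ^ p) x ≤ L → emp (fun y => (max (|y| - M) 0) ^ p) x ≤ b →
      inCls p (ENNReal.ofReal L) (ENNReal.ofReal b) M (fun s => x (τ s)) := by
    intro n _ τ hτ x hA hB
    refine ⟨(measurable_of_countable x).comp hτ.1, ?_, ?_⟩
    · rw [lint_pow hτ hp]; exact ENNReal.ofReal_le_ofReal hA
    · rw [lint_tail hτ hp]; exact ENNReal.ofReal_le_ofReal hB
  have hclsE : ∀ {n : ℕ} [NeZero n] {τ : ℝ → Fin n} (_ : equi τ) (x : Fin n → ℝ),
      inCls p (ENNReal.ofReal L) (ENNReal.ofReal b) M (fun s => x (τ s)) →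
      emp (fun y => |y| ^ p) x ≤ L ∧ emp (fun y => (max (|y| - M) 0) ^ p) x ≤ b := by
    intro n _ τ hτ x hx
    have ha := hx.2.1
    have hb' := hx.2.2
    rw [lint_pow hτ hp] at ha
    rw [lint_tail hτ hp] at hb'
    exact ⟨(ENNReal.ofReal_le_ofReal_iff hL0).1 ha, (ENNReal.ofReal_le_ofReal_iff hb.le).1 hb'⟩
  obtain ⟨T, hT⟩ := cover S hZ hε (bavg (idx k) W) L b M (by
    intro y hA hB
    refine hθ _ _ ?_
    rw [Vstat_eq G hκ, abs_sub_comm]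
    exact h2 _ _ S.hW hWkL hWcut _ (hcls hκ y hA hB))
  have hNlim : ∀ᶠ n : ℕ in atTop, Real.log (T.card + 2) ≤ n * ε := by
    have : Tendsto (fun n : ℕ => (n : ℝ) * ε) atTop atTop :=
      tendsto_natCast_atTop_atTop.atTop_mul_const hε
    exact this.eventually_ge_atTop _
  filter_upwards [S.happ η hη, eventually_gt_atTop 0, eventually_ge_atTop n0, hNlim]
    with n hn hn0 hn1 hn2
  have : NeZero n := ⟨hn0.ne'⟩
  have hnpos : (0 : ℝ) < n := by exact_mod_cast hn0
  obtain ⟨τ, hτ, hQ, hcut⟩ := hn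
  refine (ZnGen_le (μ := μ) (fun n => Ustat G (fun y : Fin v → ℝ => ∏ a, y a) n (Q n)) n
    (Ustat_meas G (Q n)) θ _ ?_).2
  have good : ∀ x : Fin n → ℝ, emp (fun y => |y| ^ p) x ≤ L →
      emp (fun y => (max (|y| - M) 0) ^ p) x ≤ b → ∃ t ∈ T,
      θ * Ustat G (fun y : Fin v → ℝ => ∏ a, y a) n (Q n) x ≤ Z + 6 * ε +
        (k : ℝ)⁻¹ * ∑ l, (t l * cavg (idx k) (fun s => x (τ s)) l - cgf' μ (t l)) := by
    intro x hA hB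
    have hx := hcls hτ x hA hB
    obtain ⟨hA', hB'⟩ := hclsE hκ (cavg (idx k) fun s => x (τ s))
      (inCls_cavg hκ hp1 hx ENNReal.ofReal_ne_top)
    obtain ⟨t, ht, hy⟩ := hT _ hA' hB'
    refine ⟨t, ht, ?_⟩
    have e1 := hθ _ _ (h1 n hn1 τ hτ (Q n) hQ x hx)
    rw [Vstat_eq G hτ] at e1
    have e2 := hθ _ _ (h2 _ _ hQ S.hW hcut _ hx)
    have e3 := hθ _ _ (h2 _ _ S.hW hWkL hWcut _ hx)
    rw [hWk, G1_block G hκ.1 _ _ (comp_integrable hτ.1 x)] at e3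
    linarith
  let F1 : (Fin k → ℝ) → (Fin n → ℝ) → ℝ≥0∞ := fun t x =>
    ENNReal.ofReal (Real.exp (n * (Z + 6 * ε - (k : ℝ)⁻¹ * ∑ l, cgf' μ (t l)))) *
    ENNReal.ofReal (Real.exp (n * ((k : ℝ)⁻¹ * ∑ l, t l * cavg (idx k) (fun s => x (τ s)) l)))
  let F2 : (Fin n → ℝ) → ℝ≥0∞ := fun x =>
    ENNReal.ofReal (Real.exp (n * ((K - L) + emp (fun y => (K + 1) * |y| ^ p) x)))
  let F3 : (Fin n → ℝ) → ℝ≥0∞ := fun x => ENNReal.ofReal (Real.exp (n * ((K - lam * b) +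
    emp (fun y => K * |y| ^ p + lam * (max (|y| - M) 0) ^ p) x)))
  have hF2m : Measurable F2 := by
    have : Continuous fun x : Fin n → ℝ => emp (fun y => (K + 1) * |y| ^ p) x :=
      emp_cont (continuous_const.mul (continuous_abs.rpow_const fun _ => Or.inr hp.le))
    exact (measurable_const.mul (measurable_const.add this.measurable)).exp.ennreal_ofReal
  have hF3m : Measurable F3 := by
    have : Continuous fun x : Fin n → ℝ =>
        emp (fun y => K * |y| ^ p + lam * (max (|y| - M) 0) ^ p) x :=
      emp_cont ((continuous_const.mul (continuous_abs.rpow_const fun _ => Or.inr hp.le)).add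
        (continuous_const.mul (tail_cont hp M)))
    exact (measurable_const.mul (measurable_const.add this.measurable)).exp.ennreal_ofReal
  have hpt : ∀ x : Fin n → ℝ, ENNReal.ofReal (Real.exp (n * θ *
      Ustat G (fun y : Fin v → ℝ => ∏ a, y a) n (Q n) x)) ≤ (∑ t ∈ T, F1 t x) + F2 x + F3 x := by
    intro x
    have hU := S.U_le hτ hQ θ x
    by_cases hA : emp (fun y => |y| ^ p) x ≤ L
    · by_cases hB : emp (fun y => (max (|y| - M) 0) ^ p) x ≤ b
      · obtain ⟨t, ht, hle⟩ := good x hA hB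
        have : ENNReal.ofReal (Real.exp (n * θ *
            Ustat G (fun y : Fin v → ℝ => ∏ a, y a) n (Q n) x)) ≤ F1 t x := by
          simp only [F1]
          rw [← ENNReal.ofReal_mul (Real.exp_pos _).le, ← Real.exp_add, ← mul_add, mul_assoc]
          refine ENNReal.ofReal_le_ofReal (Real.exp_le_exp.2
            (mul_le_mul_of_nonneg_left (hle.trans (le_of_eq ?_)) hnpos.le))
          rw [Finset.sum_sub_distrib]; ring
        refine this.trans ((Finset.single_le_sum (f := fun t => F1 t x)
          (fun _ _ => zero_le) ht).trans ?_)
        rw [add_assoc]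
        exact le_self_add
      · refine le_trans ?_ le_add_self
        refine ENNReal.ofReal_le_ofReal (Real.exp_le_exp.2 ?_)
        rw [mul_assoc]
        refine mul_le_mul_of_nonneg_left (hU.trans ?_) hnpos.le
        rw [emp_add (fun y => K * |y| ^ p) (fun y => lam * (max (|y| - M) 0) ^ p),
          emp_smul K (fun y => |y| ^ p), emp_smul lam (fun y => (max (|y| - M) 0) ^ p)]
        push Not at hB
        nlinarith
    · refine le_trans ?_ (le_trans le_add_self le_self_add)
      refine ENNReal.ofReal_le_ofReal (Real.exp_le_exp.2 ?_)
      rw [mul_assoc]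
      refine mul_le_mul_of_nonneg_left (hU.trans ?_) hnpos.le
      rw [emp_smul (K + 1) (fun y => |y| ^ p)]
      push Not at hA
      nlinarith
  set E := ENNReal.ofReal (Real.exp (n * (Z + 6 * ε))) with hEdef
  have i1 : ∀ t, ∫⁻ x, F1 t x ∂(Measure.pi fun _ : Fin n => μ) ≤ E := by
    intro t
    simp only [F1]
    rw [lintegral_const_mul' _ _ ENNReal.ofReal_ne_top]
    refine (mul_le_mul_right (chernoff_block S.hE hτ t) _).trans ?_
    rw [← ENNReal.ofReal_mul (Real.exp_pos _).le, ← Real.exp_add, ← mul_add, sub_add_cancel]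
  have i2 : ∫⁻ x, F2 x ∂(Measure.pi fun _ : Fin n => μ) ≤ E := by
    simp only [F2]
    rw [exp_emp_le _ (powm _ _) (S.hT _ (by positivity))]
    refine ENNReal.ofReal_le_ofReal (Real.exp_le_exp.2 (mul_le_mul_of_nonneg_left ?_ hnpos.le))
    linarith
  have i3 : ∫⁻ x, F3 x ∂(Measure.pi fun _ : Fin n => μ) ≤ E := by
    simp only [F3]
    have hm3 : Measurable fun y : ℝ => K * |y| ^ p + lam * (max (|y| - M) 0) ^ p :=
      (powm K p).add ((tail_cont hp M).measurable.const_mul lam)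
    have hfin := hMt.trans_lt ENNReal.ofReal_lt_top
    rw [exp_emp_le _ hm3 hfin]
    refine ENNReal.ofReal_le_ofReal (Real.exp_le_exp.2 (mul_le_mul_of_nonneg_left ?_ hnpos.le))
    rw [lmom_spec hm3 hfin, ENNReal.ofReal_le_ofReal_iff (Real.exp_pos _).le,
      Real.exp_le_exp] at hMt
    linarith
  have hF1m : ∀ t, AEMeasurable (F1 t) (Measure.pi fun _ : Fin n => μ) := by
    intro t
    have hc : ∀ l, Measurable fun x : Fin n → ℝ => cavg (idx k) (fun s => x (τ s)) l := by
      intro l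
      unfold cavg
      refine Measurable.const_mul ?_ _
      have : (fun x : Fin n → ℝ => ∫ s, (if idx k s = l then x (τ s) else 0) ∂unif01) =
          fun x => ∑ i, (∫ s, (if idx k s = l then (if τ s = i then 1 else 0) else 0) ∂unif01)
            * x i := by
        funext x
        have e : (fun s => if idx k s = l then x (τ s) else 0) =
            fun s => ∑ i, (if idx k s = l then (if τ s = i then 1 else 0) else 0) * x i := by
          funext s; split_ifs <;> simp
        rw [e, integral_finsetSum]
        · exact Finset.sum_congr rfl fun i _ => integral_mul_const _ _
        · intro i _
          exact (ite_int hκ.1 (ite_int hτ.1 (integrable_const 1) i) l).mul_const _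
      rw [this]
      exact Finset.measurable_sum _ fun i _ => (measurable_pi_apply i).const_mul _
    refine (Measurable.const_mul ?_ _).aemeasurable
    refine ((((Finset.measurable_sum _ fun l _ => (hc l).const_mul (t l))).const_mul
      _).const_mul _).exp.ennreal_ofReal
  calc _ ≤ ∫⁻ x, ((∑ t ∈ T, F1 t x) + F2 x + F3 x) ∂(Measure.pi fun _ : Fin n => μ) :=
        lintegral_mono hpt
    _ = (∑ t ∈ T, ∫⁻ x, F1 t x ∂(Measure.pi fun _ : Fin n => μ)) +
        ∫⁻ x, F2 x ∂(Measure.pi fun _ : Fin n => μ) +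
        ∫⁻ x, F3 x ∂(Measure.pi fun _ : Fin n => μ) := by
        rw [lintegral_add_right _ hF3m, lintegral_add_right _ hF2m,
          lintegral_finsetSum' _ fun t _ => hF1m t]
    _ ≤ (∑ _t ∈ T, E) + E + E := by gcongr with t _; exact i1 t
    _ = ENNReal.ofReal ((T.card + 2) * Real.exp (n * (Z + 6 * ε))) := by
        rw [ENNReal.ofReal_mul (by positivity), ENNReal.ofReal_add (by positivity) (by norm_num),
          ENNReal.ofReal_natCast, Finset.sum_const, nsmul_eq_mul, add_assoc, ← two_mul, add_mul]
        simp [hEdef]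
    _ ≤ ENNReal.ofReal (Real.exp (n * (Z + 7 * ε))) := by
        refine ENNReal.ofReal_le_ofReal ?_
        have hpos : (0 : ℝ) < T.card + 2 := by positivity
        rw [← Real.exp_log hpos, ← Real.exp_add]
        refine Real.exp_le_exp.2 ?_
        nlinarith

end

end MGL

/-- Theorem 1.3 (i): limit of the multilinear log-normalizing constant. -/
theorem multilinear_gibbs_log_partition_limit
    (μ : Measure ℝ) [IsProbabilityMeasure μ]
    (hnondeg : ∀ x : ℝ, μ ≠ Measure.dirac x)
    {v : ℕ} (hv : 2 ≤ v) (G : SimpleGraph (Fin v)) [DecidableRel G.Adj]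
    (Q : ∀ n : ℕ, Fin n → Fin n → ℝ)
    (hQsymm : ∀ n i j, Q n i j = Q n j i) (hQzero : ∀ n i, Q n i i = 0)
    (W : ℝ → ℝ → ℝ) (hWmeas : Measurable (Function.uncurry W))
    (hWsymm : ∀ x y, W x y = W y x) (hWL1 : kerNorm W 1 ≠ ⊤)
    (hcut : Tendsto (fun n => weakCutDist (stepKernel n (Q n)) W) atTop (nhds 0))
    (p : ℝ≥0∞) (hpv : (v : ℝ≥0∞) ≤ p) (hTail : TailCond μ (fun x => |x|) p)
    (q : ℝ≥0∞) (hq : 1 < q) (hpq : p⁻¹ + q⁻¹ ≤ 1)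
    (hnorm : Filter.atTop.limsup
        (fun n => kerNorm (stepKernel n (Q n)) (q * (G.maxDegree : ℝ≥0∞))) ≠ ⊤)
    (θ : ℝ) :
    (∀ᶠ n : ℕ in atTop,
      ∫⁻ x, ENNReal.ofReal
          (Real.exp (n * θ * Ustat G (fun y : Fin v → ℝ => ∏ a, y a) n (Q n) x))
        ∂(Measure.pi fun _ : Fin n => μ) < ⊤) ∧
    Tendsto (fun n => ZnGen μ (fun n => Ustat G (fun y : Fin v → ℝ => ∏ a, y a) n (Q n)) n θ)
      atTop (nhds (sSup (Zset1 G W μ p θ))) := by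
  have hpT : p ≠ ⊤ := by
    rintro rfl
    simp only [TailCond, if_true] at hTail
    obtain ⟨K, hK⟩ := hTail
    have := hK (|K| + 1)
    rw [abs_of_pos (by positivity)] at this
    linarith [le_abs_self K]
  simp only [TailCond, if_neg hpT] at hTail
  have hvP : (v : ℝ) ≤ p.toReal := by
    have := ENNReal.toReal_mono hpT hpv
    simpa using this
  have hv2 : (2 : ℝ) ≤ v := by exact_mod_cast hv
  set P := p.toReal with hP
  have hP1 : 1 < P := by linarith
  have hPpos : 0 < P := by linarith
  have hp0 : p ≠ 0 := by
    rintro rfl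
    simp [hP] at hPpos
  have hconj := Real.HolderConjugate.conjExponent hP1
  set q' := P.conjExponent with hq'
  have hq'pos : 0 < q' := hconj.symm.pos
  have hqq : ENNReal.ofReal q' ≤ q := by
    rw [← ENNReal.inv_le_inv]
    have h1 : p⁻¹ = ENNReal.ofReal P⁻¹ := by
      rw [ENNReal.ofReal_inv_of_pos hPpos, hP, ENNReal.ofReal_toReal hpT]
    have h2 : p⁻¹ + (ENNReal.ofReal q')⁻¹ = 1 := by
      rw [h1, ← ENNReal.ofReal_inv_of_pos hq'pos, ← ENNReal.ofReal_add (by positivity)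
        (by positivity), hconj.inv_add_inv_eq_one, ENNReal.ofReal_one]
    rw [← h2] at hpq
    exact (ENNReal.add_le_add_iff_left (by simp [hp0])).1 hpq
  obtain ⟨C, hC, hC', happ⟩ := MGL.kernels_approx Q W hWmeas hWL1 hcut G.maxDegree q q' hq'pos
    hqq hnorm
  have hWi : Integrable (Function.uncurry W) (unif01.prod unif01) := by
    rw [← memLp_one_iff_integrable]
    exact ⟨hWmeas.aestronglyMeasurable, hWL1.lt_top⟩
  have hWL : MGL.LrB (q' * G.maxDegree) C W := by
    by_cases h : G.maxDegree = 0
    · refine ⟨hWmeas, ?_⟩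
      simp only [h, Nat.cast_zero, mul_zero, ENNReal.rpow_zero, lintegral_one, measure_univ]
      exact hC
    · refine MGL.LrB_limit ?_ hC' hWmeas hWi fun η hη => ?_
      · have h1 : (1 : ℝ) ≤ G.maxDegree := by exact_mod_cast Nat.one_le_iff_ne_zero.2 h
        have h2 := hconj.symm.lt
        nlinarith
      · obtain ⟨n, hn, hn0⟩ := ((happ η hη).and (eventually_gt_atTop 0)).exists
        have : NeZero n := ⟨hn0.ne'⟩
        obtain ⟨τ, -, h1, h2⟩ := hn
        exact ⟨_, h1, h2⟩
  have S : MGL.Setup μ G Q W P q' C :=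
    ⟨hnondeg, hconj, hvP, hC, hC', hTail, hWL, hWi, happ⟩
  have hLp : ∀ f : ℝ → ℝ, eLpNorm f p unif01 < ⊤ ↔ ∫⁻ s, ‖f s‖ₑ ^ P ∂unif01 ≠ ⊤ := fun f => by
    rw [eLpNorm_lt_top_iff_lintegral_rpow_enorm_lt_top hp0 hpT, lt_top_iff_ne_top]
  have hmem : ∀ f : ℝ → ℝ, Measurable f → ∫⁻ s, ‖f s‖ₑ ^ P ∂unif01 ≠ ⊤ →
      (∀ s, gammaBeta μ (f s) ≠ ⊤) → ∫⁻ s, gammaBeta μ (f s) ∂unif01 ≠ ⊤ →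
      θ * G1 G W f - (∫⁻ s, gammaBeta μ (f s) ∂unif01).toReal ∈ Zset1 G W μ p θ :=
    fun f hf hL hg hI => ⟨f, ⟨hf, fun s _ => MGL.mem_closure_Ncal S.hE hnondeg (hg s),
      (hLp f).2 hL⟩, hI, rfl⟩
  have hbdd : BddAbove (Zset1 G W μ p θ) := by
    refine ⟨MGL.KC G q' C θ + MGL.lmom μ (fun y => MGL.KC G q' C θ * |y| ^ P), ?_⟩
    rintro z ⟨f, ⟨hf, -, hL⟩, hI, rfl⟩
    exact MGL.val_bdd S θ hf ((hLp f).1 hL) hI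
  have hne : (Zset1 G W μ p θ).Nonempty := by
    refine ⟨_, hmem (fun _ => ∫ x, x ∂μ) measurable_const ?_ ?_ ?_⟩
    · rw [lintegral_const]
      simpa using fun _ => hPpos.le
    · intro s; rw [MGL.gamma_mean S.hE]; simp
    · simp [MGL.gamma_mean S.hE]
  refine ⟨?_, ?_⟩
  · filter_upwards [S.happ 1 one_pos, eventually_gt_atTop 0] with n hn hn0
    have : NeZero n := ⟨hn0.ne'⟩
    obtain ⟨τ, hτ, hQ, -⟩ := hn
    exact (S.finite hτ hQ θ).trans_lt ENNReal.ofReal_lt_top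
  · refine tendsto_order.2 ⟨fun a ha => ?_, fun a ha => ?_⟩
    · obtain ⟨z, ⟨f, ⟨hf, -, hL⟩, hI, rfl⟩, hz⟩ := exists_lt_of_lt_csSup hne ha
      filter_upwards [MGL.lower S θ hf ((hLp f).1 hL) hI (half_pos (sub_pos.2 hz))] with n hn
      have : a < MGL.Zn μ G Q θ n := by linarith
      exact this
    · have hε : 0 < (a - sSup (Zset1 G W μ p θ)) / 8 := by linarith
      filter_upwards [MGL.upper S (fun f hf hL hg hI => le_csSup hbdd (hmem f hf hL hg hI)) hε]
        with n hn
      have : MGL.Zn μ G Q θ n < a := by linarith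
      exact this
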